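/- Main theorem. Under the standing assumptions, with u₀∈BUC(ℝⁿ;ℝ^m) and u̲₀=min_{1≤k≤m}u_{k,0}: for each ω∈Ω₃ (the full-probability set on which δv^δ_1 converges locally uniformly at scale 1/δ to −H̄), the solutions u^ε of the ε-system satisfy, as ε→0 and for each k∈{1,…,m}, u^ε_k → ū locally uniformly on ℝⁿ×(0,∞), where ū is the unique viscosity solution of the deterministic scalar equation ū_t + H̄(Dū, ū)=0 on ℝⁿ×(0,∞) with ū=u̲₀ on ℝⁿ×{0}. -/

import Mathlib

open Filter Topology Matrix

noncomputable section

/-- Euclidean space ℝⁿ. -/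
abbrev Euc (n : ℕ) := EuclideanSpace ℝ (Fin n)

/-- The Hessian matrix of a (test) function `φ : ℝⁿ → ℝ` at a point `y`. -/
def hess {n : ℕ} (φ : Euc n → ℝ) (y : Euc n) : Matrix (Fin n) (Fin n) ℝ :=
  fun i j =>
    iteratedFDeriv ℝ 2 φ y ![EuclideanSpace.single i (1 : ℝ), EuclideanSpace.single j (1 : ℝ)]

/-- `max_{i ≠ k} (s i)₊`, the positive-part maximum over the indices other than `k`. -/
def posMaxOff {m : ℕ} (k : Fin m) (s : Fin m → ℝ) : ℝ :=
  (((Finset.univ.erase k).sup fun i => (s i).toNNReal : NNReal) : ℝ)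

/-- `v` is a viscosity subsolution on `U` of the system `G_k(y, v(y), Dv_k, D²v_k) = 0`,
`k = 1, …, m`. -/
def IsViscSubOn {n m : ℕ}
    (G : Fin m → Euc n → (Fin m → ℝ) → Euc n → Matrix (Fin n) (Fin n) ℝ → ℝ)
    (U : Set (Euc n)) (v : Fin m → Euc n → ℝ) : Prop :=
  ∀ k : Fin m, ∀ φ : Euc n → ℝ, ContDiff ℝ 2 φ →
    ∀ y₀ ∈ U, IsLocalMaxOn (fun y => v k y - φ y) U y₀ →
      G k y₀ (fun j => v j y₀) (gradient φ y₀) (hess φ y₀) ≤ 0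

/-- `v` is a viscosity supersolution on `U` of the system `G_k(y, v(y), Dv_k, D²v_k) = 0`. -/
def IsViscSupOn {n m : ℕ}
    (G : Fin m → Euc n → (Fin m → ℝ) → Euc n → Matrix (Fin n) (Fin n) ℝ → ℝ)
    (U : Set (Euc n)) (v : Fin m → Euc n → ℝ) : Prop :=
  ∀ k : Fin m, ∀ φ : Euc n → ℝ, ContDiff ℝ 2 φ →
    ∀ y₀ ∈ U, IsLocalMinOn (fun y => v k y - φ y) U y₀ →
      0 ≤ G k y₀ (fun j => v j y₀) (gradient φ y₀) (hess φ y₀)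

/-- Viscosity solution of the system `G_k = 0` on `U`. -/
def IsViscSolnOn {n m : ℕ}
    (G : Fin m → Euc n → (Fin m → ℝ) → Euc n → Matrix (Fin n) (Fin n) ℝ → ℝ)
    (U : Set (Euc n)) (v : Fin m → Euc n → ℝ) : Prop :=
  IsViscSubOn G U v ∧ IsViscSupOn G U v

/-- The standing assumptions: a probability space `(Ω, 𝓕, P)` with an ergodic group
`(τ_y)` of measure-preserving transformations, diffusion matrices `A_k = Σ_k Σ_kᵗ` and
Hamiltonians `H_k(p, r, s, y, ω)`, stationary, convex and coercive in `(p, s)`, monotone,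
bounded on bounded sets and locally Lipschitz continuous.  The difference variable
`s ∈ ℝ^{m-1}` is encoded as a vector `s : Fin m → ℝ` whose `k`-th entry is irrelevant
(it is always `0 = v_k - v_k` when evaluated on differences). -/
structure Setting (n m : ℕ) where
  Ω : Type
  [mΩ : MeasurableSpace Ω]
  P : MeasureTheory.Measure Ω
  [probP : MeasureTheory.IsProbabilityMeasure P]
  τ : Euc n → Ω → Ω
  A : Fin m → Euc n → Ω → Matrix (Fin n) (Fin n) ℝ
  Sig : Fin m → Euc n → Ω → Matrix (Fin n) (Fin n) ℝ
  H : Fin m → Euc n → (Fin m → ℝ) → (Fin m → ℝ) → Euc n → Ω → ℝ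
  γ : Fin m → ℝ
  τ_zero : τ 0 = id
  τ_add : ∀ y z : Euc n, τ (y + z) = τ y ∘ τ z
  τ_measurePreserving : ∀ y, MeasureTheory.MeasurePreserving (τ y) P P
  ergodic : ∀ E : Set Ω, MeasurableSet E → (∀ y, τ y ⁻¹' E = E) → P E = 0 ∨ P E = 1
  A_stat : ∀ k y z ω, A k (y + z) ω = A k y (τ z ω)
  H_stat : ∀ k p r s y z ω, H k p r s (y + z) ω = H k p r s y (τ z ω)
  H_convex_p : ∀ k r s y ω, ConvexOn ℝ Set.univ fun p => H k p r s y ω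
  H_convex_s : ∀ k p r y ω, ConvexOn ℝ Set.univ fun s => H k p r s y ω
  γ_gt_one : ∀ k, 1 < γ k
  coercive : ∀ R : ℝ, 0 < R → ∃ C₁ C₂ C₃ : ℝ, 0 < C₁ ∧ 0 < C₂ ∧ 0 < C₃ ∧
    ∀ k p r s y ω, ‖r‖ ≤ R →
      C₁ * ‖p‖ ^ γ k + C₂ * posMaxOff k s - C₃ ≤ H k p r s y ω
  A_sq : ∀ k y ω, A k y ω = Sig k y ω * (Sig k y ω)ᵀ
  Sig_lip : ∃ C : ℝ, 0 < C ∧ ∀ k ω i j, (∀ y, |Sig k y ω i j| ≤ C) ∧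
    ∀ y₁ y₂, |Sig k y₁ ω i j - Sig k y₂ ω i j| ≤ C * ‖y₁ - y₂‖
  H_mono_rk : ∀ k p r s y ω t t', t ≤ t' →
    H k p (Function.update r k t) s y ω ≤ H k p (Function.update r k t') s y ω
  H_mono_s : ∀ k p r s y ω i t t', t ≤ t' →
    H k p r (Function.update s i t) y ω ≤ H k p r (Function.update s i t') y ω
  H_antitone_r : ∀ k p r s y ω i t t', i ≠ k → t ≤ t' →
    H k p (Function.update r i t') s y ω ≤ H k p (Function.update r i t) s y ω
  H_bounded : ∀ R : ℝ, 0 < R → ∃ C₄ : ℝ, 0 < C₄ ∧ ∀ k p r s y ω,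
    ‖p‖ ≤ R → ‖r‖ ≤ R → ‖s‖ ≤ R → |H k p r s y ω| ≤ C₄
  H_cont : ∀ R : ℝ, 0 < R → ∃ C₅ : ℝ, 0 < C₅ ∧ ∀ k p₁ p₂ r₁ r₂ s₁ s₂ y₁ y₂ ω,
    ‖r₁‖ ≤ R → ‖r₂‖ ≤ R → ‖s₁‖ ≤ R → ‖s₂‖ ≤ R →
    |H k p₁ r₁ s₁ y₁ ω - H k p₂ r₂ s₂ y₂ ω| ≤
      C₅ * ((1 + ‖p₁‖ + ‖p₂‖) ^ (γ k - 1) * ‖p₁ - p₂‖ + ‖r₁ - r₂‖ + ‖s₁ - s₂‖ + ‖y₁ - y₂‖)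
  H_colmon : ∀ k p (r q : Fin m → ℝ) s y ω, (∀ i, |r i - q i| ≤ r k - q k) →
    H k p q s y ω ≤ H k p r s y ω

attribute [instance] Setting.mΩ Setting.probP

open MeasureTheory

/-- The operator of the approximate macroscopic system
`δ v_k − tr(A_k(y,ω) D²v_k) + H_k(p + Dv_k, r̂, v_k − v_j, y, ω) = 0`. -/
def macroOp {n m : ℕ} (S : Setting n m) (p : Euc n) (r δ : ℝ) (ω : S.Ω) :
    Fin m → Euc n → (Fin m → ℝ) → Euc n → Matrix (Fin n) (Fin n) ℝ → ℝ :=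
  fun k y vals q X =>
    δ * vals k - (S.A k y ω * X).trace +
      S.H k (p + q) (fun _ => r) (fun j => vals k - vals j) y ω

/-- `v` is "the" solution of the approximate macroscopic system: a continuous, bounded,
Lipschitz (i.e. bounded-gradient) viscosity solution on all of `ℝⁿ`. -/
def IsMacroSoln {n m : ℕ} (S : Setting n m) (p : Euc n) (r δ : ℝ) (ω : S.Ω)
    (v : Fin m → Euc n → ℝ) : Prop :=
  (∀ k, Continuous (v k)) ∧ (∃ B : ℝ, ∀ k y, |v k y| ≤ B) ∧
  (∃ L : NNReal, ∀ k, LipschitzWith L (v k)) ∧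
  IsViscSolnOn (macroOp S p r δ ω) Set.univ v

/-- The stationary cell/metric operator at level `μ`:
`−tr(A_k(y,ω) D²v_k) + H_k(p + Dv_k, r̂, v_k − v_j, y, ω) − μ = 0`. -/
def statOp {n m : ℕ} (S : Setting n m) (p : Euc n) (r μ : ℝ) (ω : S.Ω) :
    Fin m → Euc n → (Fin m → ℝ) → Euc n → Matrix (Fin n) (Fin n) ℝ → ℝ :=
  fun k y vals q X =>
    -(S.A k y ω * X).trace +
      S.H k (p + q) (fun _ => r) (fun j => vals k - vals j) y ω - μ

/-- `u` grows at most linearly at infinity (`limsup_{|y|→∞} u(y)/|y| < ∞`). -/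
def SublinearAbove {n : ℕ} (u : Euc n → ℝ) : Prop :=
  ∃ C : ℝ, ∀ᶠ y in Bornology.cobounded (Euc n), u y ≤ C * ‖y‖

/-- `liminf_{|y|→∞} u(y)/|y| ≥ 0`. -/
def SublinearBelow {n : ℕ} (u : Euc n → ℝ) : Prop :=
  ∀ ε : ℝ, 0 < ε → ∀ᶠ y in Bornology.cobounded (Euc n), -(ε * ‖y‖) ≤ u y

/-- A Lipschitz, sublinearly growing global viscosity subsolution of the cell problem at
level `lam`. -/
def IsCellSub {n m : ℕ} (S : Setting n m) (p : Euc n) (r lam : ℝ) (ω : S.Ω)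
    (w : Fin m → Euc n → ℝ) : Prop :=
  (∃ L : NNReal, ∀ k, LipschitzWith L (w k)) ∧
  IsViscSubOn (statOp S p r lam ω) Set.univ w ∧
  ∀ k, Tendsto (fun y => w k y / ‖y‖) (Bornology.cobounded (Euc n)) (𝓝 0)

/-- `γ = min_k γ_k`. -/
def gammaMin {n m : ℕ} (S : Setting n (m + 1)) : ℝ :=
  Finset.univ.inf' ⟨0, Finset.mem_univ 0⟩ S.γ

/-- The case distinction: every `A_k` vanishes identically, or `γ > 2`. -/
def degenCase {n m : ℕ} (S : Setting n (m + 1)) : Prop :=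
  (∀ k y ω, S.A k y ω = 0) ∨ 2 < gammaMin S

open Classical in
/-- The excised set `D₁(x)`: the point `{x}` if every `A_k ≡ 0` or `γ > 2`, and the
closed unit ball `B̄₁(x)` otherwise. -/
def Dset {n m : ℕ} (S : Setting n (m + 1)) (x : Euc n) : Set (Euc n) :=
  if degenCase S then {x} else Metric.closedBall x 1

/-- `mm` solves the metric system at level `μ`, excised at `x`, with boundary data
`w(·) − w(x)` and the natural growth conditions at infinity. -/
def IsMetricSoln {n m : ℕ} (S : Setting n (m + 1)) (p : Euc n) (r μ : ℝ) (ω : S.Ω)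
    (x : Euc n) (wb : Fin (m + 1) → Euc n → ℝ) (mm : Fin (m + 1) → Euc n → ℝ) : Prop :=
  (∀ k, Continuous (mm k)) ∧
  IsViscSolnOn (statOp S p r μ ω) (Dset S x)ᶜ mm ∧
  (∀ y ∈ frontier (Dset S x), ∀ k, mm k y = wb k y - wb k x) ∧
  (∀ k, SublinearBelow (mm k)) ∧ (∀ k, SublinearAbove (mm k))

/-- `M k y x = m_{k,μ}(y, x, ω)`, the metric solution excised at `x`, extended (in the case
`A_k ≠ 0` for some `k` and `γ ≤ 2`) by `w(y) − w(x)` for `|x − y| < 1`. -/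
def IsExtMetric {n m : ℕ} (S : Setting n (m + 1)) (p : Euc n) (r μ : ℝ) (ω : S.Ω)
    (wb : Fin (m + 1) → Euc n → ℝ) (M : Fin (m + 1) → Euc n → Euc n → ℝ) : Prop :=
  (∀ x : Euc n, IsMetricSoln S p r μ ω x wb fun k y => M k y x) ∧
  (¬ degenCase S → ∀ k x y, ‖x - y‖ < 1 → M k y x = wb k y - wb k x)

/-- Scalar first-order viscosity subsolution on `U` of `G(y, u, Du) = 0`. -/
def IsViscSubOn1 {n : ℕ} (G : Euc n → ℝ → Euc n → ℝ) (U : Set (Euc n))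
    (u : Euc n → ℝ) : Prop :=
  ∀ φ : Euc n → ℝ, ContDiff ℝ 2 φ → ∀ y₀ ∈ U,
    IsLocalMaxOn (fun y => u y - φ y) U y₀ → G y₀ (u y₀) (gradient φ y₀) ≤ 0

/-- Scalar first-order viscosity supersolution on `U` of `G(y, u, Du) = 0`. -/
def IsViscSupOn1 {n : ℕ} (G : Euc n → ℝ → Euc n → ℝ) (U : Set (Euc n))
    (u : Euc n → ℝ) : Prop :=
  ∀ φ : Euc n → ℝ, ContDiff ℝ 2 φ → ∀ y₀ ∈ U,
    IsLocalMinOn (fun y => u y - φ y) U y₀ → 0 ≤ G y₀ (u y₀) (gradient φ y₀)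

/-- `M` solves the effective metric problem `H̄(p + DM, r) = μ` on `ℝⁿ ∖ {0}`, `M(0) = 0`,
subject to the growth conditions `0 ≤ liminf M/|y| ≤ limsup M/|y| < ∞`. -/
def IsEffMetricSoln {n : ℕ} (Hbar : Euc n → ℝ → ℝ) (p : Euc n) (r μ : ℝ)
    (M : Euc n → ℝ) : Prop :=
  Continuous M ∧
  IsViscSubOn1 (fun _y _val q => Hbar (p + q) r - μ) {(0 : Euc n)}ᶜ M ∧
  IsViscSupOn1 (fun _y _val q => Hbar (p + q) r - μ) {(0 : Euc n)}ᶜ M ∧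
  M 0 = 0 ∧ SublinearBelow M ∧ SublinearAbove M

/-- Spatial gradient of a space-time test function. -/
def gradX {n : ℕ} (φ : Euc n × ℝ → ℝ) (x : Euc n) (t : ℝ) : Euc n :=
  gradient (fun x' => φ (x', t)) x

/-- Spatial Hessian of a space-time test function. -/
def hessX {n : ℕ} (φ : Euc n × ℝ → ℝ) (x : Euc n) (t : ℝ) : Matrix (Fin n) (Fin n) ℝ :=
  hess (fun x' => φ (x', t)) x

/-- Time derivative of a space-time test function. -/
def derT {n : ℕ} (φ : Euc n × ℝ → ℝ) (x : Euc n) (t : ℝ) : ℝ :=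
  deriv (fun t' => φ (x, t')) t

/-- Parabolic viscosity subsolution on `U ⊆ ℝⁿ × ℝ` of the system
`G_k(x, t, u(x,t), ∂_t u_k, Du_k, D²u_k) = 0`. -/
def IsParSubOn {n m : ℕ}
    (G : Fin m → Euc n → ℝ → (Fin m → ℝ) → ℝ → Euc n → Matrix (Fin n) (Fin n) ℝ → ℝ)
    (U : Set (Euc n × ℝ)) (u : Fin m → Euc n × ℝ → ℝ) : Prop :=
  ∀ k : Fin m, ∀ φ : Euc n × ℝ → ℝ, ContDiff ℝ 2 φ → ∀ z ∈ U,
    IsLocalMaxOn (fun w => u k w - φ w) U z →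
      G k z.1 z.2 (fun j => u j z) (derT φ z.1 z.2) (gradX φ z.1 z.2) (hessX φ z.1 z.2) ≤ 0

/-- Parabolic viscosity supersolution on `U ⊆ ℝⁿ × ℝ`. -/
def IsParSupOn {n m : ℕ}
    (G : Fin m → Euc n → ℝ → (Fin m → ℝ) → ℝ → Euc n → Matrix (Fin n) (Fin n) ℝ → ℝ)
    (U : Set (Euc n × ℝ)) (u : Fin m → Euc n × ℝ → ℝ) : Prop :=
  ∀ k : Fin m, ∀ φ : Euc n × ℝ → ℝ, ContDiff ℝ 2 φ → ∀ z ∈ U,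
    IsLocalMinOn (fun w => u k w - φ w) U z →
      0 ≤ G k z.1 z.2 (fun j => u j z) (derT φ z.1 z.2) (gradX φ z.1 z.2) (hessX φ z.1 z.2)

/-- Scalar first-order parabolic viscosity subsolution on `U` of `G(x, t, u, u_t, Du) = 0`. -/
def IsParSubOn1 {n : ℕ} (G : Euc n → ℝ → ℝ → ℝ → Euc n → ℝ)
    (U : Set (Euc n × ℝ)) (u : Euc n × ℝ → ℝ) : Prop :=
  ∀ φ : Euc n × ℝ → ℝ, ContDiff ℝ 2 φ → ∀ z ∈ U,
    IsLocalMaxOn (fun w => u w - φ w) U z →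
      G z.1 z.2 (u z) (derT φ z.1 z.2) (gradX φ z.1 z.2) ≤ 0

/-- Scalar first-order parabolic viscosity supersolution on `U`. -/
def IsParSupOn1 {n : ℕ} (G : Euc n → ℝ → ℝ → ℝ → Euc n → ℝ)
    (U : Set (Euc n × ℝ)) (u : Euc n × ℝ → ℝ) : Prop :=
  ∀ φ : Euc n × ℝ → ℝ, ContDiff ℝ 2 φ → ∀ z ∈ U,
    IsLocalMinOn (fun w => u w - φ w) U z →
      0 ≤ G z.1 z.2 (u z) (derT φ z.1 z.2) (gradX φ z.1 z.2)

/-- `u` is "the" solution of the effective scalar equation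
`u_t + H̄(Du, u) = 0` on `ℝⁿ × (0,∞)`, `u = u₀` on `ℝⁿ × {0}`: bounded and uniformly
continuous on every strip `ℝⁿ × [0, T)`, a viscosity solution for `t > 0`, attaining the
initial data. -/
def IsEffSoln {n : ℕ} (Hbar : Euc n → ℝ → ℝ) (u₀ : Euc n → ℝ) (u : Euc n × ℝ → ℝ) : Prop :=
  (∀ T : ℝ, 0 < T → (∃ B : ℝ, ∀ x t, t ∈ Set.Ico (0 : ℝ) T → |u (x, t)| ≤ B) ∧
      UniformContinuousOn u (Set.univ ×ˢ Set.Ico (0 : ℝ) T)) ∧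
  IsParSubOn1 (fun _x _t val ut q => ut + Hbar q val) (Set.univ ×ˢ Set.Ioi (0 : ℝ)) u ∧
  IsParSupOn1 (fun _x _t val ut q => ut + Hbar q val) (Set.univ ×ˢ Set.Ioi (0 : ℝ)) u ∧
  ∀ x, u (x, 0) = u₀ x

/-- The operator of the oscillating ε-system:
`u_t − ε tr(A_k(x/ε,ω) D²u_k) + H_k(Du_k, u, (u_k − u_j)/ε, x/ε, ω) = 0`. -/
def epsOp {n m : ℕ} (S : Setting n (m + 1)) (ε : ℝ) (ω : S.Ω) :
    Fin (m + 1) → Euc n → ℝ → (Fin (m + 1) → ℝ) → ℝ → Euc n →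
      Matrix (Fin n) (Fin n) ℝ → ℝ :=
  fun k x _t vals ut q X =>
    ut - ε * (S.A k (ε⁻¹ • x) ω * X).trace +
      S.H k q vals (fun j => (vals k - vals j) / ε) (ε⁻¹ • x) ω

/-- `u` is the (bounded, continuous) viscosity solution of the ε-system with initial
datum `u₀`. -/
def IsEpsSoln {n m : ℕ} (S : Setting n (m + 1)) (ε : ℝ) (ω : S.Ω)
    (u₀ : Fin (m + 1) → Euc n → ℝ) (u : Fin (m + 1) → Euc n × ℝ → ℝ) : Prop :=
  (∀ k, Continuous (u k)) ∧
  (∀ T : ℝ, 0 < T → ∃ B : ℝ, ∀ k x t, t ∈ Set.Icc (0 : ℝ) T → |u k (x, t)| ≤ B) ∧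
  IsParSubOn (epsOp S ε ω) (Set.univ ×ˢ Set.Ioi (0 : ℝ)) u ∧
  IsParSupOn (epsOp S ε ω) (Set.univ ×ˢ Set.Ioi (0 : ℝ)) u ∧
  ∀ k x, u k (x, 0) = u₀ k x

section Jensen

open scoped RealInnerProductSpace

variable {E : Type*} [NormedAddCommGroup E] [InnerProductSpace ℝ E]

/-- `ξ` is a subgradient at `z` of the function `f`, with a quadratic margin `½‖·‖²`. -/
def StrongSubgrad (f : E → ℝ) (z ξ : E) : Prop :=
  ∀ z', f z + ⟪ξ, z' - z⟫ + 1 / 2 * ‖z' - z‖ ^ 2 ≤ f z'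

theorem StrongSubgrad.monotone {f : E → ℝ} {z ξ z' ξ' : E} (h : StrongSubgrad f z ξ)
    (h' : StrongSubgrad f z' ξ') : ‖z' - z‖ ^ 2 ≤ ⟪ξ' - ξ, z' - z⟫ := by
  have h1 := h z'
  have h2 := h' z
  rw [inner_sub_left]
  rw [norm_sub_rev z z', ← neg_sub z' z, inner_neg_right] at h2
  linarith

theorem StrongSubgrad.norm_sub_le {f : E → ℝ} {z ξ z' ξ' : E} (h : StrongSubgrad f z ξ)
    (h' : StrongSubgrad f z' ξ') : ‖z' - z‖ ≤ ‖ξ' - ξ‖ := by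
  have h1 := h.monotone h'
  have h2 := real_inner_le_norm (ξ' - ξ) (z' - z)
  by_contra! hc
  have : 0 ≤ ‖ξ' - ξ‖ := norm_nonneg _
  nlinarith

theorem exists_strongSubgrad_eq [FiniteDimensional ℝ E] {f : E → ℝ} (hf : Continuous f)
    (hD : ∀ z, ∃ ξ, StrongSubgrad f z ξ) (ξ : E) : ∃ z, StrongSubgrad f z ξ := by
  obtain ⟨ξ0, h0⟩ := hD 0
  obtain ⟨z, -, hz⟩ := (isCompact_closedBall (0 : E) (2 * ‖ξ0 - ξ‖ + 1)).exists_isMinOn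
    ⟨0, by simp; positivity⟩ (f := fun z => f z - ⟪ξ, z⟫) (by fun_prop)
  have hmin : ∀ z', f z - ⟪ξ, z⟫ ≤ f z' - ⟪ξ, z'⟫ := by
    intro z'
    by_cases hz' : ‖z'‖ ≤ 2 * ‖ξ0 - ξ‖ + 1
    · exact hz (by simpa using hz')
    · have h1 : f z - ⟪ξ, z⟫ ≤ f 0 - ⟪ξ, 0⟫ := hz (by simp; positivity)
      have h2 := h0 z'
      have h3 := abs_real_inner_le_norm (ξ0 - ξ) z'
      have h4 := (abs_le.1 h3).1
      simp only [sub_zero, inner_zero_right, inner_sub_left] at *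
      push Not at hz'
      nlinarith [norm_nonneg (ξ0 - ξ), norm_nonneg z']
  refine ⟨z, fun z' => ?_⟩
  set d := z' - z with hd
  have key : ∀ t : ℝ, 0 < t → t < 1 →
      f z + ⟪ξ, d⟫ + 1 / 2 * (1 - t) * ‖d‖ ^ 2 ≤ f z' := by
    intro t ht0 ht1
    obtain ⟨ξm, hm⟩ := hD (z + t • d)
    have a1 := hm z
    have a2 := hm z'
    have a3 := hmin (z + t • d)
    have e1 : z - (z + t • d) = (-t) • d := by simp
    have e2 : z' - (z + t • d) = (1 - t) • d := by rw [sub_smul, one_smul, hd]; abel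
    rw [e1, real_inner_smul_right, norm_smul, mul_pow, Real.norm_eq_abs, sq_abs] at a1
    rw [e2, real_inner_smul_right, norm_smul, mul_pow, Real.norm_eq_abs, sq_abs] at a2
    rw [inner_add_right, real_inner_smul_right] at a3
    have : t * (f z + ⟪ξ, d⟫ + 1 / 2 * (1 - t) * ‖d‖ ^ 2) ≤ t * f z' := by
      nlinarith [mul_le_mul_of_nonneg_left a1 (sub_pos.2 ht1).le,
        mul_le_mul_of_nonneg_left a2 ht0.le]
    exact le_of_mul_le_mul_left this ht0
  have hlim : Tendsto (fun t : ℝ => f z + ⟪ξ, d⟫ + 1 / 2 * (1 - t) * ‖d‖ ^ 2) (𝓝[>] 0)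
      (𝓝 (f z + ⟪ξ, d⟫ + 1 / 2 * (1 - 0) * ‖d‖ ^ 2)) :=
    (Continuous.tendsto (by fun_prop) _).mono_left nhdsWithin_le_nhds
  have := le_of_tendsto hlim (b := f z') (by
    filter_upwards [Ioo_mem_nhdsGT (zero_lt_one (α := ℝ))] with t ht using key t ht.1 ht.2)
  simpa using this

/-- A chain estimate: quadratic control with vanishing step sums to a linear bound. -/
theorem abs_sub_le_of_step_bound {χ : ℝ → ℝ} {K M : ℝ}
    (h : ∀ s t, 0 ≤ s → s < t → t ≤ 1 → |χ t - χ s| ≤ K * (t - s) + M * (t - s) ^ 2) :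
    |χ 1 - χ 0| ≤ K := by
  have key : ∀ N : ℕ, 0 < N → |χ 1 - χ 0| ≤ K + M * (1 / (N : ℝ)) := by
    intro N hN
    have hN' : (0 : ℝ) < N := by exact_mod_cast hN
    have ind : ∀ i : ℕ, i ≤ N →
        |χ (i / N) - χ 0| ≤ i * (K * (1 / N) + M * (1 / (N : ℝ)) ^ 2) := by
      intro i
      induction i with
      | zero => intro _; simp
      | succ i ih =>
        intro hi
        have h1 := ih (by omega)
        have h2 := h (i / N) ((i + 1 : ℕ) / N) (by positivity)
          (by gcongr; exact_mod_cast Nat.lt_succ_self i)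
          (by rw [div_le_one hN']; exact_mod_cast hi)
        have e : ((i + 1 : ℕ) : ℝ) / N - i / N = 1 / N := by push_cast; ring
        rw [e] at h2
        have h3 := abs_sub_le (χ ((i + 1 : ℕ) / N)) (χ (i / N)) (χ 0)
        push_cast at *
        linarith
    have := ind N le_rfl
    rw [div_self hN'.ne'] at this
    refine this.trans (le_of_eq ?_)
    field_simp
  have hlim : Tendsto (fun N : ℕ => K + M * (1 / (N : ℝ))) atTop (𝓝 (K + M * 0)) :=
    tendsto_const_nhds.add (tendsto_const_nhds.mul tendsto_one_div_atTop_nhds_zero_nat)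
  have := ge_of_tendsto hlim (b := |χ 1 - χ 0|) (by
    filter_upwards [eventually_gt_atTop 0] with N hN using key N hN)
  simpa using this

theorem norm_sub_le_of_contact {f : E → ℝ} {c ρ : ℝ} (hc : 0 ≤ c) (hρ : 0 < ρ)
    {z p ξ z' ξ' : E} (hz : StrongSubgrad f z ξ)
    (hcon : ∀ h, ‖h‖ < ρ → f (z + h) ≤ f z + ⟪p, h⟫ + c / 2 * ‖z + h‖ ^ 2 - c / 2 * ‖z‖ ^ 2)
    (hζ : ξ = p + c • z)
    (hz' : StrongSubgrad f z' ξ') (hzz : ‖z' - z‖ < ρ / 2) :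
    ‖ξ' - ξ‖ ≤ 2 * c * ‖z' - z‖ := by
  subst hζ
  set e := z' - z with he
  set d := ξ' - (p + c • z) with hd
  have main : ∀ w : E, ‖w‖ < ρ / 2 → ⟪d, w⟫ ≤ c / 2 * ‖e + w‖ ^ 2 := by
    intro w hw
    have h1 := hz' (z' + w)
    have h2 := hz z'
    have h3 := hcon (e + w) ((norm_add_le _ _).trans_lt (by linarith))
    have e1 : z + (e + w) = z' + w := by rw [he]; abel
    rw [e1] at h3
    have e2 : z' + w = z + (e + w) := e1.symm
    have e3 : ‖z' + w‖ ^ 2 = ‖z‖ ^ 2 + 2 * ⟪z, e + w⟫ + ‖e + w‖ ^ 2 := by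
      rw [e2, norm_add_sq_real]
    rw [e3] at h3
    simp only [add_sub_cancel_left] at h1
    rw [← he] at h2
    have e4 : ⟪d, w⟫ = ⟪ξ', w⟫ - ⟪p, w⟫ - c * ⟪z, w⟫ := by
      rw [hd, inner_sub_left, inner_add_left, real_inner_smul_left]; ring
    rw [inner_add_left, real_inner_smul_left] at h2
    simp only [inner_add_right] at h3
    rw [e4]
    nlinarith [sq_nonneg ‖e‖, sq_nonneg ‖w‖]
  rcases eq_or_ne d 0 with h0 | h0
  · rw [h0, norm_zero]; positivity
  have hdpos : 0 < ‖d‖ := norm_pos_iff.2 h0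
  -- test with `w` a small positive multiple of `d`
  have test : ∀ s : ℝ, 0 < s → s < ρ / 2 → s * ‖d‖ ≤ c / 2 * (‖e‖ + s) ^ 2 := by
    intro s hs hsρ
    have hw : ‖(s / ‖d‖) • d‖ = s := by
      rw [norm_smul, Real.norm_eq_abs, abs_of_pos (by positivity)]; field_simp
    have h1 := main ((s / ‖d‖) • d) (by rw [hw]; exact hsρ)
    have h2 : ‖e + (s / ‖d‖) • d‖ ≤ ‖e‖ + s := (norm_add_le _ _).trans (by rw [hw])
    have h3 : ⟪d, (s / ‖d‖) • d⟫ = s * ‖d‖ := by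
      rw [real_inner_smul_right, real_inner_self_eq_norm_sq]; field_simp
    rw [h3] at h1
    refine h1.trans ?_
    gcongr
  rcases eq_or_ne e 0 with he0 | he0
  · exfalso
    have h1 : ∀ s : ℝ, 0 < s → s < ρ / 2 → ‖d‖ ≤ c / 2 * s := by
      intro s hs hs'
      have := test s hs hs'
      rw [he0, norm_zero, zero_add] at this
      nlinarith
    have h2 := h1 (min (ρ / 4) (‖d‖ / (c + 1))) (by positivity)
      ((min_le_left _ _).trans_lt (by linarith))
    have h3 : c / 2 * min (ρ / 4) (‖d‖ / (c + 1)) ≤ c / 2 * (‖d‖ / (c + 1)) := by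
      gcongr; exact min_le_right _ _
    have h4 : c / 2 * (‖d‖ / (c + 1)) < ‖d‖ := by
      rw [← mul_div_assoc, div_lt_iff₀ (by positivity)]; nlinarith
    linarith
  · have hepos : 0 < ‖e‖ := norm_pos_iff.2 he0
    have := test ‖e‖ hepos hzz
    nlinarith

variable [FiniteDimensional ℝ E]

theorem exists_contact_second_order {f : E → ℝ} (hf : Continuous f)
    (hD : ∀ z, ∃ ξ, StrongSubgrad f z ξ) {c : ℝ} (hc : 0 ≤ c) {z0 : E} {r : ℝ} (hr : 0 < r)
    (hsph : ∀ z, ‖z - z0‖ = r → f z - c / 2 * ‖z‖ ^ 2 < f z0 - c / 2 * ‖z0‖ ^ 2)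
    {δ : ℝ} (hδ : 0 < δ) :
    ∃ (z p : E) (B : E →L[ℝ] E), ‖z - z0‖ < r ∧ ‖p‖ < δ ∧
      (∀ z', ‖z' - z0‖ ≤ r → f z' - c / 2 * ‖z'‖ ^ 2 - ⟪p, z'⟫ ≤
        f z - c / 2 * ‖z‖ ^ 2 - ⟪p, z⟫) ∧
      ∀ κ : ℝ, 0 < κ → ∀ᶠ h in 𝓝 (0 : E),
        |(f (z + h) - c / 2 * ‖z + h‖ ^ 2) - (f z - c / 2 * ‖z‖ ^ 2) - ⟪p, h⟫
          - 1 / 2 * ⟪B h, h⟫| ≤ κ * ‖h‖ ^ 2 := by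
  classical
  borelize E
  set g : E → ℝ := fun z => f z - c / 2 * ‖z‖ ^ 2 with hg
  have hgc : Continuous g := by fun_prop
  -- uniform gap on the sphere
  obtain ⟨m, hm, hgap⟩ : ∃ m > 0, ∀ z, ‖z - z0‖ = r → g z ≤ g z0 - m := by
    rcases (Metric.sphere z0 r).eq_empty_or_nonempty with hemp | hne
    · exact ⟨1, one_pos, fun z hz => absurd (show z ∈ Metric.sphere z0 r by
        simpa [dist_eq_norm] using hz) (by simp [hemp])⟩
    · obtain ⟨zm, hzm, hzmax⟩ := (isCompact_sphere z0 r).exists_isMaxOn hne hgc.continuousOn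
      refine ⟨g z0 - g zm, ?_, fun z hz => ?_⟩
      · have := hsph zm (by simpa [dist_eq_norm] using hzm)
        simp only [hg]; linarith
      · have : g z ≤ g zm := hzmax (show z ∈ Metric.sphere z0 r by simpa [dist_eq_norm] using hz)
        linarith
  set δ' := min δ (m / (2 * r)) with hδ'
  have hδ'pos : 0 < δ' := by positivity
  choose J hJ using exists_strongSubgrad_eq hf hD
  have hJlip : LipschitzWith 1 J := LipschitzWith.of_dist_le_mul fun x y => by
    simpa [dist_eq_norm] using (hJ y).norm_sub_le (hJ x)
  -- contact points
  have hcontact : ∀ p : E, ‖p‖ < δ' → ∃ z, ‖z - z0‖ < r ∧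
      (∀ z', ‖z' - z0‖ ≤ r → g z' - ⟪p, z'⟫ ≤ g z - ⟪p, z⟫) := by
    intro p hp
    obtain ⟨z, hz, hzmax⟩ := (isCompact_closedBall z0 r).exists_isMaxOn
      ⟨z0, by simp [hr.le]⟩ (f := fun z => g z - ⟪p, z⟫) (by fun_prop)
    have hz' : ‖z - z0‖ ≤ r := by simpa [dist_eq_norm] using hz
    refine ⟨z, lt_of_le_of_ne hz' fun heq => ?_, fun z' h' =>
      hzmax (show z' ∈ Metric.closedBall z0 r by simpa [dist_eq_norm] using h')⟩
    have h1 : g z0 - ⟪p, z0⟫ ≤ g z - ⟪p, z⟫ := hzmax (by simp [hr.le])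
    have h2 := hgap z heq
    have h3 := (abs_le.1 (abs_real_inner_le_norm p (z - z0))).1
    rw [inner_sub_right, heq] at h3
    have h4 : ‖p‖ * r < m := by
      have : ‖p‖ < m / (2 * r) := hp.trans_le (min_le_right _ _)
      rw [lt_div_iff₀ (by positivity)] at this
      nlinarith [norm_nonneg p]
    linarith
  -- upper bound near contact
  have hupper : ∀ p z : E, ‖z - z0‖ < r →
      (∀ z', ‖z' - z0‖ ≤ r → g z' - ⟪p, z'⟫ ≤ g z - ⟪p, z⟫) →
      ∀ h, ‖h‖ < r - ‖z - z0‖ →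
        f (z + h) ≤ f z + ⟪p, h⟫ + c / 2 * ‖z + h‖ ^ 2 - c / 2 * ‖z‖ ^ 2 := by
    intro p z hz hmax h hh
    have h1 := hmax (z + h) (by
      have : z + h - z0 = (z - z0) + h := by abel
      rw [this]; exact (norm_add_le _ _).trans (by linarith))
    simp only [hg, inner_add_right] at h1
    linarith
  have hsubg : ∀ p z : E, ‖z - z0‖ < r →
      (∀ z', ‖z' - z0‖ ≤ r → g z' - ⟪p, z'⟫ ≤ g z - ⟪p, z⟫) →
      StrongSubgrad f z (p + c • z) := by
    intro p z hz hmax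
    have hup := hupper p z hz hmax
    obtain ⟨ξ, hξ⟩ := hD z
    suffices ξ = p + c • z by rwa [← this]
    by_contra hne
    set d := ξ - (p + c • z) with hd
    have hdpos : 0 < ‖d‖ := norm_pos_iff.2 (sub_ne_zero.2 hne)
    have test : ∀ s : ℝ, 0 < s → s * ‖d‖ < r - ‖z - z0‖ → 1 ≤ c / 2 * s := by
      intro s hs hsr
      have h1 := hup (s • d) (by rwa [norm_smul, Real.norm_eq_abs, abs_of_pos hs])
      have h2 := hξ (z + s • d)
      rw [add_sub_cancel_left] at h2
      rw [norm_add_sq_real] at h1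
      simp only [real_inner_smul_right, norm_smul, Real.norm_eq_abs, mul_pow, sq_abs] at h1 h2
      have e : ⟪d, d⟫ = ⟪ξ, d⟫ - ⟪p, d⟫ - c * ⟪z, d⟫ := by
        conv_lhs => rw [hd, inner_sub_left, inner_add_left, real_inner_smul_left]
        rw [← hd]; ring
      rw [real_inner_self_eq_norm_sq] at e
      have h3 : s * ‖d‖ ^ 2 ≤ s * ‖d‖ ^ 2 * (c / 2 * s) := by
        nlinarith [mul_nonneg (sq_nonneg s) (sq_nonneg ‖d‖)]
      have h4 : 0 < s * ‖d‖ ^ 2 := by positivity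
      by_contra! hcon
      nlinarith
    have hpos : 0 < r - ‖z - z0‖ := by linarith
    set s := min ((r - ‖z - z0‖) / (2 * ‖d‖)) (1 / (c + 1)) with hs
    have hspos : 0 < s := by positivity
    have h1 := test s hspos (by
      have : s ≤ (r - ‖z - z0‖) / (2 * ‖d‖) := min_le_left _ _
      rw [le_div_iff₀ (by positivity)] at this
      nlinarith)
    have h2 : s ≤ 1 / (c + 1) := min_le_right _ _
    rw [le_div_iff₀ (by positivity)] at h2
    nlinarith
  -- the set of contact values is not null
  set Z : Set E := {ζ | ∃ p z : E, ‖p‖ < δ' ∧ ‖z - z0‖ < r ∧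
      (∀ z', ‖z' - z0‖ ≤ r → g z' - ⟪p, z'⟫ ≤ g z - ⟪p, z⟫) ∧ ζ = p + c • z} with hZ
  let Pi : E → E := fun ζ => ζ - c • J ζ
  have hPilip : LipschitzWith (1 + ‖c‖₊ * 1) Pi := by
    simpa using LipschitzWith.id.sub ((lipschitzWith_smul c).comp hJlip)
  have hsub : Metric.ball (0 : E) δ' ⊆ Pi '' Z := by
    intro p hp
    have hp' : ‖p‖ < δ' := by simpa using hp
    obtain ⟨z, hz, hmax⟩ := hcontact p hp'
    refine ⟨p + c • z, ⟨p, z, hp', hz, hmax, rfl⟩, ?_⟩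
    have : J (p + c • z) = z := by
      have h1 := (hsubg p z hz hmax).norm_sub_le (hJ (p + c • z))
      rw [sub_self, norm_zero] at h1
      exact sub_eq_zero.1 (norm_le_zero_iff.1 h1)
    simp [Pi, this]
  let μ : Measure E := μH[(Module.finrank ℝ E : ℝ)]
  have : μ.IsAddHaarMeasure := MeasureTheory.isAddHaarMeasure_hausdorffMeasure
  have hZne : μ Z ≠ 0 := by
    intro h0
    have h1 := hPilip.hausdorffMeasure_image_le (d := (Module.finrank ℝ E : ℝ)) (by positivity) Z
    have h2 : μ (Metric.ball (0 : E) δ') ≤ 0 := by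
      refine (measure_mono hsub).trans (h1.trans ?_)
      change _ * μ Z ≤ 0
      rw [h0, mul_zero]
    exact (Metric.measure_ball_pos μ (0 : E) hδ'pos).ne' (le_antisymm h2 bot_le)
  obtain ⟨ζ, hζZ, hζd⟩ : ∃ ζ ∈ Z, DifferentiableAt ℝ J ζ := by
    by_contra! hcon
    exact hZne (measure_mono_null (fun ζ h => hcon ζ h) (hJlip.ae_differentiableAt (μ := μ)))
  obtain ⟨p, z, hp, hz, hmax, hζ⟩ := hζZ
  have hsg : StrongSubgrad f z ζ := hζ ▸ hsubg p z hz hmax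
  have huniq : ∀ ζ z, StrongSubgrad f z ζ → J ζ = z := by
    intro ζ z h
    have h1 := h.norm_sub_le (hJ ζ)
    rw [sub_self, norm_zero] at h1
    exact sub_eq_zero.1 (norm_le_zero_iff.1 h1)
  have hJζ : J ζ = z := huniq _ _ hsg
  set ρ := r - ‖z - z0‖ with hρ
  have hρpos : 0 < ρ := by linarith
  have hlip : ∀ z' ξ', StrongSubgrad f z' ξ' → ‖z' - z‖ < ρ / 2 →
      ‖ξ' - ζ‖ ≤ 2 * c * ‖z' - z‖ := fun z' ξ' h' hzz =>
    norm_sub_le_of_contact hc hρpos hsg (hupper p z hz hmax) hζ h' hzz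
  set T := fderiv ℝ J ζ with hT
  have hTd : HasFDerivAt J T ζ := hζd.hasFDerivAt
  have hTo := hTd.isLittleO
  rw [hJζ] at hTo
  -- the derivative is injective
  have hTinj : Function.Injective T := by
    rw [injective_iff_map_eq_zero]
    intro d hd0
    by_contra hdne
    have hdpos : 0 < ‖d‖ := norm_pos_iff.2 hdne
    have h1 := hTo.def (c := 1 / (2 * c + 1) / 2) (by positivity)
    have hcont : Tendsto (fun s : ℝ => ζ + s • d) (𝓝[>] 0) (𝓝 ζ) := by
      have : Tendsto (fun s : ℝ => ζ + s • d) (𝓝 0) (𝓝 (ζ + (0 : ℝ) • d)) :=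
        Continuous.tendsto (by fun_prop) _
      simpa using this.mono_left nhdsWithin_le_nhds
    have h2 : ∀ᶠ x in 𝓝 ζ, ‖J x - z‖ < ρ / 2 := by
      have := (hJlip.continuous.tendsto ζ)
      rw [hJζ] at this
      simpa [dist_eq_norm] using this.eventually (Metric.ball_mem_nhds z (by linarith : 0 < ρ / 2))
    obtain ⟨s, ⟨hs1, hs2⟩, hs0⟩ := ((hcont.eventually (h1.and h2)).and
      (self_mem_nhdsWithin)).exists
    have hs0 : (0 : ℝ) < s := hs0
    have h3 := hlip _ _ (hJ (ζ + s • d)) hs2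
    simp only [add_sub_cancel_left, map_smul, hd0, smul_zero, sub_zero] at hs1 h3
    have hsd : 0 < ‖s • d‖ := by
      rw [norm_smul, Real.norm_eq_abs, abs_of_pos hs0]; positivity
    have h4 : 2 * c * ‖J (ζ + s • d) - z‖ ≤ 2 * c * (1 / (2 * c + 1) / 2 * ‖s • d‖) := by gcongr
    have h5 : 2 * c * (1 / (2 * c + 1) / 2 * ‖s • d‖) < ‖s • d‖ := by
      have : 2 * c * (1 / (2 * c + 1) / 2) < 1 := by
        rw [← sub_pos]; field_simp; linarith
      nlinarith
    linarith
  let Te : E ≃L[ℝ] E := (LinearEquiv.ofInjectiveEndo (T : E →ₗ[ℝ] E) hTinj).toContinuousLinearEquiv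
  have hTe : ∀ x, Te x = T x := fun x => rfl
  let Ti : E →L[ℝ] E := (Te.symm : E →L[ℝ] E)
  have hTi : ∀ x, Ti (T x) = x := fun x => by
    change Te.symm (T x) = x
    rw [← hTe, ContinuousLinearEquiv.symm_apply_apply]
  -- first-order expansion of subgradients
  have hexp : ∀ κ : ℝ, 0 < κ → ∃ η > 0, ∀ z' ξ', StrongSubgrad f z' ξ' → ‖z' - z‖ < η →
      ‖ξ' - ζ - Ti (z' - z)‖ ≤ κ * ‖z' - z‖ := by
    intro κ hκ
    have hq : 0 < κ / ((‖Ti‖ + 1) * (2 * c + 1)) := by positivity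
    obtain ⟨η, hη, hball⟩ := Metric.eventually_nhds_iff.1 (hTo.def hq)
    refine ⟨min (ρ / 2) (η / (2 * c + 1)), by positivity, fun z' ξ' h' hlt => ?_⟩
    have h1 := hlip z' ξ' h' (hlt.trans_le (min_le_left _ _))
    have h2 : ‖ξ' - ζ‖ < η := by
      have h3 := hlt.trans_le (min_le_right _ _)
      rw [lt_div_iff₀ (by positivity)] at h3
      nlinarith [norm_nonneg (z' - z)]
    have h3 := hball (y := ξ') (by rwa [dist_eq_norm])
    rw [huniq _ _ h'] at h3
    have h4 : ξ' - ζ - Ti (z' - z) = - Ti (z' - z - T (ξ' - ζ)) := by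
      rw [map_sub Ti (z' - z), hTi]; abel
    rw [h4, norm_neg]
    calc ‖Ti (z' - z - T (ξ' - ζ))‖ ≤ ‖Ti‖ * ‖z' - z - T (ξ' - ζ)‖ := Ti.le_opNorm _
      _ ≤ (‖Ti‖ + 1) * (κ / ((‖Ti‖ + 1) * (2 * c + 1)) * ((2 * c + 1) * ‖z' - z‖)) := by
        gcongr
        · linarith
        · refine h3.trans ?_
          gcongr
          nlinarith [norm_nonneg (z' - z)]
      _ = κ * ‖z' - z‖ := by field_simp
  refine ⟨z, p, Ti - c • ContinuousLinearMap.id ℝ E, hz, hp.trans_le (min_le_left _ _), hmax, ?_⟩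
  intro κ hκ
  obtain ⟨η, hη, hη'⟩ := hexp κ hκ
  filter_upwards [Metric.ball_mem_nhds (0 : E) hη] with h hh
  have hh : ‖h‖ < η := by simpa using hh
  have hgoal := abs_sub_le_of_step_bound
    (χ := fun t => f (z + t • h) - t * ⟪ζ, h⟫ - t ^ 2 / 2 * ⟪Ti h, h⟫)
    (K := κ * ‖h‖ ^ 2) (M := |⟪Ti h, h⟫| / 2) ?_
  · convert hgoal using 2
    simp only [one_smul, zero_smul, add_zero, hζ, inner_add_left, real_inner_smul_left,
      norm_add_sq_real, _root_.sub_apply, _root_.smul_apply,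
      ContinuousLinearMap.id_apply, inner_sub_left, real_inner_self_eq_norm_sq]
    ring
  · have hslope : ∀ t, 0 ≤ t → t ≤ 1 → ∃ ξ, StrongSubgrad f (z + t • h) ξ ∧
        |⟪ξ, h⟫ - ⟪ζ, h⟫ - t * ⟪Ti h, h⟫| ≤ κ * ‖h‖ ^ 2 := by
      intro t ht0 ht1
      obtain ⟨ξ, hξ⟩ := hD (z + t • h)
      refine ⟨ξ, hξ, ?_⟩
      have hth : ‖t • h‖ ≤ ‖h‖ := by
        rw [norm_smul, Real.norm_eq_abs, abs_of_nonneg ht0]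
        nlinarith [norm_nonneg h]
      have h1 := hη' _ _ hξ (by rw [add_sub_cancel_left]; exact hth.trans_lt hh)
      rw [add_sub_cancel_left] at h1
      have h2 := abs_real_inner_le_norm (ξ - ζ - Ti (t • h)) h
      rw [inner_sub_left, inner_sub_left, map_smul, real_inner_smul_left] at h2
      refine h2.trans ?_
      rw [map_smul] at h1
      nlinarith [norm_nonneg h, mul_le_mul_of_nonneg_left hth hκ.le]
    intro s t hs hst ht
    obtain ⟨ξs, hξs, bs⟩ := hslope s hs (by linarith)
    obtain ⟨ξt, hξt, bt⟩ := hslope t (by linarith) ht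
    have a1 := hξs (z + t • h)
    have a2 := hξt (z + s • h)
    have e1 : z + t • h - (z + s • h) = (t - s) • h := by rw [sub_smul]; abel
    have e2 : z + s • h - (z + t • h) = (s - t) • h := by rw [sub_smul]; abel
    rw [e1, real_inner_smul_right] at a1
    rw [e2, real_inner_smul_right] at a2
    have bs' := abs_le.1 bs
    have bt' := abs_le.1 bt
    have hts : 0 < t - s := by linarith
    have q1 := mul_le_mul_of_nonneg_left bs'.1 hts.le
    have q2 := mul_le_mul_of_nonneg_left bt'.2 hts.le
    have n1 := sq_nonneg ‖(t - s) • h‖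
    have n2 := sq_nonneg ‖(s - t) • h‖
    have m1 := mul_le_mul_of_nonneg_left (le_abs_self ⟪Ti h, h⟫) (sq_nonneg (t - s))
    have m2 := mul_le_mul_of_nonneg_left (neg_abs_le ⟪Ti h, h⟫) (sq_nonneg (t - s))
    rw [abs_le]
    constructor
    · linarith
    · linarith

end Jensen

section TwoPoint

set_option linter.unusedSectionVars false

open scoped RealInnerProductSpace

variable {E : Type*} [NormedAddCommGroup E] [InnerProductSpace ℝ E]
variable {E₁ : Type*} [NormedAddCommGroup E₁] [InnerProductSpace ℝ E₁]
variable {E₂ : Type*} [NormedAddCommGroup E₂] [InnerProductSpace ℝ E₂]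

/-- The pair `(a, b)` in the `ℓ²` product. -/
def pr (a : E₁) (b : E₂) : WithLp 2 (E₁ × E₂) := WithLp.toLp 2 (a, b)

@[simp] theorem pr_fst (a : E₁) (b : E₂) : (pr a b).fst = a := rfl
@[simp] theorem pr_snd (a : E₁) (b : E₂) : (pr a b).snd = b := rfl
theorem pr_fst_snd (z : WithLp 2 (E₁ × E₂)) : pr z.fst z.snd = z := rfl
theorem pr_add (a a' : E₁) (b b' : E₂) : pr (a + a') (b + b') = pr a b + pr a' b' := rfl
theorem pr_sub (a a' : E₁) (b b' : E₂) : pr (a - a') (b - b') = pr a b - pr a' b' := rfl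
theorem pr_smul (s : ℝ) (a : E₁) (b : E₂) : pr (s • a) (s • b) = s • pr a b := rfl
theorem pr_zero : pr (0 : E₁) (0 : E₂) = 0 := rfl

theorem inner_pr (a : E₁) (b : E₂) (z : WithLp 2 (E₁ × E₂)) :
    ⟪pr a b, z⟫ = ⟪a, z.fst⟫ + ⟪b, z.snd⟫ := WithLp.prod_inner_apply _ _

theorem inner_pr_right (a : E₁) (b : E₂) (z : WithLp 2 (E₁ × E₂)) :
    ⟪z, pr a b⟫ = ⟪z.fst, a⟫ + ⟪z.snd, b⟫ := WithLp.prod_inner_apply _ _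

theorem norm_sq_eq (z : WithLp 2 (E₁ × E₂)) : ‖z‖ ^ 2 = ‖z.fst‖ ^ 2 + ‖z.snd‖ ^ 2 :=
  WithLp.prod_norm_sq_eq_of_L2 z

theorem norm_fst_le' (z : WithLp 2 (E₁ × E₂)) : ‖z.fst‖ ≤ ‖z‖ := by
  have := norm_sq_eq z
  exact le_of_sq_le_sq (by nlinarith [sq_nonneg ‖z.snd‖]) (norm_nonneg _)

theorem norm_snd_le' (z : WithLp 2 (E₁ × E₂)) : ‖z.snd‖ ≤ ‖z‖ := by
  have := norm_sq_eq z
  exact le_of_sq_le_sq (by nlinarith [sq_nonneg ‖z.fst‖]) (norm_nonneg _)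

theorem continuous_pr : Continuous fun z : E₁ × E₂ => pr z.1 z.2 :=
  WithLp.prod_continuous_toLp 2 E₁ E₂

theorem continuous_fst' : Continuous fun z : WithLp 2 (E₁ × E₂) => z.fst :=
  WithLp.continuous_fst _ _ _

theorem continuous_snd' : Continuous fun z : WithLp 2 (E₁ × E₂) => z.snd :=
  WithLp.continuous_snd _ _ _

/-- Inclusion of the first factor. -/
def incl₁ : E₁ →L[ℝ] WithLp 2 (E₁ × E₂) :=
  ⟨⟨⟨fun a => pr a 0, fun a b => by rw [← pr_add, add_zero]⟩,
    fun s a => by rw [RingHom.id_apply, ← pr_smul, smul_zero]⟩,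
    continuous_pr.comp (continuous_id.prodMk continuous_const)⟩

/-- Inclusion of the second factor. -/
def incl₂ : E₂ →L[ℝ] WithLp 2 (E₁ × E₂) :=
  ⟨⟨⟨fun a => pr 0 a, fun a b => by rw [← pr_add, add_zero]⟩,
    fun s a => by rw [RingHom.id_apply, ← pr_smul, smul_zero]⟩,
    continuous_pr.comp (continuous_const.prodMk continuous_id)⟩

/-- Projection to the first factor. -/
def proj₁ : WithLp 2 (E₁ × E₂) →L[ℝ] E₁ :=
  ⟨⟨⟨fun z => z.fst, fun _ _ => rfl⟩, fun _ _ => rfl⟩, continuous_fst'⟩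

/-- Projection to the second factor. -/
def proj₂ : WithLp 2 (E₁ × E₂) →L[ℝ] E₂ :=
  ⟨⟨⟨fun z => z.snd, fun _ _ => rfl⟩, fun _ _ => rfl⟩, continuous_snd'⟩

@[simp] theorem incl₁_apply (a : E₁) : (incl₁ a : WithLp 2 (E₁ × E₂)) = pr a 0 := rfl
@[simp] theorem incl₂_apply (a : E₂) : (incl₂ a : WithLp 2 (E₁ × E₂)) = pr 0 a := rfl
@[simp] theorem proj₁_apply (z : WithLp 2 (E₁ × E₂)) : proj₁ z = z.fst := rfl
@[simp] theorem proj₂_apply (z : WithLp 2 (E₁ × E₂)) : proj₂ z = z.snd := rfl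

theorem hom2_nonpos {q : E → ℝ} (hq : ∀ (s : ℝ) h, q (s • h) = s ^ 2 * q h)
    (H : ∀ κ : ℝ, 0 < κ → ∀ᶠ h in 𝓝 (0 : E), q h ≤ κ * ‖h‖ ^ 2) (h : E) : q h ≤ 0 := by
  have key : ∀ κ : ℝ, 0 < κ → q h ≤ κ * ‖h‖ ^ 2 := by
    intro κ hκ
    have hcont : Tendsto (fun s : ℝ => s • h) (𝓝[>] 0) (𝓝 0) := by
      have : Tendsto (fun s : ℝ => s • h) (𝓝 0) (𝓝 ((0 : ℝ) • h)) :=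
        Continuous.tendsto (by fun_prop) _
      simpa using this.mono_left nhdsWithin_le_nhds
    obtain ⟨s, hs, hs0⟩ := ((hcont.eventually (H κ hκ)).and self_mem_nhdsWithin).exists
    have hs0 : (0 : ℝ) < s := hs0
    rw [hq, norm_smul, mul_pow, Real.norm_eq_abs, sq_abs] at hs
    have : s ^ 2 * q h ≤ s ^ 2 * (κ * ‖h‖ ^ 2) := by linarith
    exact le_of_mul_le_mul_left this (by positivity)
  by_contra! hc
  have := key (q h / (2 * (‖h‖ ^ 2 + 1))) (by positivity)
  rw [div_mul_eq_mul_div, le_div_iff₀ (by positivity)] at this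
  nlinarith [sq_nonneg ‖h‖]

theorem exists_supConv {w : E → ℝ} (hw : Continuous w) {K : Set E} (hK : IsCompact K)
    (hne : K.Nonempty) (τ : ℝ) : ∃ (W : E → ℝ) (X : E → E), Continuous W ∧
      (∀ ξ, X ξ ∈ K ∧ W ξ = w (X ξ) - ‖X ξ - ξ‖ ^ 2 / (2 * τ)) ∧
      ∀ ξ, ∀ x ∈ K, w x - ‖x - ξ‖ ^ 2 / (2 * τ) ≤ W ξ := by
  have hc : Continuous (fun z : E × E => w z.2 - ‖z.2 - z.1‖ ^ 2 / (2 * τ)) := by fun_prop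
  have hc' : ∀ ξ, Continuous (fun x : E => w x - ‖x - ξ‖ ^ 2 / (2 * τ)) := by
    intro ξ; fun_prop
  have hW := hK.continuous_sSup (f := fun ξ x => w x - ‖x - ξ‖ ^ 2 / (2 * τ))
    (by change Continuous (fun z : E × E => _); exact hc)
  have hex := fun ξ => hK.exists_isMaxOn hne (hc' ξ).continuousOn
  choose X hXK hX using hex
  refine ⟨fun ξ => w (X ξ) - ‖X ξ - ξ‖ ^ 2 / (2 * τ), X, ?_, fun ξ => ⟨hXK ξ, rfl⟩,
    fun ξ x hx => hX ξ hx⟩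
  convert hW using 2 with ξ
  have hg : IsGreatest ((fun x => w x - ‖x - ξ‖ ^ 2 / (2 * τ)) '' K)
      (w (X ξ) - ‖X ξ - ξ‖ ^ 2 / (2 * τ)) := by
    refine ⟨⟨X ξ, hXK ξ, rfl⟩, ?_⟩
    rintro _ ⟨x, hx, rfl⟩
    exact hX ξ hx
  exact hg.csSup_eq.symm

variable [FiniteDimensional ℝ E₁] [FiniteDimensional ℝ E₂]

instance : FiniteDimensional ℝ (WithLp 2 (E₁ × E₂)) :=
  Module.Finite.equiv (WithLp.linearEquiv 2 ℝ (E₁ × E₂)).symm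

set_option maxHeartbeats 1000000 in
/-- The theorem on sums at a strict maximum. -/
theorem exists_jets_of_strict_max {w₁ : E₁ → ℝ} {w₂ : E₂ → ℝ} (hw₁ : Continuous w₁)
    (hw₂ : Continuous w₂) {x₀ : E₁} {y₀ : E₂} {P : WithLp 2 (E₁ × E₂)}
    {M : WithLp 2 (E₁ × E₂) →L[ℝ] WithLp 2 (E₁ × E₂)} (hM : ∀ a b, ⟪M a, b⟫ = ⟪M b, a⟫)
    {r₀ κ : ℝ} (hr₀ : 0 < r₀) (hκ : 0 < κ)
    (hmax : ∀ h k, ‖h‖ ≤ r₀ → ‖k‖ ≤ r₀ → w₁ (x₀ + h) + w₂ (y₀ + k) ≤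
      w₁ x₀ + w₂ y₀ + ⟪P, pr h k⟫ + 1 / 2 * ⟪M (pr h k), pr h k⟫ - κ * ‖pr h k‖ ^ 2)
    {ε : ℝ} (hε : 0 < ε) :
    ∃ (x : E₁) (y : E₂) (q : WithLp 2 (E₁ × E₂)) (X₁ : E₁ →L[ℝ] E₁) (X₂ : E₂ →L[ℝ] E₂),
      ‖x - x₀‖ < ε ∧ ‖y - y₀‖ < ε ∧ ‖q - P‖ < ε ∧
      (∀ᶠ h in 𝓝 (0 : E₁), w₁ (x + h) ≤ w₁ x + ⟪q.fst, h⟫ + 1 / 2 * ⟪X₁ h, h⟫) ∧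
      (∀ᶠ k in 𝓝 (0 : E₂), w₂ (y + k) ≤ w₂ y + ⟪q.snd, k⟫ + 1 / 2 * ⟪X₂ k, k⟫) ∧
      ∀ h k, ⟪X₁ h, h⟫ + ⟪X₂ k, k⟫ ≤ ⟪M (pr h k), pr h k⟫ + ε * ‖pr h k‖ ^ 2 := by
  set z₀ := pr x₀ y₀ with hz₀
  set r := min (min ε r₀ / 2) (ε / (4 * (‖M‖ + 1))) with hr
  have hrpos : 0 < r := by positivity
  have hr1 : 2 * r ≤ ε := by
    have : r ≤ min ε r₀ / 2 := min_le_left _ _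
    linarith [min_le_left ε r₀]
  have hr2 : 2 * r ≤ r₀ := by
    have : r ≤ min ε r₀ / 2 := min_le_left _ _
    linarith [min_le_right ε r₀]
  have hr3 : ‖M‖ * r ≤ ε / 4 := by
    have : r ≤ ε / (4 * (‖M‖ + 1)) := min_le_right _ _
    rw [le_div_iff₀ (by positivity)] at this
    linarith
  set φ : WithLp 2 (E₁ × E₂) → ℝ := fun u => ⟪P, u⟫ + 1 / 2 * ⟪M u, u⟫ with hφ
  have hφc : Continuous φ := by fun_prop
  have hφexp : ∀ u d, φ (u + d) = φ u + ⟪P, d⟫ + ⟪M u, d⟫ + 1 / 2 * ⟪M d, d⟫ := by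
    intro u d
    simp only [hφ, inner_add_right, map_add, inner_add_left]
    rw [hM d u]; ring
  set ψ : WithLp 2 (E₁ × E₂) → ℝ := fun u => φ u - κ * ‖u‖ ^ 2 with hψ
  have hψc : Continuous ψ := by fun_prop
  obtain ⟨η, hη, hηψ⟩ := Metric.uniformContinuousOn_iff.1
    ((isCompact_closedBall (0 : WithLp 2 (E₁ × E₂)) (2 * r)).uniformContinuousOn_of_continuous
      hψc.continuousOn) (κ * r ^ 2) (by positivity)
  have hK₁ := isCompact_closedBall x₀ r₀
  have hK₂ := isCompact_closedBall y₀ r₀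
  obtain ⟨A₁, hA₁⟩ := hK₁.exists_bound_of_continuousOn hw₁.continuousOn
  obtain ⟨A₂, hA₂⟩ := hK₂.exists_bound_of_continuousOn hw₂.continuousOn
  set A := max A₁ A₂ with hA
  have hA0 : 0 ≤ A := (norm_nonneg _).trans ((hA₁ x₀ (by simp [hr₀.le])).trans (le_max_left _ _))
  set τ := min η r ^ 2 / (16 * (A + 1)) with hτ
  have hτpos : 0 < τ := by positivity
  have hτA : 8 * A * τ < min η r ^ 2 := by
    have h1 : τ * (16 * (A + 1)) = min η r ^ 2 := by rw [hτ]; field_simp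
    have : 0 < min η r ^ 2 := by positivity
    nlinarith
  obtain ⟨W₁, X₁, hW₁c, hX₁, hW₁⟩ := exists_supConv hw₁ hK₁ ⟨x₀, by simp [hr₀.le]⟩ τ
  obtain ⟨W₂, X₂, hW₂c, hX₂, hW₂⟩ := exists_supConv hw₂ hK₂ ⟨y₀, by simp [hr₀.le]⟩ τ
  have hclose₁ : ∀ ξ, ‖ξ - x₀‖ ≤ r₀ → ‖X₁ ξ - ξ‖ ^ 2 ≤ 4 * A * τ := by
    intro ξ hξ
    have hξK : ξ ∈ Metric.closedBall x₀ r₀ := by simpa [dist_eq_norm] using hξ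
    have h1 := hW₁ ξ ξ hξK
    have h2 := hX₁ ξ
    have h3 := abs_le.1 (hA₁ ξ hξK)
    have h4 := abs_le.1 (hA₁ _ h2.1)
    have h5 : ‖X₁ ξ - ξ‖ ^ 2 / (2 * τ) ≤ 2 * A := by
      simp at h1
      linarith [le_max_left A₁ A₂]
    rw [div_le_iff₀ (by positivity)] at h5
    linarith
  have hclose₂ : ∀ ξ, ‖ξ - y₀‖ ≤ r₀ → ‖X₂ ξ - ξ‖ ^ 2 ≤ 4 * A * τ := by
    intro ξ hξ
    have hξK : ξ ∈ Metric.closedBall y₀ r₀ := by simpa [dist_eq_norm] using hξ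
    have h1 := hW₂ ξ ξ hξK
    have h2 := hX₂ ξ
    have h3 := abs_le.1 (hA₂ ξ hξK)
    have h4 := abs_le.1 (hA₂ _ h2.1)
    have h5 : ‖X₂ ξ - ξ‖ ^ 2 / (2 * τ) ≤ 2 * A := by
      simp at h1
      linarith [le_max_right A₁ A₂]
    rw [div_le_iff₀ (by positivity)] at h5
    linarith
  set X : WithLp 2 (E₁ × E₂) → WithLp 2 (E₁ × E₂) := fun z => pr (X₁ z.fst) (X₂ z.snd) with hX
  set G : WithLp 2 (E₁ × E₂) → ℝ := fun z => W₁ z.fst + W₂ z.snd with hG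
  have hGc : Continuous G := (hW₁c.comp continuous_fst').add (hW₂c.comp continuous_snd')
  have hXclose : ∀ z, ‖z - z₀‖ ≤ r → ‖X z - z‖ < min η r := by
    intro z hz
    have h1 := hclose₁ z.fst ((norm_fst_le' (z - z₀)).trans (by linarith))
    have h2 := hclose₂ z.snd ((norm_snd_le' (z - z₀)).trans (by linarith))
    have h3 : ‖X z - z‖ ^ 2 = ‖X₁ z.fst - z.fst‖ ^ 2 + ‖X₂ z.snd - z.snd‖ ^ 2 := norm_sq_eq _
    exact lt_of_pow_lt_pow_left₀ 2 (by positivity) (by linarith)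
  set c := 1 / τ + ‖M‖ + 1 with hcdef
  set f : WithLp 2 (E₁ × E₂) → ℝ := fun z => G z - φ (z - z₀) + c / 2 * ‖z‖ ^ 2 with hf
  have hfc : Continuous f := by fun_prop
  have hWsub : ∀ z d, G z + 1 / τ * ⟪X z - z, d⟫ - ‖d‖ ^ 2 / (2 * τ) ≤ G (z + d) := by
    intro z d
    have h1 := hW₁ (z + d).fst _ (hX₁ z.fst).1
    have h2 := hW₂ (z + d).snd _ (hX₂ z.snd).1
    have e1 := (hX₁ z.fst).2
    have e2 := (hX₂ z.snd).2
    have n1 : X₁ z.fst - (z + d).fst = (X₁ z.fst - z.fst) - d.fst := by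
      rw [WithLp.add_fst]; abel
    have n2 : X₂ z.snd - (z + d).snd = (X₂ z.snd - z.snd) - d.snd := by
      rw [WithLp.add_snd]; abel
    rw [n1, norm_sub_sq_real] at h1
    rw [n2, norm_sub_sq_real] at h2
    have e3 : ⟪X z - z, d⟫ = ⟪X₁ z.fst - z.fst, d.fst⟫ + ⟪X₂ z.snd - z.snd, d.snd⟫ :=
      WithLp.prod_inner_apply _ _
    simp only [hG]
    rw [e1, e2, e3, norm_sq_eq d]
    refine le_trans (le_of_eq ?_) (add_le_add h1 h2)
    field_simp
    ring
  have hD : ∀ z, ∃ ξ, StrongSubgrad f z ξ := by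
    intro z
    refine ⟨(1 / τ) • (X z - z) - P - M (z - z₀) + c • z, fun z' => ?_⟩
    obtain ⟨d, rfl⟩ : ∃ d, z' = z + d := ⟨z' - z, by abel⟩
    have h1 := hWsub z d
    have h2 := hφexp (z - z₀) d
    have e : z + d - z₀ = z - z₀ + d := by abel
    have h3 : ⟪M d, d⟫ ≤ ‖M‖ * ‖d‖ ^ 2 := by
      refine (real_inner_le_norm _ _).trans ?_
      nlinarith [M.le_opNorm d, norm_nonneg d]
    simp only [hf]
    rw [e, h2, add_sub_cancel_left, inner_add_left, inner_sub_left, inner_sub_left,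
      real_inner_smul_left, real_inner_smul_left, norm_add_sq_real]
    have h4 : c * ‖d‖ ^ 2 = 2 * (‖d‖ ^ 2 / (2 * τ)) + ‖M‖ * ‖d‖ ^ 2 + ‖d‖ ^ 2 := by
      rw [hcdef]; field_simp
    linarith
  have hcpos : 0 ≤ c := by positivity
  have hGz₀ : w₁ x₀ + w₂ y₀ ≤ G z₀ := by
    have h1 := hW₁ x₀ x₀ (by simp [hr₀.le])
    have h2 := hW₂ y₀ y₀ (by simp [hr₀.le])
    simp at h1 h2
    exact add_le_add h1 h2
  have hGle : ∀ z, G z ≤ w₁ (X z).fst + w₂ (X z).snd := by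
    intro z
    have e1 := (hX₁ z.fst).2
    have e2 := (hX₂ z.snd).2
    have : 0 ≤ ‖X₁ z.fst - z.fst‖ ^ 2 / (2 * τ) := by positivity
    have : 0 ≤ ‖X₂ z.snd - z.snd‖ ^ 2 / (2 * τ) := by positivity
    simp only [hG, hX, pr_fst, pr_snd]
    linarith
  have hsph : ∀ z, ‖z - z₀‖ = r → f z - c / 2 * ‖z‖ ^ 2 < f z₀ - c / 2 * ‖z₀‖ ^ 2 := by
    intro z hz
    have hcl := hXclose z hz.le
    set u := X z - z₀ with hu
    set u' := z - z₀ with hu'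
    have huu : X z - z = u - u' := by rw [hu, hu']; abel
    rw [huu] at hcl
    have hun : ‖u‖ ≤ 2 * r := by
      have : u = (u - u') + u' := by abel
      rw [this]
      refine (norm_add_le _ _).trans ?_
      linarith [min_le_right η r]
    have h1 := hηψ u (by simpa using hun) u' (by simp; linarith) (by
      rw [dist_eq_norm]; exact hcl.trans_le (min_le_left _ _))
    rw [Real.dist_eq] at h1
    have h2 := (abs_lt.1 h1).2
    have h3 := hmax u.fst u.snd ((norm_fst_le' u).trans (by linarith))
      ((norm_snd_le' u).trans (by linarith))
    have e1 : x₀ + u.fst = (X z).fst := by simp [hu, hz₀]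
    have e2 : y₀ + u.snd = (X z).snd := by simp [hu, hz₀]
    rw [e1, e2, pr_fst_snd] at h3
    have h4 := hGle z
    simp only [hf, hψ, sub_self] at h2 ⊢
    have h5 : φ 0 = 0 := by simp [hφ]
    rw [h5]
    rw [hz] at h2
    simp only [hφ] at h2 h3 ⊢
    linarith
  obtain ⟨z, p, B, hz, hp, hzmax, hexp⟩ :=
    exists_contact_second_order hfc hD hcpos hrpos hsph (δ := ε / 4) (by positivity)
  simp only [hf, add_sub_cancel_right] at hzmax hexp
  set u := z - z₀ with hu
  have hGexp : ∀ κ : ℝ, 0 < κ → ∀ᶠ h in 𝓝 (0 : WithLp 2 (E₁ × E₂)),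
      |G (z + h) - G z - ⟪p + P + M u, h⟫ - 1 / 2 * ⟪(B + M) h, h⟫| ≤ κ * ‖h‖ ^ 2 := by
    intro κ hκ
    filter_upwards [hexp κ hκ] with h hh
    have e : z + h - z₀ = u + h := by rw [hu]; abel
    rw [e, hφexp u h] at hh
    refine le_of_eq_of_le ?_ hh
    congr 1
    rw [_root_.add_apply, inner_add_left, inner_add_left, inner_add_left]
    ring
  have hB : ∀ h, ⟪B h, h⟫ ≤ 0 := by
    refine hom2_nonpos (fun s h => by
      rw [map_smul, real_inner_smul_left, real_inner_smul_right]; ring) fun κ hκ => ?_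
    have hnear : ∀ᶠ h in 𝓝 (0 : WithLp 2 (E₁ × E₂)), ‖h‖ < r - ‖u‖ := by
      have := Metric.ball_mem_nhds (0 : WithLp 2 (E₁ × E₂)) (sub_pos.2 hz)
      filter_upwards [this] with h hh using by simpa using hh
    filter_upwards [hexp (κ / 2) (by positivity), hnear] with h hh hn
    have h1 := hzmax (z + h) (by
      have e : z + h - z₀ = u + h := by rw [hu]; abel
      rw [e]; exact (norm_add_le _ _).trans (by linarith))
    rw [inner_add_right] at h1
    have h2 := (abs_le.1 hh).1
    linarith
  set N := B + M with hN
  have hsep : ∀ h, ⟪N (pr h.fst 0), pr h.fst 0⟫ + ⟪N (pr 0 h.snd), pr 0 h.snd⟫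
      - ⟪N h, h⟫ ≤ 0 := by
    refine hom2_nonpos (q := fun h => ⟪N (pr h.fst 0), pr h.fst 0⟫
      + ⟪N (pr 0 h.snd), pr 0 h.snd⟫ - ⟪N h, h⟫) (fun s h => ?_) fun κ hκ => ?_
    · have e1 : pr (s • h).fst (0 : E₂) = s • pr h.fst 0 := by
        rw [← pr_smul, smul_zero]; rfl
      have e2 : pr (0 : E₁) (s • h).snd = s • pr 0 h.snd := by
        rw [← pr_smul, smul_zero]; rfl
      simp only [e1, e2, map_smul, real_inner_smul_left, real_inner_smul_right]
      ring
    · have t1 : Tendsto (fun h : WithLp 2 (E₁ × E₂) => pr h.fst (0 : E₂)) (𝓝 0) (𝓝 0) := by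
        have : Continuous (fun h : WithLp 2 (E₁ × E₂) => pr h.fst (0 : E₂)) :=
          continuous_pr.comp (continuous_fst'.prodMk continuous_const)
        exact this.tendsto 0
      have t2 : Tendsto (fun h : WithLp 2 (E₁ × E₂) => pr (0 : E₁) h.snd) (𝓝 0) (𝓝 0) := by
        have : Continuous (fun h : WithLp 2 (E₁ × E₂) => pr (0 : E₁) h.snd) :=
          continuous_pr.comp (continuous_const.prodMk continuous_snd')
        exact this.tendsto 0
      have hx := hGexp (κ / 4) (by positivity)
      filter_upwards [hx, t1.eventually hx, t2.eventually hx] with h h0 h1 h2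
      have b0 := abs_le.1 h0
      have b1 := abs_le.1 h1
      have b2 := abs_le.1 h2
      have n1 : ‖pr h.fst (0 : E₂)‖ ^ 2 + ‖pr (0 : E₁) h.snd‖ ^ 2 = ‖h‖ ^ 2 := by
        rw [norm_sq_eq, norm_sq_eq, norm_sq_eq h]; simp
      have i1 : ⟪p + P + M u, h⟫ = ⟪p + P + M u, pr h.fst 0⟫ + ⟪p + P + M u, pr 0 h.snd⟫ := by
        rw [← inner_add_right, ← pr_add, add_zero, zero_add, pr_fst_snd]
      have g1 : G (z + h) + G z = G (z + pr h.fst 0) + G (z + pr 0 h.snd) := by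
        simp only [hG, WithLp.add_fst, WithLp.add_snd, pr_fst, pr_snd, add_zero]; ring
      have n2 : κ / 4 * ‖pr h.fst (0 : E₂)‖ ^ 2 + κ / 4 * ‖pr (0 : E₁) h.snd‖ ^ 2
          = κ / 4 * ‖h‖ ^ 2 := by rw [← mul_add, n1]
      linarith
  have hcl := hXclose z hz.le
  have hcl' : ‖X z - z₀‖ < 2 * r := by
    have : X z - z₀ = (X z - z) + u := by rw [hu]; abel
    rw [this]
    refine (norm_add_le _ _).trans_lt ?_
    linarith [min_le_right η r]
  have hx₁ : ‖X₁ z.fst - x₀‖ < 2 * r := (norm_fst_le' (X z - z₀)).trans_lt hcl'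
  have hx₂ : ‖X₂ z.snd - y₀‖ < 2 * r := (norm_snd_le' (X z - z₀)).trans_lt hcl'
  refine ⟨X₁ z.fst, X₂ z.snd, p + P + M u,
    (proj₁.comp (N.comp incl₁)) + ε • ContinuousLinearMap.id ℝ E₁,
    (proj₂.comp (N.comp incl₂)) + ε • ContinuousLinearMap.id ℝ E₂,
    hx₁.trans_le hr1, hx₂.trans_le hr1, ?_, ?_, ?_, ?_⟩
  · have e : p + P + M u - P = p + M u := by abel
    rw [e]
    have h1 := M.le_opNorm u
    have h2 : ‖M‖ * ‖u‖ ≤ ‖M‖ * r := by gcongr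
    exact (norm_add_le _ _).trans_lt (by linarith)
  · have t1 : Tendsto (fun h : E₁ => pr h (0 : E₂)) (𝓝 0) (𝓝 0) :=
      (incl₁ (E₂ := E₂)).continuous.tendsto' 0 0 (map_zero _)
    have hnear : ∀ᶠ h in 𝓝 (0 : E₁), ‖h‖ < r₀ - ‖X₁ z.fst - x₀‖ := by
      have := Metric.ball_mem_nhds (0 : E₁) (by linarith : 0 < r₀ - ‖X₁ z.fst - x₀‖)
      filter_upwards [this] with h hh using by simpa using hh
    filter_upwards [t1.eventually (hGexp (ε / 2) (by positivity)), hnear] with h hh hn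
    have h1 := (abs_le.1 hh).2
    have h2 := hW₁ (z.fst + h) (X₁ z.fst + h) (by
      rw [Metric.mem_closedBall, dist_eq_norm]
      have e : X₁ z.fst + h - x₀ = (X₁ z.fst - x₀) + h := by abel
      rw [e]; exact (norm_add_le _ _).trans (by linarith))
    rw [add_sub_add_right_eq_sub] at h2
    have h3 := (hX₁ z.fst).2
    have e1 : ⟪p + P + M u, pr h 0⟫ = ⟪(p + P + M u).fst, h⟫ := by
      rw [inner_pr_right, inner_zero_right, add_zero]
    have e2 : ⟪N (pr h 0), pr h 0⟫ = ⟪(N (pr h (0 : E₂))).fst, h⟫ := by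
      rw [inner_pr_right, inner_zero_right, add_zero]
    have e3 : ‖pr h (0 : E₂)‖ ^ 2 = ‖h‖ ^ 2 := by rw [norm_sq_eq]; simp
    have e4 : G (z + pr h 0) - G z = W₁ (z.fst + h) - W₁ z.fst := by
      simp only [hG, WithLp.add_fst, WithLp.add_snd, pr_fst, pr_snd, add_zero]; ring
    rw [e1, e2, e3, e4] at h1
    simp only [_root_.add_apply, ContinuousLinearMap.comp_apply, incl₁_apply, proj₁_apply,
      _root_.smul_apply, ContinuousLinearMap.id_apply, inner_add_left (x := (N _).fst),
      real_inner_smul_left, real_inner_self_eq_norm_sq]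
    linarith
  · have t1 : Tendsto (fun h : E₂ => pr (0 : E₁) h) (𝓝 0) (𝓝 0) :=
      (incl₂ (E₁ := E₁)).continuous.tendsto' 0 0 (map_zero _)
    have hnear : ∀ᶠ h in 𝓝 (0 : E₂), ‖h‖ < r₀ - ‖X₂ z.snd - y₀‖ := by
      have := Metric.ball_mem_nhds (0 : E₂) (by linarith : 0 < r₀ - ‖X₂ z.snd - y₀‖)
      filter_upwards [this] with h hh using by simpa using hh
    filter_upwards [t1.eventually (hGexp (ε / 2) (by positivity)), hnear] with h hh hn
    have h1 := (abs_le.1 hh).2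
    have h2 := hW₂ (z.snd + h) (X₂ z.snd + h) (by
      rw [Metric.mem_closedBall, dist_eq_norm]
      have e : X₂ z.snd + h - y₀ = (X₂ z.snd - y₀) + h := by abel
      rw [e]; exact (norm_add_le _ _).trans (by linarith))
    rw [add_sub_add_right_eq_sub] at h2
    have h3 := (hX₂ z.snd).2
    have e1 : ⟪p + P + M u, pr 0 h⟫ = ⟪(p + P + M u).snd, h⟫ := by
      rw [inner_pr_right, inner_zero_right, zero_add]
    have e2 : ⟪N (pr 0 h), pr 0 h⟫ = ⟪(N (pr (0 : E₁) h)).snd, h⟫ := by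
      rw [inner_pr_right, inner_zero_right, zero_add]
    have e3 : ‖pr (0 : E₁) h‖ ^ 2 = ‖h‖ ^ 2 := by rw [norm_sq_eq]; simp
    have e4 : G (z + pr 0 h) - G z = W₂ (z.snd + h) - W₂ z.snd := by
      simp only [hG, WithLp.add_fst, WithLp.add_snd, pr_fst, pr_snd, add_zero]; ring
    rw [e1, e2, e3, e4] at h1
    simp only [_root_.add_apply, ContinuousLinearMap.comp_apply, incl₂_apply, proj₂_apply,
      _root_.smul_apply, ContinuousLinearMap.id_apply, inner_add_left (x := (N _).snd),
      real_inner_smul_left, real_inner_self_eq_norm_sq]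
    linarith
  · intro h k
    have h1 := hsep (pr h k)
    have h2 := hB (pr h k)
    simp only [pr_fst, pr_snd] at h1
    have e2 : ⟪N (pr h 0), pr h 0⟫ = ⟪(N (pr h (0 : E₂))).fst, h⟫ := by
      rw [inner_pr_right, inner_zero_right, add_zero]
    have e3 : ⟪N (pr 0 k), pr 0 k⟫ = ⟪(N (pr (0 : E₁) k)).snd, k⟫ := by
      rw [inner_pr_right, inner_zero_right, zero_add]
    have e4 : ⟪N (pr h k), pr h k⟫ = ⟪B (pr h k), pr h k⟫ + ⟪M (pr h k), pr h k⟫ := by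
      rw [hN, _root_.add_apply, inner_add_left]
    simp only [_root_.add_apply, ContinuousLinearMap.comp_apply, incl₁_apply, proj₁_apply,
      incl₂_apply, proj₂_apply, _root_.smul_apply, ContinuousLinearMap.id_apply,
      inner_add_left, real_inner_smul_left, real_inner_self_eq_norm_sq]
    rw [norm_sq_eq (pr h k), pr_fst, pr_snd]
    linarith

end TwoPoint

section Jets

set_option linter.unusedSectionVars false

open scoped RealInnerProductSpace

variable {E : Type*} [NormedAddCommGroup E] [InnerProductSpace ℝ E]
variable {E₁ : Type*} [NormedAddCommGroup E₁] [InnerProductSpace ℝ E₁]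
variable {E₂ : Type*} [NormedAddCommGroup E₂] [InnerProductSpace ℝ E₂]
variable {ι : Type*} [Fintype ι]

/-- Subsolution property of `F(z, Dw) - ∑ᵢ D²w(σᵢ, σᵢ) ≤ 0` on `U`, in terms of second-order
superjets. -/
def JSub (U : Set E) (σ : E → ι → E) (F : E → E → ℝ) (w : E → ℝ) : Prop :=
  ∀ z ∈ U, ∀ (q : E) (X : E →L[ℝ] E),
    (∀ᶠ h in 𝓝 (0 : E), w (z + h) ≤ w z + ⟪q, h⟫ + 1 / 2 * ⟪X h, h⟫) →
      F z q ≤ ∑ i, ⟪X (σ z i), σ z i⟫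

/-- Supersolution property of `F(z, Dv) - ∑ᵢ D²v(σᵢ, σᵢ) ≥ 0` on `U`, in terms of second-order
subjets. -/
def JSup (U : Set E) (σ : E → ι → E) (F : E → E → ℝ) (v : E → ℝ) : Prop :=
  ∀ z ∈ U, ∀ (q : E) (X : E →L[ℝ] E),
    (∀ᶠ h in 𝓝 (0 : E), v z + ⟪q, h⟫ + 1 / 2 * ⟪X h, h⟫ ≤ v (z + h)) →
      ∑ i, ⟪X (σ z i), σ z i⟫ ≤ F z q

theorem JSup.neg {U : Set E} {σ : E → ι → E} {F : E → E → ℝ} {v : E → ℝ} (h : JSup U σ F v) :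
    JSub U σ (fun z q => -F z (-q)) (fun z => -v z) := by
  intro z hz q X hX
  have := h z hz (-q) (-X) (by
    filter_upwards [hX] with d hd
    simp only [inner_neg_left, _root_.neg_apply]
    linarith)
  simp only [inner_neg_left, _root_.neg_apply, Finset.sum_neg_distrib] at this
  linarith

theorem JSub.neg {U : Set E} {σ : E → ι → E} {F : E → E → ℝ} {v : E → ℝ} (h : JSub U σ F v) :
    JSup U σ (fun z q => -F z (-q)) (fun z => -v z) := by
  intro z hz q X hX
  have := h z hz (-q) (-X) (by
    filter_upwards [hX] with d hd
    simp only [inner_neg_left, _root_.neg_apply]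
    linarith)
  simp only [inner_neg_left, _root_.neg_apply, Finset.sum_neg_distrib] at this
  linarith

variable [FiniteDimensional ℝ E₁] [FiniteDimensional ℝ E₂]

theorem two_point_sum {w₁ : E₁ → ℝ} {w₂ : E₂ → ℝ} (hw₁ : Continuous w₁) (hw₂ : Continuous w₂)
    {U₁ : Set E₁} {U₂ : Set E₂} {σ₁ : E₁ → ι → E₁} {σ₂ : E₂ → ι → E₂} {F₁ : E₁ → E₁ → ℝ}
    {F₂ : E₂ → E₂ → ℝ} (h₁ : JSub U₁ σ₁ F₁ w₁) (h₂ : JSub U₂ σ₂ F₂ w₂)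
    (hF₁ : Continuous fun z : E₁ × E₁ => F₁ z.1 z.2) (hF₂ : Continuous fun z : E₂ × E₂ => F₂ z.1 z.2)
    (hσ₁ : ∀ i, Continuous fun z => σ₁ z i) (hσ₂ : ∀ i, Continuous fun z => σ₂ z i)
    {x₀ : E₁} {y₀ : E₂} (hU₁ : U₁ ∈ 𝓝 x₀) (hU₂ : U₂ ∈ 𝓝 y₀) {P : WithLp 2 (E₁ × E₂)}
    {M : WithLp 2 (E₁ × E₂) →L[ℝ] WithLp 2 (E₁ × E₂)} (hM : ∀ a b, ⟪M a, b⟫ = ⟪M b, a⟫)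
    (hmax : ∀ᶠ d in 𝓝 (0 : WithLp 2 (E₁ × E₂)), w₁ (x₀ + d.fst) + w₂ (y₀ + d.snd) ≤
      w₁ x₀ + w₂ y₀ + ⟪P, d⟫ + 1 / 2 * ⟪M d, d⟫) (a b : ℝ) :
    a ^ 2 * F₁ x₀ P.fst + b ^ 2 * F₂ y₀ P.snd ≤
      ∑ i, ⟪M (pr (a • σ₁ x₀ i) (b • σ₂ y₀ i)), pr (a • σ₁ x₀ i) (b • σ₂ y₀ i)⟫ := by
  obtain ⟨ρ, hρ, hball⟩ := Metric.eventually_nhds_iff.1 hmax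
  have step : ∀ N : ℕ, ∃ (x : E₁) (y : E₂) (q : WithLp 2 (E₁ × E₂)),
      ‖x - x₀‖ < 1 / ((N : ℝ) + 1) ∧ ‖y - y₀‖ < 1 / ((N : ℝ) + 1) ∧
      ‖q - P‖ < 1 / ((N : ℝ) + 1) ∧ (x ∈ U₁ → y ∈ U₂ →
      a ^ 2 * F₁ x q.fst + b ^ 2 * F₂ y q.snd ≤
        ∑ i, (⟪M (pr (a • σ₁ x i) (b • σ₂ y i)), pr (a • σ₁ x i) (b • σ₂ y i)⟫ +
          3 * (1 / ((N : ℝ) + 1)) * ‖pr (a • σ₁ x i) (b • σ₂ y i)‖ ^ 2)) := by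
    intro N
    set ε : ℝ := 1 / ((N : ℝ) + 1) with hε
    have hεpos : 0 < ε := by positivity
    obtain ⟨x, y, q, X₁, X₂, hx, hy, hq, j₁, j₂, hX⟩ := exists_jets_of_strict_max hw₁ hw₂
      (x₀ := x₀) (y₀ := y₀) (P := P) (M := M + (2 * ε) • ContinuousLinearMap.id ℝ _)
      (r₀ := ρ / 4) (κ := ε) (fun u v => by
        simp only [_root_.add_apply, _root_.smul_apply, ContinuousLinearMap.id_apply,
          inner_add_left, real_inner_smul_left, hM u v, real_inner_comm u v])
      (by positivity) hεpos (fun h k hh hk => by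
        have hn : ‖pr h k‖ < ρ := by
          have := norm_sq_eq (pr h k)
          simp only [pr_fst, pr_snd] at this
          refine lt_of_pow_lt_pow_left₀ 2 hρ.le ?_
          nlinarith [norm_nonneg h, norm_nonneg k]
        have := hball (y := pr h k) (by simpa using hn)
        simp only [_root_.add_apply, _root_.smul_apply, ContinuousLinearMap.id_apply,
          inner_add_left, real_inner_smul_left, real_inner_self_eq_norm_sq]
        simp only [pr_fst, pr_snd] at this
        linarith) hεpos
    refine ⟨x, y, q, hx, hy, hq, fun hxU hyU => ?_⟩
    have b₁ := mul_le_mul_of_nonneg_left (h₁ x hxU q.fst X₁ j₁) (sq_nonneg a)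
    have b₂ := mul_le_mul_of_nonneg_left (h₂ y hyU q.snd X₂ j₂) (sq_nonneg b)
    refine (add_le_add b₁ b₂).trans ?_
    rw [Finset.mul_sum, Finset.mul_sum, ← Finset.sum_add_distrib]
    refine Finset.sum_le_sum fun i _ => ?_
    have := hX (a • σ₁ x i) (b • σ₂ y i)
    simp only [_root_.add_apply, _root_.smul_apply, ContinuousLinearMap.id_apply,
      inner_add_left, real_inner_smul_left, real_inner_self_eq_norm_sq] at this
    rw [map_smul, map_smul, real_inner_smul_left, real_inner_smul_right, real_inner_smul_left,
      real_inner_smul_right] at this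
    linarith
  choose x y q hx hy hq hle using step
  have hlim : Tendsto (fun N : ℕ => 1 / ((N : ℝ) + 1)) atTop (𝓝 0) :=
    tendsto_one_div_add_atTop_nhds_zero_nat
  have tx : Tendsto x atTop (𝓝 x₀) := tendsto_iff_norm_sub_tendsto_zero.2
    (squeeze_zero (fun _ => norm_nonneg _) (fun N => (hx N).le) hlim)
  have ty : Tendsto y atTop (𝓝 y₀) := tendsto_iff_norm_sub_tendsto_zero.2
    (squeeze_zero (fun _ => norm_nonneg _) (fun N => (hy N).le) hlim)
  have tq : Tendsto q atTop (𝓝 P) := tendsto_iff_norm_sub_tendsto_zero.2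
    (squeeze_zero (fun _ => norm_nonneg _) (fun N => (hq N).le) hlim)
  have tq₁ : Tendsto (fun N => (q N).fst) atTop (𝓝 P.fst) := (continuous_fst'.tendsto P).comp tq
  have tq₂ : Tendsto (fun N => (q N).snd) atTop (𝓝 P.snd) := (continuous_snd'.tendsto P).comp tq
  have tL : Tendsto (fun N => a ^ 2 * F₁ (x N) (q N).fst + b ^ 2 * F₂ (y N) (q N).snd) atTop
      (𝓝 (a ^ 2 * F₁ x₀ P.fst + b ^ 2 * F₂ y₀ P.snd)) :=
    (((hF₁.tendsto (x₀, P.fst)).comp (tx.prodMk_nhds tq₁)).const_mul _).add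
      (((hF₂.tendsto (y₀, P.snd)).comp (ty.prodMk_nhds tq₂)).const_mul _)
  have tσ : ∀ i, Tendsto (fun N => pr (a • σ₁ (x N) i) (b • σ₂ (y N) i)) atTop
      (𝓝 (pr (a • σ₁ x₀ i) (b • σ₂ y₀ i))) := fun i =>
    (continuous_pr.tendsto (a • σ₁ x₀ i, b • σ₂ y₀ i)).comp
      (((((hσ₁ i).tendsto x₀).comp tx).const_smul a).prodMk_nhds
        ((((hσ₂ i).tendsto y₀).comp ty).const_smul b))
  have tR : Tendsto (fun N : ℕ => ∑ i,
      (⟪M (pr (a • σ₁ (x N) i) (b • σ₂ (y N) i)), pr (a • σ₁ (x N) i) (b • σ₂ (y N) i)⟫ +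
        3 * (1 / ((N : ℝ) + 1)) * ‖pr (a • σ₁ (x N) i) (b • σ₂ (y N) i)‖ ^ 2)) atTop
      (𝓝 (∑ i, (⟪M (pr (a • σ₁ x₀ i) (b • σ₂ y₀ i)), pr (a • σ₁ x₀ i) (b • σ₂ y₀ i)⟫ +
        3 * 0 * ‖pr (a • σ₁ x₀ i) (b • σ₂ y₀ i)‖ ^ 2))) :=
    tendsto_finsetSum _ fun i _ =>
      (((M.continuous.tendsto _).comp (tσ i)).inner (tσ i)).add
        ((hlim.const_mul 3).mul ((tσ i).norm.pow 2))
  have hfin := le_of_tendsto_of_tendsto tL tR (by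
    filter_upwards [tx.eventually hU₁, ty.eventually hU₂] with N a1 a2 using hle N a1 a2)
  simpa using hfin

/-- The quadratic form `α ‖L h - k‖² + β (‖h‖² + ‖k‖²)` as a symmetric operator. -/
def couplingForm (L : E₁ →L[ℝ] E₂) (α β : ℝ) :
    WithLp 2 (E₁ × E₂) →L[ℝ] WithLp 2 (E₁ × E₂) :=
  α • ((ContinuousLinearMap.adjoint (L.comp proj₁ - proj₂)).comp (L.comp proj₁ - proj₂))
    + β • ContinuousLinearMap.id ℝ _

theorem couplingForm_symm (L : E₁ →L[ℝ] E₂) (α β : ℝ) (a b : WithLp 2 (E₁ × E₂)) :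
    ⟪couplingForm L α β a, b⟫ = ⟪couplingForm L α β b, a⟫ := by
  simp only [couplingForm, _root_.add_apply, _root_.smul_apply, ContinuousLinearMap.id_apply,
    inner_add_left, real_inner_smul_left, ContinuousLinearMap.comp_apply,
    ContinuousLinearMap.adjoint_inner_left]
  rw [real_inner_comm a b]
  congr 2
  exact real_inner_comm _ _

theorem couplingForm_self (L : E₁ →L[ℝ] E₂) (α β : ℝ) (a : WithLp 2 (E₁ × E₂)) :
    ⟪couplingForm L α β a, a⟫ =
      α * ‖L a.fst - a.snd‖ ^ 2 + β * (‖a.fst‖ ^ 2 + ‖a.snd‖ ^ 2) := by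
  simp only [couplingForm, _root_.add_apply, _root_.smul_apply, ContinuousLinearMap.id_apply,
    inner_add_left, real_inner_smul_left, ContinuousLinearMap.comp_apply,
    ContinuousLinearMap.adjoint_inner_left, real_inner_self_eq_norm_sq, norm_sq_eq a]
  rfl

theorem two_point {w : E₁ → ℝ} {v : E₂ → ℝ} (hw : Continuous w) (hv : Continuous v)
    {U₁ : Set E₁} {U₂ : Set E₂} {σ₁ : E₁ → ι → E₁} {σ₂ : E₂ → ι → E₂} {F₁ : E₁ → E₁ → ℝ}
    {F₂ : E₂ → E₂ → ℝ} (h₁ : JSub U₁ σ₁ F₁ w) (h₂ : JSup U₂ σ₂ F₂ v)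
    (hF₁ : Continuous fun z : E₁ × E₁ => F₁ z.1 z.2) (hF₂ : Continuous fun z : E₂ × E₂ => F₂ z.1 z.2)
    (hσ₁ : ∀ i, Continuous fun z => σ₁ z i) (hσ₂ : ∀ i, Continuous fun z => σ₂ z i)
    {x₀ : E₁} {y₀ : E₂} (hU₁ : U₁ ∈ 𝓝 x₀) (hU₂ : U₂ ∈ 𝓝 y₀) {P : E₁} {P' : E₂}
    (L : E₁ →L[ℝ] E₂) (α β : ℝ)
    (hmax : ∀ᶠ d in 𝓝 (0 : WithLp 2 (E₁ × E₂)), w (x₀ + d.fst) - v (y₀ + d.snd) ≤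
      w x₀ - v y₀ + ⟪P, d.fst⟫ - ⟪P', d.snd⟫ + α / 2 * ‖L d.fst - d.snd‖ ^ 2
        + β / 2 * (‖d.fst‖ ^ 2 + ‖d.snd‖ ^ 2)) (a b : ℝ) :
    a ^ 2 * F₁ x₀ P - b ^ 2 * F₂ y₀ P' ≤
      ∑ i, (α * ‖a • L (σ₁ x₀ i) - b • σ₂ y₀ i‖ ^ 2 +
        β * (a ^ 2 * ‖σ₁ x₀ i‖ ^ 2 + b ^ 2 * ‖σ₂ y₀ i‖ ^ 2)) := by
  have hF₂' : Continuous fun z : E₂ × E₂ => -F₂ z.1 (-z.2) :=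
    (hF₂.comp (continuous_fst.prodMk continuous_snd.neg)).neg
  have := two_point_sum hw hv.neg h₁ h₂.neg hF₁ hF₂' hσ₁ hσ₂ hU₁ hU₂ (P := pr P (-P'))
    (couplingForm_symm L α β) (by
      filter_upwards [hmax] with d hd
      rw [couplingForm_self, inner_pr, inner_neg_left]
      simp only [Pi.neg_apply]
      linarith) a b
  simp only [couplingForm_self, pr_fst, pr_snd, neg_neg, map_smul, norm_smul, mul_pow,
    Real.norm_eq_abs, sq_abs] at this
  linarith

/-- Comparison of a subsolution `w` with a Lipschitz supersolution `v` composed with a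
linear map, at a local maximum of the difference. -/
theorem exists_common_gradient {w : E₁ → ℝ} {v : E₂ → ℝ} (hw : Continuous w)
    {Λ C : ℝ} (hΛ : 0 ≤ Λ) (hC : 0 ≤ C) (hvL : ∀ x y, |v x - v y| ≤ Λ * ‖x - y‖)
    {U₁ : Set E₁} {σ₁ : E₁ → ι → E₁} {σ₂ : E₂ → ι → E₂} {F₁ : E₁ → E₁ → ℝ}
    {F₂ : E₂ → E₂ → ℝ} (h₁ : JSub U₁ σ₁ F₁ w) (h₂ : JSup Set.univ σ₂ F₂ v)
    (hF₁ : Continuous fun z : E₁ × E₁ => F₁ z.1 z.2) (hF₂ : Continuous fun z : E₂ × E₂ => F₂ z.1 z.2)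
    (hσ₁ : ∀ i, Continuous fun z => σ₁ z i) (hσ₂ : ∀ i x y, ‖σ₂ x i - σ₂ y i‖ ≤ C * ‖x - y‖)
    {z₀ : E₁} (hU₁ : U₁ ∈ 𝓝 z₀) (L : E₁ →L[ℝ] E₂) (Lt : E₂ →L[ℝ] E₁)
    (hLt : ∀ k h, ⟪Lt k, h⟫ = ⟪k, L h⟫) (hL : ∀ z i, L (σ₁ z i) = σ₂ (L z) i)
    (hmax : ∀ᶠ z in 𝓝 z₀, w z - v (L z) ≤ w z₀ - v (L z₀)) :
    ∃ P : E₂, ‖P‖ ≤ 2 * Λ ∧ F₁ z₀ (Lt P) ≤ F₂ (L z₀) P := by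
  have hvc : Continuous v := by
    refine (LipschitzWith.of_dist_le_mul (K := ⟨Λ, hΛ⟩) fun x y => ?_).continuous
    rw [Real.dist_eq, dist_eq_norm]; exact hvL x y
  have hσ₂c : ∀ i, Continuous fun z => σ₂ z i := fun i => by
    refine (LipschitzWith.of_dist_le_mul (K := ⟨C, hC⟩) fun x y => ?_).continuous
    rw [dist_eq_norm, dist_eq_norm]; exact hσ₂ i x y
  obtain ⟨r₀, hr₀, hball⟩ := Metric.eventually_nhds_iff.1 hmax
  set r := min (r₀ / 2) (1 / (2 * (‖L‖ + 1))) with hr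
  have hrpos : 0 < r := by positivity
  have hrL : ∀ h : E₁, ‖h‖ ≤ r → ‖L h‖ ≤ 1 / 2 := by
    intro h hh
    have h1 := L.le_opNorm h
    have h2 : r ≤ 1 / (2 * (‖L‖ + 1)) := min_le_right _ _
    rw [le_div_iff₀ (by positivity)] at h2
    nlinarith [norm_nonneg L, norm_nonneg h]
  have step : ∀ N : ℕ, 1 ≤ N → 4 * Λ ^ 2 / N < r ^ 2 → 2 * Λ / (N : ℝ) ^ 2 < 1 / 2 →
      ∃ (z : E₁) (y P : E₂), ‖P‖ ≤ 2 * Λ ∧ ‖z - z₀‖ ^ 2 ≤ 4 * Λ ^ 2 / N ∧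
        ‖L z - y‖ ≤ 2 * Λ / (N : ℝ) ^ 2 ∧ (z ∈ interior U₁ →
        F₁ z (Lt P + (1 / (N : ℝ)) • (z - z₀)) - F₂ y P ≤
          ∑ i, (C ^ 2 * (4 * Λ ^ 2) / (N : ℝ) ^ 2
            + 1 / (N : ℝ) * (‖σ₁ z i‖ ^ 2 + ‖σ₂ y i‖ ^ 2))) := by
    intro N hN hNr hN1
    have hNpos : (0 : ℝ) < N := by exact_mod_cast hN
    have hcomp : IsCompact (Metric.closedBall z₀ r ×ˢ Metric.closedBall (L z₀) 1) :=
      (isCompact_closedBall _ _).prod (isCompact_closedBall _ _)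
    set Φ : E₁ × E₂ → ℝ := fun p => w p.1 - v p.2 - (N : ℝ) ^ 2 / 2 * ‖L p.1 - p.2‖ ^ 2
      - 1 / (2 * (N : ℝ)) * ‖p.1 - z₀‖ ^ 2 with hΦ
    have hΦc : Continuous Φ := by fun_prop
    obtain ⟨⟨z, y⟩, ⟨hzK, hyK⟩, hzy⟩ := hcomp.exists_isMaxOn
      ⟨(z₀, L z₀), by simp [hrpos.le]⟩ hΦc.continuousOn
    have hzK' : ‖z - z₀‖ ≤ r := by simpa [dist_eq_norm] using hzK
    have hLz : ‖L z - L z₀‖ ≤ 1 / 2 := by rw [← map_sub]; exact hrL _ hzK'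
    have c1 : Φ (z, L z) ≤ Φ (z, y) := hzy (by
      refine ⟨hzK, ?_⟩
      simp only [Metric.mem_closedBall, dist_eq_norm]; linarith)
    have c2 : Φ (z₀, L z₀) ≤ Φ (z, y) := hzy (by simp [hrpos.le])
    simp only [hΦ, sub_self, norm_zero] at c1 c2
    have v1 := (abs_le.1 (hvL (L z) y)).2
    have d1 : (N : ℝ) ^ 2 * ‖L z - y‖ ≤ 2 * Λ := by
      by_contra! hcon
      have : 0 < ‖L z - y‖ := by
        by_contra! h0
        have h0' : ‖L z - y‖ = 0 := le_antisymm h0 (norm_nonneg _)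
        rw [h0'] at hcon; linarith
      nlinarith
    have d1' : ‖L z - y‖ ≤ 2 * Λ / (N : ℝ) ^ 2 := by
      rw [le_div_iff₀ (by positivity)]; linarith
    have d2 : ‖z - z₀‖ ^ 2 ≤ 4 * Λ ^ 2 / N := by
      have h1 := hball (y := z) (by
        rw [dist_eq_norm]
        have : r ≤ r₀ / 2 := min_le_left _ _
        linarith)
      have h2 : 1 / (2 * (N : ℝ)) * ‖z - z₀‖ ^ 2 ≤ Λ * ‖L z - y‖ := by
        have : 0 ≤ (N : ℝ) ^ 2 / 2 * ‖L z - y‖ ^ 2 := by positivity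
        linarith
      have h3 : Λ * ‖L z - y‖ ≤ Λ * (2 * Λ / (N : ℝ) ^ 2) := by gcongr
      have h5 := h2.trans h3
      rw [le_div_iff₀ hNpos]
      field_simp at h5
      linarith
    refine ⟨z, y, (N : ℝ) ^ 2 • (L z - y), ?_, d2, d1', fun hzU => ?_⟩
    · rw [norm_smul, Real.norm_eq_abs, abs_of_pos (by positivity)]; exact d1
    have hzlt : ‖z - z₀‖ < r := lt_of_pow_lt_pow_left₀ 2 hrpos.le (d2.trans_lt hNr)
    have hylt : ‖y - L z₀‖ < 1 := by
      have : y - L z₀ = (L z - L z₀) - (L z - y) := by abel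
      rw [this]
      refine (norm_sub_le _ _).trans_lt ?_
      linarith
    have hmx : ∀ᶠ d in 𝓝 (0 : WithLp 2 (E₁ × E₂)), w (z + d.fst) - v (y + d.snd) ≤
      w z - v y + ⟪Lt ((N : ℝ) ^ 2 • (L z - y)) + (1 / (N : ℝ)) • (z - z₀), d.fst⟫
        - ⟪(N : ℝ) ^ 2 • (L z - y), d.snd⟫ + (N : ℝ) ^ 2 / 2 * ‖L d.fst - d.snd‖ ^ 2
        + 1 / (N : ℝ) / 2 * (‖d.fst‖ ^ 2 + ‖d.snd‖ ^ 2) := by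
      have e1 : ∀ᶠ d in 𝓝 (0 : WithLp 2 (E₁ × E₂)), ‖d‖ < min (r - ‖z - z₀‖) (1 - ‖y - L z₀‖) := by
        have := Metric.ball_mem_nhds (0 : WithLp 2 (E₁ × E₂))
          (lt_min (sub_pos.2 hzlt) (sub_pos.2 hylt))
        filter_upwards [this] with h hh using by simpa using hh
      filter_upwards [e1] with d hd
      have f1 := (norm_fst_le' d).trans_lt (hd.trans_le (min_le_left _ _))
      have f2 := (norm_snd_le' d).trans_lt (hd.trans_le (min_le_right _ _))
      have g1 : z + d.fst - z₀ = (z - z₀) + d.fst := by abel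
      have g2 : y + d.snd - L z₀ = (y - L z₀) + d.snd := by abel
      have hm : Φ (z + d.fst, y + d.snd) ≤ Φ (z, y) := hzy (by
        refine ⟨?_, ?_⟩
        · simp only [Metric.mem_closedBall, dist_eq_norm, g1]
          exact (norm_add_le _ _).trans (by linarith)
        · simp only [Metric.mem_closedBall, dist_eq_norm, g2]
          exact (norm_add_le _ _).trans (by linarith))
      have g3 : L (z + d.fst) - (y + d.snd) = (L z - y) + (L d.fst - d.snd) := by
        rw [map_add]; abel
      simp only [hΦ, g1, g3] at hm
      rw [norm_add_sq_real, norm_add_sq_real, inner_sub_right] at hm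
      rw [inner_add_left, hLt, real_inner_smul_left, real_inner_smul_left, real_inner_smul_left]
      have : 0 ≤ 1 / (N : ℝ) / 2 * ‖d.snd‖ ^ 2 := by positivity
      have e4 : 1 / (2 * (N : ℝ)) = 1 / (N : ℝ) / 2 := by field_simp
      rw [e4] at hm
      linarith
    have main := two_point hw hvc h₁ h₂ hF₁ hF₂ hσ₁ hσ₂c (mem_interior_iff_mem_nhds.1 hzU)
      univ_mem L _ _ hmx 1 1
    simp only [one_pow, one_mul, one_smul] at main
    refine main.trans (Finset.sum_le_sum fun i _ => ?_)
    gcongr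
    rw [hL]
    have h3 : ‖σ₂ (L z) i - σ₂ y i‖ ≤ C * (2 * Λ / (N : ℝ) ^ 2) :=
      (hσ₂ i _ _).trans (by gcongr)
    calc (N : ℝ) ^ 2 * ‖σ₂ (L z) i - σ₂ y i‖ ^ 2
        ≤ (N : ℝ) ^ 2 * (C * (2 * Λ / (N : ℝ) ^ 2)) ^ 2 := by gcongr
      _ = C ^ 2 * (4 * Λ ^ 2) / (N : ℝ) ^ 2 := by field_simp; ring
  have tinv : Tendsto (fun N : ℕ => 1 / (N : ℝ)) atTop (𝓝 0) :=
    tendsto_one_div_atTop_nhds_zero_nat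
  have t1 : Tendsto (fun N : ℕ => 4 * Λ ^ 2 / (N : ℝ)) atTop (𝓝 0) := by
    simpa [div_eq_mul_inv] using tinv.const_mul (4 * Λ ^ 2)
  have t2 : Tendsto (fun N : ℕ => 2 * Λ / (N : ℝ) ^ 2) atTop (𝓝 0) := by
    simpa [div_eq_mul_inv] using (tinv.pow 2).const_mul (2 * Λ)
  obtain ⟨N₀, hN₀⟩ := eventually_atTop.1 (((t1.eventually_lt_const (by positivity : 0 < r ^ 2)).and
    (t2.eventually_lt_const (by norm_num : (0 : ℝ) < 1 / 2))).and (eventually_ge_atTop 1))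
  have step' : ∀ N : ℕ, ∃ (z : E₁) (y P : E₂), N₀ ≤ N → (‖P‖ ≤ 2 * Λ ∧ ‖z - z₀‖ ^ 2 ≤ 4 * Λ ^ 2 / N ∧
        ‖L z - y‖ ≤ 2 * Λ / (N : ℝ) ^ 2 ∧ (z ∈ interior U₁ →
        F₁ z (Lt P + (1 / (N : ℝ)) • (z - z₀)) - F₂ y P ≤
          ∑ i, (C ^ 2 * (4 * Λ ^ 2) / (N : ℝ) ^ 2
            + 1 / (N : ℝ) * (‖σ₁ z i‖ ^ 2 + ‖σ₂ y i‖ ^ 2)))) := by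
    intro N
    by_cases h : N₀ ≤ N
    · obtain ⟨z, y, P, hh⟩ := step N (hN₀ N h).2 (hN₀ N h).1.1 (hN₀ N h).1.2
      exact ⟨z, y, P, fun _ => hh⟩
    · exact ⟨0, 0, 0, fun h' => absurd h' h⟩
  choose z y P hzyP using step'
  obtain ⟨P₀, hP₀, s, hs, tP⟩ := (isCompact_closedBall (0 : E₂) (2 * Λ)).tendsto_subseq
    (x := fun N => P (N + N₀)) (fun N => by simpa using (hzyP (N + N₀) (by omega)).1)
  have hs' : Tendsto (fun j => s j + N₀) atTop atTop :=
    tendsto_atTop_mono (fun j => Nat.le_add_right _ _) hs.tendsto_atTop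
  have tz : Tendsto (fun j => z (s j + N₀)) atTop (𝓝 z₀) := by
    refine tendsto_iff_norm_sub_tendsto_zero.2 ?_
    have : Tendsto (fun j => ‖z (s j + N₀) - z₀‖ ^ 2) atTop (𝓝 0) :=
      squeeze_zero (fun _ => sq_nonneg _) (fun j => (hzyP (s j + N₀) (by omega)).2.1)
        (t1.comp hs')
    have h2 := this.sqrt
    simpa using h2
  have tLzy : Tendsto (fun j => L (z (s j + N₀)) - y (s j + N₀)) atTop (𝓝 0) :=
    squeeze_zero_norm (fun j => (hzyP (s j + N₀) (by omega)).2.2.1) (t2.comp hs')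
  have tLz := (L.continuous.tendsto z₀).comp tz
  have ty : Tendsto (fun j => y (s j + N₀)) atTop (𝓝 (L z₀)) := by
    have := tLz.sub tLzy
    simpa using this
  have tp₁ : Tendsto (fun j => Lt (P (s j + N₀)) + (1 / ((s j + N₀ : ℕ) : ℝ)) • (z (s j + N₀) - z₀))
      atTop (𝓝 (Lt P₀ + (0 : ℝ) • (z₀ - z₀))) :=
    ((Lt.continuous.tendsto P₀).comp tP).add ((tinv.comp hs').smul (tz.sub_const z₀))
  rw [zero_smul, add_zero] at tp₁
  refine ⟨P₀, by simpa using hP₀, ?_⟩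
  have tL : Tendsto (fun j => F₁ (z (s j + N₀)) (Lt (P (s j + N₀)) +
      (1 / ((s j + N₀ : ℕ) : ℝ)) • (z (s j + N₀) - z₀)) - F₂ (y (s j + N₀)) (P (s j + N₀))) atTop
      (𝓝 (F₁ z₀ (Lt P₀) - F₂ (L z₀) P₀)) :=
    ((hF₁.tendsto (z₀, Lt P₀)).comp (tz.prodMk_nhds tp₁)).sub
      ((hF₂.tendsto (L z₀, P₀)).comp (ty.prodMk_nhds tP))
  have t3 : Tendsto (fun N : ℕ => C ^ 2 * (4 * Λ ^ 2) / (N : ℝ) ^ 2) atTop (𝓝 0) := by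
    simpa [div_eq_mul_inv] using (tinv.pow 2).const_mul (C ^ 2 * (4 * Λ ^ 2))
  have tR : Tendsto (fun j => ∑ i, (C ^ 2 * (4 * Λ ^ 2) / ((s j + N₀ : ℕ) : ℝ) ^ 2
      + 1 / ((s j + N₀ : ℕ) : ℝ) * (‖σ₁ (z (s j + N₀)) i‖ ^ 2 + ‖σ₂ (y (s j + N₀)) i‖ ^ 2))) atTop
      (𝓝 (∑ i : ι, (0 + 0 * (‖σ₁ z₀ i‖ ^ 2 + ‖σ₂ (L z₀) i‖ ^ 2)))) :=
    tendsto_finsetSum _ fun i _ => (t3.comp hs').add ((tinv.comp hs').mul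
      (((((hσ₁ i).tendsto z₀).comp tz).norm.pow 2).add
        ((((hσ₂c i).tendsto (L z₀)).comp ty).norm.pow 2)))
  have := le_of_tendsto_of_tendsto tL tR (by
    filter_upwards [tz.eventually (isOpen_interior.mem_nhds (mem_interior_iff_mem_nhds.2 hU₁))]
      with j hj using (hzyP (s j + N₀) (by omega)).2.2.2 hj)
  simp at this
  exact this

end Jets

section Quadratic

set_option linter.unusedSectionVars false

open scoped RealInnerProductSpace

variable {E : Type*} [NormedAddCommGroup E] [InnerProductSpace ℝ E]

/-- The quadratic test function with gradient `q` and (unsymmetrised) Hessian `X` at `z`. -/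
def quadFun (z q : E) (X : E →L[ℝ] E) : E → ℝ :=
  fun y => ⟪q, y - z⟫ + 1 / 2 * ⟪X (y - z), y - z⟫

theorem contDiff_quadFun (z q : E) (X : E →L[ℝ] E) {k : WithTop ℕ∞} :
    ContDiff ℝ k (quadFun z q X) := by
  unfold quadFun
  have h1 : ContDiff ℝ k fun y : E => y - z := contDiff_id.sub contDiff_const
  exact (contDiff_const.inner ℝ h1).add (contDiff_const.mul ((X.contDiff.comp h1).inner ℝ h1))

variable [FiniteDimensional ℝ E]

theorem fderiv_quadFun (z q : E) (X : E →L[ℝ] E) (y : E) :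
    HasFDerivAt (quadFun z q X)
      (innerSL ℝ (q + (1 / 2 : ℝ) • (X + ContinuousLinearMap.adjoint X) (y - z))) y := by
  have h1 : HasFDerivAt (fun y : E => y - z) (ContinuousLinearMap.id ℝ E) y :=
    (hasFDerivAt_id y).sub_const z
  have h2 := (X.hasFDerivAt (x := y - z)).comp y h1
  have h3 := ((hasFDerivAt_const q y).inner ℝ h1).add ((h2.inner ℝ h1).const_mul (1 / 2))
  refine h3.congr_fderiv ?_
  ext d
  simp [ContinuousLinearMap.adjoint_inner_left, inner_sub_left, inner_sub_right,
    real_inner_comm]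
  ring

theorem gradient_quadFun (z q : E) (X : E →L[ℝ] E) : gradient (quadFun z q X) z = q := by
  have := (fderiv_quadFun z q X z).fderiv
  rw [gradient, this, sub_self, map_zero, smul_zero, add_zero]
  exact (InnerProductSpace.toDual ℝ E).symm_apply_apply q

theorem hess_quadFun {n : ℕ} (z q : Euc n) (X : Euc n →L[ℝ] Euc n) (i j : Fin n) :
    hess (quadFun z q X) z i j = 1 / 2 *
      (⟪X (EuclideanSpace.single i 1), EuclideanSpace.single j 1⟫ +
        ⟪X (EuclideanSpace.single j 1), EuclideanSpace.single i 1⟫) := by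
  have h1 : fderiv ℝ (quadFun z q X) = fun y =>
      innerSL ℝ (q + (1 / 2 : ℝ) • (X + ContinuousLinearMap.adjoint X) (y - z)) := by
    ext1 y; exact (fderiv_quadFun z q X y).fderiv
  have h2 : HasFDerivAt (fun y => innerSL ℝ (q + (1 / 2 : ℝ) • (X + ContinuousLinearMap.adjoint X) (y - z)))
      ((innerSL ℝ).comp ((1 / 2 : ℝ) • (X + ContinuousLinearMap.adjoint X))) z := by
    have h3 : HasFDerivAt (fun y : Euc n => q + (1 / 2 : ℝ) • (X + ContinuousLinearMap.adjoint X) (y - z))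
        ((1 / 2 : ℝ) • (X + ContinuousLinearMap.adjoint X)) z := by
      have h4 : HasFDerivAt (fun y : Euc n => y - z) (ContinuousLinearMap.id ℝ (Euc n)) z :=
        (hasFDerivAt_id z).sub_const z
      have := ((1 / 2 : ℝ) • (X + ContinuousLinearMap.adjoint X)).hasFDerivAt (x := z - z)
      exact (HasFDerivAt.comp (f := fun y : Euc n => y - z) z this h4).const_add q
    exact ((innerSL ℝ).hasFDerivAt).comp z h3
  rw [hess, iteratedFDeriv_two_apply, h1, h2.fderiv]
  simp [ContinuousLinearMap.adjoint_inner_left, real_inner_comm]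
  ring

end Quadratic

section Bridge

set_option linter.unusedSectionVars false

open scoped RealInnerProductSpace

variable {n m : ℕ}

/-- The `i`-th column of `Σ_k(y, ω)`. -/
def sigCol (S : Setting n m) (ω : S.Ω) (k : Fin m) (y : Euc n) (i : Fin n) : Euc n :=
  WithLp.toLp 2 fun a => S.Sig k y ω a i

theorem sigCol_eq (S : Setting n m) (ω : S.Ω) (k : Fin m) (y : Euc n) (i : Fin n) :
    sigCol S ω k y i = ∑ a, S.Sig k y ω a i • EuclideanSpace.single a (1 : ℝ) := by
  ext b
  simp [sigCol, Finset.sum_apply, Pi.single_apply]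

theorem trace_hess_quadFun (S : Setting n m) (ω : S.Ω) (k : Fin m) (y z q : Euc n)
    (X : Euc n →L[ℝ] Euc n) :
    (S.A k y ω * hess (quadFun z q X) z).trace =
      ∑ i, ⟪X (sigCol S ω k y i), sigCol S ω k y i⟫ := by
  have h : ∀ i, ⟪X (sigCol S ω k y i), sigCol S ω k y i⟫ = ∑ a, ∑ b, S.Sig k y ω a i *
      S.Sig k y ω b i * ⟪X (EuclideanSpace.single a 1), EuclideanSpace.single b 1⟫ := by
    intro i
    rw [sigCol_eq, map_sum, sum_inner]
    refine Finset.sum_congr rfl fun a _ => ?_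
    rw [inner_sum]
    refine Finset.sum_congr rfl fun b _ => ?_
    rw [map_smul, real_inner_smul_left, real_inner_smul_right]
    ring
  have h' : ∀ i, ⟪X (sigCol S ω k y i), sigCol S ω k y i⟫ = ∑ a, ∑ b, S.Sig k y ω a i *
      S.Sig k y ω b i * hess (quadFun z q X) z b a := by
    intro i
    have hs : ∑ a, ∑ b, S.Sig k y ω a i *
      S.Sig k y ω b i * ⟪X (EuclideanSpace.single a 1), EuclideanSpace.single b 1⟫ =
        ∑ a, ∑ b, S.Sig k y ω a i *
      S.Sig k y ω b i * ⟪X (EuclideanSpace.single b 1), EuclideanSpace.single a 1⟫ := by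
      rw [Finset.sum_comm]
      refine Finset.sum_congr rfl fun b _ => Finset.sum_congr rfl fun a _ => by ring
    have h2 := h i
    have h3 := h i
    rw [hs] at h3
    have : ⟪X (sigCol S ω k y i), sigCol S ω k y i⟫ = 1 / 2 *
      (⟪X (sigCol S ω k y i), sigCol S ω k y i⟫ + ⟪X (sigCol S ω k y i), sigCol S ω k y i⟫) := by
      ring
    rw [this]
    nth_rewrite 1 [h2]
    rw [h3, ← Finset.sum_add_distrib, Finset.mul_sum]
    refine Finset.sum_congr rfl fun a _ => ?_
    rw [← Finset.sum_add_distrib, Finset.mul_sum]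
    refine Finset.sum_congr rfl fun b _ => ?_
    rw [hess_quadFun]
    ring
  simp_rw [h', Matrix.trace, Matrix.diag_apply, Matrix.mul_apply, S.A_sq, Matrix.mul_apply,
    Matrix.transpose_apply, Finset.sum_mul]
  rw [Finset.sum_comm (s := (Finset.univ : Finset (Fin n)))
    (f := fun i a => ∑ b, S.Sig k y ω a i * S.Sig k y ω b i * hess (quadFun z q X) z b a)]
  exact Finset.sum_congr rfl fun a _ => Finset.sum_comm

theorem Setting.continuous_H (S : Setting n m) (ω : S.Ω) (k : Fin m) :
    Continuous fun z : Euc n × (Fin m → ℝ) × (Fin m → ℝ) × Euc n =>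
      S.H k z.1 z.2.1 z.2.2.1 z.2.2.2 ω := by
  rw [continuous_iff_continuousAt]
  intro z₀
  obtain ⟨C, hC, h⟩ := S.H_cont (‖z₀.2.1‖ + ‖z₀.2.2.1‖ + 1) (by positivity)
  rw [ContinuousAt, tendsto_iff_norm_sub_tendsto_zero]
  have hb : ∀ᶠ z in 𝓝 z₀, ‖z.2.1‖ < ‖z₀.2.1‖ + ‖z₀.2.2.1‖ + 1 ∧
      ‖z.2.2.1‖ < ‖z₀.2.1‖ + ‖z₀.2.2.1‖ + 1 := by
    refine (Tendsto.eventually_lt_const (f := fun z : Euc n × (Fin m → ℝ) × (Fin m → ℝ) × Euc n =>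
      ‖z.2.1‖) (v := ‖z₀.2.1‖) ?_ ?_).and (Tendsto.eventually_lt_const
        (f := fun z : Euc n × (Fin m → ℝ) × (Fin m → ℝ) × Euc n => ‖z.2.2.1‖)
        (v := ‖z₀.2.2.1‖) ?_ ?_)
    · linarith [norm_nonneg z₀.2.2.1]
    · exact Continuous.tendsto (by fun_prop) _
    · linarith [norm_nonneg z₀.2.1]
    · exact Continuous.tendsto (by fun_prop) _
  refine squeeze_zero' (Eventually.of_forall fun _ => norm_nonneg _) (hb.mono fun z hz =>
    h k z.1 z₀.1 z.2.1 z₀.2.1 z.2.2.1 z₀.2.2.1 z.2.2.2 z₀.2.2.2 ω hz.1.le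
      (by linarith [norm_nonneg z₀.2.2.1]) hz.2.le (by linarith [norm_nonneg z₀.2.1])) ?_
  have hg : Continuous fun z : Euc n × (Fin m → ℝ) × (Fin m → ℝ) × Euc n =>
      C * ((1 + ‖z.1‖ + ‖z₀.1‖) ^ (S.γ k - 1) * ‖z.1 - z₀.1‖ + ‖z.2.1 - z₀.2.1‖
        + ‖z.2.2.1 - z₀.2.2.1‖ + ‖z.2.2.2 - z₀.2.2.2‖) := by
    have : Continuous fun z : Euc n × (Fin m → ℝ) × (Fin m → ℝ) × Euc n =>
        (1 + ‖z.1‖ + ‖z₀.1‖) ^ (S.γ k - 1) :=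
      Continuous.rpow_const (by fun_prop) fun z => Or.inl (by positivity)
    fun_prop
  have := hg.tendsto z₀
  simpa using this

/-- The first-order part of the macroscopic system, frozen along `v`. -/
def macroF (S : Setting n m) (p : Euc n) (r δ : ℝ) (ω : S.Ω) (v : Fin m → Euc n → ℝ) (k : Fin m)
    (y q : Euc n) : ℝ :=
  δ * v k y + S.H k (p + q) (fun _ => r) (fun j => v k y - v j y) y ω

theorem continuous_macroF (S : Setting n m) (p : Euc n) (r δ : ℝ) (ω : S.Ω)
    {v : Fin m → Euc n → ℝ} (hv : ∀ k, Continuous (v k)) (k : Fin m) :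
    Continuous fun z : Euc n × Euc n => macroF S p r δ ω v k z.1 z.2 := by
  unfold macroF
  refine (continuous_const.mul ((hv k).comp continuous_fst)).add ?_
  refine (S.continuous_H ω k).comp (g := _) (f := fun z : Euc n × Euc n =>
    (p + z.2, (fun _ => r), (fun j => v k z.1 - v j z.1), z.1)) ?_
  refine Continuous.prodMk (by fun_prop) (Continuous.prodMk continuous_const
    (Continuous.prodMk (continuous_pi fun j => ?_) continuous_fst))
  exact ((hv k).comp continuous_fst).sub ((hv j).comp continuous_fst)

theorem macro_jsub {S : Setting n m} {p : Euc n} {r δ : ℝ} {ω : S.Ω} {v : Fin m → Euc n → ℝ}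
    (h : IsViscSubOn (macroOp S p r δ ω) Set.univ v) (k : Fin m) :
    JSub Set.univ (sigCol S ω k) (macroF S p r δ ω v k) (v k) := by
  intro z _ q X hX
  have := h k (quadFun z q X) (contDiff_quadFun z q X) z (Set.mem_univ z) (by
    rw [isLocalMaxOn_univ_iff]
    have ht : Tendsto (fun y : Euc n => y - z) (𝓝 z) (𝓝 0) := by
      have : Tendsto (fun y : Euc n => y - z) (𝓝 z) (𝓝 (z - z)) := Continuous.tendsto (by fun_prop) _
      simpa using this
    filter_upwards [ht.eventually hX] with y hy
    simp only [quadFun, sub_self, inner_zero_right, map_zero]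
    rw [add_sub_cancel] at hy
    linarith)
  rw [macroOp, gradient_quadFun, trace_hess_quadFun] at this
  unfold macroF
  linarith

theorem macro_jsup {S : Setting n m} {p : Euc n} {r δ : ℝ} {ω : S.Ω} {v : Fin m → Euc n → ℝ}
    (h : IsViscSupOn (macroOp S p r δ ω) Set.univ v) (k : Fin m) :
    JSup Set.univ (sigCol S ω k) (macroF S p r δ ω v k) (v k) := by
  intro z _ q X hX
  have := h k (quadFun z q X) (contDiff_quadFun z q X) z (Set.mem_univ z) (by
    rw [IsLocalMinOn, nhdsWithin_univ]
    have ht : Tendsto (fun y : Euc n => y - z) (𝓝 z) (𝓝 0) := by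
      have : Tendsto (fun y : Euc n => y - z) (𝓝 z) (𝓝 (z - z)) := Continuous.tendsto (by fun_prop) _
      simpa using this
    filter_upwards [ht.eventually hX] with y hy
    simp only [quadFun, sub_self, inner_zero_right, map_zero]
    rw [add_sub_cancel] at hy
    linarith)
  rw [macroOp, gradient_quadFun, trace_hess_quadFun] at this
  unfold macroF
  linarith

end Bridge

section Parabolic

set_option linter.unusedSectionVars false

open scoped RealInnerProductSpace

variable {n m : ℕ}

/-- Space-time with its Euclidean norm. -/
abbrev SpT (n : ℕ) := WithLp 2 (Euc n × ℝ)

/-- A function on `ℝⁿ × ℝ` regarded as a function on the Euclidean space-time. -/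
def onSpT (u : Euc n × ℝ → ℝ) : SpT n → ℝ := fun z => u (z.fst, z.snd)

theorem continuous_onSpT {u : Euc n × ℝ → ℝ} (hu : Continuous u) : Continuous (onSpT u) :=
  hu.comp (continuous_fst'.prodMk continuous_snd')

/-- A test function on space-time. -/
def quadST (z q : SpT n) (X : SpT n →L[ℝ] SpT n) : Euc n × ℝ → ℝ :=
  fun w => quadFun z q X (pr w.1 w.2)

theorem contDiff_quadST (z q : SpT n) (X : SpT n →L[ℝ] SpT n) : ContDiff ℝ 2 (quadST z q X) := by
  have h : ContDiff ℝ 2 fun w : Euc n × ℝ => (pr w.1 w.2 : SpT n) :=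
    (WithLp.prodContinuousLinearEquiv 2 ℝ (Euc n) ℝ).symm.contDiff
  exact (contDiff_quadFun z q X).comp h

theorem quadST_space (z q : SpT n) (X : SpT n →L[ℝ] SpT n) :
    (fun x => quadST z q X (x, z.snd)) = quadFun z.fst q.fst (proj₁.comp (X.comp incl₁)) := by
  ext1 x
  have h : (pr x z.snd : SpT n) - z = pr (x - z.fst) 0 := by
    rw [← sub_self z.snd, pr_sub, pr_fst_snd]
  simp only [quadST, quadFun, h, inner_pr_right, inner_zero_right, add_zero,
    ContinuousLinearMap.comp_apply, incl₁_apply, proj₁_apply]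

theorem quadST_time (z q : SpT n) (X : SpT n →L[ℝ] SpT n) :
    (fun t => quadST z q X (z.fst, t)) = quadFun z.snd q.snd (proj₂.comp (X.comp incl₂)) := by
  ext1 x
  have h : (pr z.fst x : SpT n) - z = pr 0 (x - z.snd) := by
    rw [← sub_self z.fst, pr_sub, pr_fst_snd]
  simp only [quadST, quadFun, h, inner_pr_right, inner_zero_right, zero_add,
    ContinuousLinearMap.comp_apply, incl₂_apply, proj₂_apply]

theorem gradX_quadST (z q : SpT n) (X : SpT n →L[ℝ] SpT n) :
    gradX (quadST z q X) z.fst z.snd = q.fst := by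
  rw [gradX, quadST_space, gradient_quadFun]

theorem derT_quadST (z q : SpT n) (X : SpT n →L[ℝ] SpT n) :
    derT (quadST z q X) z.fst z.snd = q.snd := by
  rw [derT, quadST_time]
  have := (fderiv_quadFun z.snd q.snd (proj₂.comp (X.comp incl₂)) z.snd).hasDerivAt.deriv
  rw [this]
  simp [pr_zero]

/-- Columns of the diffusion of the `ε`-system. -/
def epsCol (S : Setting n (m + 1)) (ε : ℝ) (ω : S.Ω) (k : Fin (m + 1)) (z : SpT n) (i : Fin n) :
    SpT n :=
  pr (√ε • sigCol S ω k (ε⁻¹ • z.fst) i) 0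

/-- The first-order part of the `ε`-system, frozen along `u`. -/
def epsF (S : Setting n (m + 1)) (ε : ℝ) (ω : S.Ω) (u : Fin (m + 1) → Euc n × ℝ → ℝ)
    (k : Fin (m + 1)) (z q : SpT n) : ℝ :=
  q.snd + S.H k q.fst (fun j => onSpT (u j) z) (fun j => (onSpT (u k) z - onSpT (u j) z) / ε)
    (ε⁻¹ • z.fst) ω

theorem trace_hessX_quadST (S : Setting n (m + 1)) {ε : ℝ} (hε : 0 < ε) (ω : S.Ω) (k : Fin (m + 1))
    (z q : SpT n) (X : SpT n →L[ℝ] SpT n) :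
    ε * (S.A k (ε⁻¹ • z.fst) ω * hessX (quadST z q X) z.fst z.snd).trace =
      ∑ i, ⟪X (epsCol S ε ω k z i), epsCol S ε ω k z i⟫ := by
  rw [hessX, quadST_space, trace_hess_quadFun, Finset.mul_sum]
  refine Finset.sum_congr rfl fun i _ => ?_
  have : epsCol S ε ω k z i = √ε • incl₁ (sigCol S ω k (ε⁻¹ • z.fst) i) := by
    rw [incl₁_apply, ← pr_smul, smul_zero]; rfl
  rw [this, map_smul, real_inner_smul_left, real_inner_smul_right, incl₁_apply, inner_pr_right,
    inner_zero_right, add_zero, ← mul_assoc, Real.mul_self_sqrt hε.le]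
  rfl

theorem tendsto_pr_sub (z : SpT n) :
    Tendsto (fun w : Euc n × ℝ => (pr w.1 w.2 : SpT n) - z) (𝓝 (z.fst, z.snd)) (𝓝 0) := by
  have : Continuous fun w : Euc n × ℝ => (pr w.1 w.2 : SpT n) - z :=
    continuous_pr.sub continuous_const
  have h := this.tendsto (z.fst, z.snd)
  simpa [pr_fst_snd] using h

/-- The open upper half of space-time. -/
def upperHalf (n : ℕ) : Set (SpT n) := {z | 0 < z.snd}

theorem isOpen_upperHalf : IsOpen (upperHalf n) := isOpen_lt continuous_const continuous_snd'

theorem eps_jsub {S : Setting n (m + 1)} {ε : ℝ} (hε : 0 < ε) {ω : S.Ω}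
    {u : Fin (m + 1) → Euc n × ℝ → ℝ}
    (h : IsParSubOn (epsOp S ε ω) (Set.univ ×ˢ Set.Ioi (0 : ℝ)) u) (k : Fin (m + 1)) :
    JSub (upperHalf n) (epsCol S ε ω k) (epsF S ε ω u k) (onSpT (u k)) := by
  intro z hz q X hX
  have := h k (quadST z q X) (contDiff_quadST z q X) (z.fst, z.snd) ⟨Set.mem_univ _, hz⟩ (by
    refine Filter.Eventually.filter_mono nhdsWithin_le_nhds ?_
    filter_upwards [(tendsto_pr_sub z).eventually hX] with y hy
    simp only [quadST, quadFun, pr_fst_snd, sub_self, inner_zero_right, map_zero]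
    rw [add_sub_cancel] at hy
    simp only [onSpT, pr_fst, pr_snd] at hy
    linarith)
  rw [epsOp, gradX_quadST, derT_quadST, trace_hessX_quadST S hε] at this
  simp only [epsF, onSpT]
  linarith

theorem eps_jsup {S : Setting n (m + 1)} {ε : ℝ} (hε : 0 < ε) {ω : S.Ω}
    {u : Fin (m + 1) → Euc n × ℝ → ℝ}
    (h : IsParSupOn (epsOp S ε ω) (Set.univ ×ˢ Set.Ioi (0 : ℝ)) u) (k : Fin (m + 1)) :
    JSup (upperHalf n) (epsCol S ε ω k) (epsF S ε ω u k) (onSpT (u k)) := by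
  intro z hz q X hX
  have := h k (quadST z q X) (contDiff_quadST z q X) (z.fst, z.snd) ⟨Set.mem_univ _, hz⟩ (by
    refine Filter.Eventually.filter_mono nhdsWithin_le_nhds ?_
    filter_upwards [(tendsto_pr_sub z).eventually hX] with y hy
    simp only [quadST, quadFun, pr_fst_snd, sub_self, inner_zero_right, map_zero]
    rw [add_sub_cancel] at hy
    simp only [onSpT, pr_fst, pr_snd] at hy
    linarith)
  rw [epsOp, gradX_quadST, derT_quadST, trace_hessX_quadST S hε] at this
  simp only [epsF, onSpT]
  linarith

theorem continuous_epsF (S : Setting n (m + 1)) (ε : ℝ) (ω : S.Ω)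
    {u : Fin (m + 1) → Euc n × ℝ → ℝ} (hu : ∀ k, Continuous (u k)) (k : Fin (m + 1)) :
    Continuous fun z : SpT n × SpT n => epsF S ε ω u k z.1 z.2 := by
  unfold epsF
  have hc : ∀ j, Continuous fun z : SpT n × SpT n => onSpT (u j) z.1 := fun j =>
    (continuous_onSpT (hu j)).comp continuous_fst
  refine (continuous_snd'.comp continuous_snd).add ?_
  refine (S.continuous_H ω k).comp (g := _) (f := fun z : SpT n × SpT n =>
    (z.2.fst, (fun j => onSpT (u j) z.1),
      (fun j => (onSpT (u k) z.1 - onSpT (u j) z.1) / ε), ε⁻¹ • z.1.fst)) ?_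
  exact Continuous.prodMk (continuous_fst'.comp continuous_snd)
    (Continuous.prodMk (continuous_pi hc)
      (Continuous.prodMk (continuous_pi fun j => ((hc k).sub (hc j)).div_const ε)
        ((continuous_const_smul ε⁻¹).comp (continuous_fst'.comp continuous_fst))))

/-- First-order superjet formulation of `w_t + H̄(Dw, w) ≤ 0` on `{t > 0}`. -/
def Jet1Sub (Hb : Euc n → ℝ → ℝ) (w : SpT n → ℝ) : Prop :=
  ∀ z, 0 < z.snd → ∀ (q : SpT n) (C : ℝ),
    (∀ᶠ d in 𝓝 (0 : SpT n), w (z + d) ≤ w z + ⟪q, d⟫ + C * ‖d‖ ^ 2) →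
      q.snd + Hb q.fst (w z) ≤ 0

/-- First-order subjet formulation of `w_t + H̄(Dw, w) ≥ 0` on `{t > 0}`. -/
def Jet1Sup (Hb : Euc n → ℝ → ℝ) (w : SpT n → ℝ) : Prop :=
  ∀ z, 0 < z.snd → ∀ (q : SpT n) (C : ℝ),
    (∀ᶠ d in 𝓝 (0 : SpT n), w z + ⟪q, d⟫ - C * ‖d‖ ^ 2 ≤ w (z + d)) →
      0 ≤ q.snd + Hb q.fst (w z)

theorem jet1Sub_of_isParSubOn1 {Hb : Euc n → ℝ → ℝ} {u : Euc n × ℝ → ℝ}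
    (h : IsParSubOn1 (fun _x _t val ut q => ut + Hb q val) (Set.univ ×ˢ Set.Ioi (0 : ℝ)) u) :
    Jet1Sub Hb (onSpT u) := by
  intro z hz q C hX
  have := h (quadST z q ((2 * C) • ContinuousLinearMap.id ℝ _)) (contDiff_quadST z q _)
    (z.fst, z.snd) ⟨Set.mem_univ _, hz⟩ (by
    refine Filter.Eventually.filter_mono nhdsWithin_le_nhds ?_
    filter_upwards [(tendsto_pr_sub z).eventually hX] with y hy
    simp only [quadST, quadFun, pr_fst_snd, sub_self, inner_zero_right, _root_.smul_apply,
      ContinuousLinearMap.id_apply, real_inner_smul_left, real_inner_self_eq_norm_sq]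
    rw [add_sub_cancel] at hy
    simp only [onSpT, pr_fst, pr_snd] at hy
    linarith)
  rwa [gradX_quadST, derT_quadST] at this

theorem jet1Sup_of_isParSupOn1 {Hb : Euc n → ℝ → ℝ} {u : Euc n × ℝ → ℝ}
    (h : IsParSupOn1 (fun _x _t val ut q => ut + Hb q val) (Set.univ ×ˢ Set.Ioi (0 : ℝ)) u) :
    Jet1Sup Hb (onSpT u) := by
  intro z hz q C hX
  have := h (quadST z q ((2 * -C) • ContinuousLinearMap.id ℝ _)) (contDiff_quadST z q _)
    (z.fst, z.snd) ⟨Set.mem_univ _, hz⟩ (by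
    refine Filter.Eventually.filter_mono nhdsWithin_le_nhds ?_
    filter_upwards [(tendsto_pr_sub z).eventually hX] with y hy
    simp only [quadST, quadFun, pr_fst_snd, sub_self, inner_zero_right, _root_.smul_apply,
      ContinuousLinearMap.id_apply, real_inner_smul_left, real_inner_self_eq_norm_sq]
    rw [add_sub_cancel] at hy
    simp only [onSpT, pr_fst, pr_snd] at hy
    linarith)
  rwa [gradX_quadST, derT_quadST] at this

/-- A `C²` function has a quadratic first-order Taylor remainder. -/
theorem exists_taylor_bound {φ : Euc n × ℝ → ℝ} (hφ : ContDiff ℝ 2 φ) (z : SpT n) :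
    ∃ C : ℝ, ∀ᶠ d in 𝓝 (0 : SpT n), |onSpT φ (z + d) - onSpT φ z -
      ⟪pr (gradX φ z.fst z.snd) (derT φ z.fst z.snd), d⟫| ≤ C * ‖d‖ ^ 2 := by
  have hψ : ContDiff ℝ 2 (onSpT φ) := by
    have : ContDiff ℝ 2 fun z : SpT n => (z.fst, z.snd) :=
      (WithLp.prodContinuousLinearEquiv 2 ℝ (Euc n) ℝ).contDiff
    exact hφ.comp this
  have hd : ∀ y, DifferentiableAt ℝ (onSpT φ) y := fun y =>
    (hψ.differentiable (by norm_num)).differentiableAt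
  have h1 : ContDiff ℝ 1 (fderiv ℝ (onSpT φ)) := hψ.fderiv_right (by norm_num)
  obtain ⟨K, s, hs, hK⟩ := h1.contDiffAt (x := z) |>.exists_lipschitzOnWith
  obtain ⟨ρ, hρ, hball⟩ := Metric.mem_nhds_iff.1 hs
  have hin : ∀ d : SpT n, fderiv ℝ (onSpT φ) z d =
      ⟪pr (gradX φ z.fst z.snd) (derT φ z.fst z.snd), d⟫ := by
    intro d
    have e1 : fderiv ℝ (onSpT φ) z (incl₁ d.fst) = ⟪gradX φ z.fst z.snd, d.fst⟫ := by
      have hc : HasFDerivAt (fun x : Euc n => onSpT φ (pr x z.snd))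
          ((fderiv ℝ (onSpT φ) z).comp incl₁) z.fst := by
        have h3 : HasFDerivAt (fun x : Euc n => (pr x z.snd : SpT n)) incl₁ z.fst := by
          have : (fun x : Euc n => (pr x z.snd : SpT n)) = fun x => incl₁ x + pr 0 z.snd := by
            ext1 x; rw [incl₁_apply, ← pr_add, add_zero, zero_add]
          rw [this]
          exact (incl₁.hasFDerivAt).add_const _
        exact HasFDerivAt.comp (g := onSpT φ) (g' := fderiv ℝ (onSpT φ) z)
          (f := fun x : Euc n => (pr x z.snd : SpT n)) z.fst (hd z).hasFDerivAt h3
      have h4 : gradX φ z.fst z.snd = (InnerProductSpace.toDual ℝ (Euc n)).symm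
          ((fderiv ℝ (onSpT φ) z).comp incl₁) := by
        rw [gradX, gradient, ← hc.fderiv]; rfl
      rw [h4, InnerProductSpace.toDual_symm_apply]; rfl
    have e2 : fderiv ℝ (onSpT φ) z (incl₂ d.snd) = derT φ z.fst z.snd * d.snd := by
      have hc : HasFDerivAt (fun t : ℝ => onSpT φ (pr z.fst t))
          ((fderiv ℝ (onSpT φ) z).comp incl₂) z.snd := by
        have h3 : HasFDerivAt (fun x : ℝ => (pr z.fst x : SpT n)) incl₂ z.snd := by
          have : (fun x : ℝ => (pr z.fst x : SpT n)) = fun x => incl₂ x + pr z.fst 0 := by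
            ext1 x; rw [incl₂_apply, ← pr_add, add_zero, zero_add]
          rw [this]
          exact (incl₂.hasFDerivAt).add_const _
        exact HasFDerivAt.comp (g := onSpT φ) (g' := fderiv ℝ (onSpT φ) z)
          (f := fun x : ℝ => (pr z.fst x : SpT n)) z.snd (hd z).hasFDerivAt h3
      have h4 : derT φ z.fst z.snd = fderiv ℝ (onSpT φ) z (incl₂ 1) := by
        rw [derT]; exact hc.hasDerivAt.deriv
      rw [h4]
      have : (incl₂ d.snd : SpT n) = d.snd • incl₂ 1 := by
        rw [← map_smul, smul_eq_mul, mul_one]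
      rw [this, map_smul, smul_eq_mul, mul_comm]
    have e3 : d = incl₁ d.fst + incl₂ d.snd := by
      rw [incl₁_apply, incl₂_apply, ← pr_add, add_zero, zero_add, pr_fst_snd]
    conv_lhs => rw [e3, map_add, e1, e2]
    rw [inner_pr]
    simp [mul_comm]
  refine ⟨K, ?_⟩
  filter_upwards [Metric.ball_mem_nhds (0 : SpT n) hρ] with d hd'
  have hd0 : ‖d‖ < ρ := by simpa using hd'
  have := (convex_ball z ρ |>.inter (convex_closedBall z ‖d‖)).norm_image_sub_le_of_norm_fderiv_le'
    (f := onSpT φ) (C := K * ‖d‖) (φ := fderiv ℝ (onSpT φ) z) (x := z) (y := z + d)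
    (fun y _ => hd y) (fun y hy => by
      have := hK.dist_le_mul y (hball hy.1) z (mem_of_mem_nhds hs)
      rw [dist_eq_norm] at this
      refine this.trans ?_
      gcongr
      exact hy.2)
    ⟨Metric.mem_ball_self hρ, Metric.mem_closedBall_self (norm_nonneg d)⟩
    ⟨by simpa using hd0, by simp⟩
  rw [add_sub_cancel_left, hin, Real.norm_eq_abs] at this
  refine this.trans (le_of_eq (by ring))

theorem isParSubOn1_of_jet1Sub {Hb : Euc n → ℝ → ℝ} {u : Euc n × ℝ → ℝ}
    (h : Jet1Sub Hb (onSpT u)) :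
    IsParSubOn1 (fun _x _t val ut q => ut + Hb q val) (Set.univ ×ˢ Set.Ioi (0 : ℝ)) u := by
  intro φ hφ z hz hmax
  obtain ⟨C, hC⟩ := exists_taylor_bound hφ (pr z.1 z.2)
  have hU : (Set.univ ×ˢ Set.Ioi (0 : ℝ) : Set (Euc n × ℝ)) ∈ 𝓝 z :=
    (isOpen_univ.prod isOpen_Ioi).mem_nhds hz
  have hm : ∀ᶠ y in 𝓝 z, u y - φ y ≤ u z - φ z := by
    have := hmax; rw [IsLocalMaxOn, nhdsWithin_eq_nhds.2 hU] at this; exact this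
  have ht : Tendsto (fun d : SpT n => (z.1 + d.fst, z.2 + d.snd)) (𝓝 0) (𝓝 z) := by
    have : Continuous fun d : SpT n => (z.1 + d.fst, z.2 + d.snd) :=
      (continuous_const.add continuous_fst').prodMk (continuous_const.add continuous_snd')
    simpa using this.tendsto 0
  refine h (pr z.1 z.2) hz.2 (pr (gradX φ z.1 z.2) (derT φ z.1 z.2)) C ?_
  filter_upwards [hC, ht.eventually hm] with d h1 h2
  have := (abs_le.1 h1).2
  simp only [pr_fst, pr_snd] at this
  change u (z.1 + d.fst, z.2 + d.snd) ≤ u z + _ + _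
  change φ (z.1 + d.fst, z.2 + d.snd) - φ z - _ ≤ _ at this
  linarith

theorem isParSupOn1_of_jet1Sup {Hb : Euc n → ℝ → ℝ} {u : Euc n × ℝ → ℝ}
    (h : Jet1Sup Hb (onSpT u)) :
    IsParSupOn1 (fun _x _t val ut q => ut + Hb q val) (Set.univ ×ˢ Set.Ioi (0 : ℝ)) u := by
  intro φ hφ z hz hmax
  obtain ⟨C, hC⟩ := exists_taylor_bound hφ (pr z.1 z.2)
  have hU : (Set.univ ×ˢ Set.Ioi (0 : ℝ) : Set (Euc n × ℝ)) ∈ 𝓝 z :=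
    (isOpen_univ.prod isOpen_Ioi).mem_nhds hz
  have hm : ∀ᶠ y in 𝓝 z, u z - φ z ≤ u y - φ y := by
    have := hmax; rw [IsLocalMinOn, nhdsWithin_eq_nhds.2 hU] at this; exact this
  have ht : Tendsto (fun d : SpT n => (z.1 + d.fst, z.2 + d.snd)) (𝓝 0) (𝓝 z) := by
    have : Continuous fun d : SpT n => (z.1 + d.fst, z.2 + d.snd) :=
      (continuous_const.add continuous_fst').prodMk (continuous_const.add continuous_snd')
    simpa using this.tendsto 0
  refine h (pr z.1 z.2) hz.2 (pr (gradX φ z.1 z.2) (derT φ z.1 z.2)) C ?_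
  filter_upwards [hC, ht.eventually hm] with d h1 h2
  have := (abs_le.1 h1).1
  simp only [pr_fst, pr_snd] at this
  change u z + _ - _ ≤ u (z.1 + d.fst, z.2 + d.snd)
  change _ ≤ φ (z.1 + d.fst, z.2 + d.snd) - φ z - _ at this
  linarith

end Parabolic

section Smooth

set_option linter.unusedSectionVars false

open scoped RealInnerProductSpace

variable {E : Type*} [NormedAddCommGroup E] [InnerProductSpace ℝ E]

/-- The smooth approximation `√(1 + ‖x‖²)` of the norm. -/
def jap (x : E) : ℝ := √(1 + ‖x‖ ^ 2)

theorem jap_sq (x : E) : jap x ^ 2 = 1 + ‖x‖ ^ 2 := Real.sq_sqrt (by positivity)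

theorem one_le_jap (x : E) : 1 ≤ jap x := by
  rw [jap, Real.one_le_sqrt]; linarith [sq_nonneg ‖x‖]

theorem norm_le_jap (x : E) : ‖x‖ ≤ jap x := Real.le_sqrt_of_sq_le (by linarith)

theorem jap_le (x : E) : jap x ≤ 1 + ‖x‖ := by
  rw [jap, Real.sqrt_le_left (by positivity)]
  nlinarith [norm_nonneg x]

theorem continuous_jap : Continuous (jap : E → ℝ) := by unfold jap; fun_prop

theorem sqrt_sq_add_le {J X : ℝ} (hJ : 0 < J) (hX : 0 ≤ J ^ 2 + X) :
    √(J ^ 2 + X) ≤ J + X / (2 * J) := by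
  have h : J + X / (2 * J) = (2 * J ^ 2 + X) / (2 * J) := by field_simp
  have h0 : 0 ≤ J + X / (2 * J) := by
    rw [h]; have := sq_nonneg J; apply div_nonneg <;> linarith
  rw [Real.sqrt_le_left h0]
  have : (J + X / (2 * J)) ^ 2 = J ^ 2 + X + (X / (2 * J)) ^ 2 := by field_simp; ring
  rw [this]
  linarith [sq_nonneg (X / (2 * J))]

theorem norm_add_le_taylor {d : E} (hd : d ≠ 0) (e : E) :
    ‖d + e‖ ≤ ‖d‖ + ⟪‖d‖⁻¹ • d, e⟫ + 1 / (2 * ‖d‖) * ‖e‖ ^ 2 := by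
  have hJ : 0 < ‖d‖ := norm_pos_iff.2 hd
  have h := norm_add_sq_real d e
  have h1 : ‖d + e‖ = √(‖d‖ ^ 2 + (2 * ⟪d, e⟫ + ‖e‖ ^ 2)) := by
    rw [← add_assoc, ← h, Real.sqrt_sq (norm_nonneg _)]
  have h2 := sqrt_sq_add_le (X := 2 * ⟪d, e⟫ + ‖e‖ ^ 2) hJ (by
    rw [← add_assoc, ← h]; positivity)
  rw [h1, real_inner_smul_left]
  refine h2.trans (le_of_eq ?_)
  field_simp
  ring

theorem jap_add_le (d e : E) :
    jap (d + e) ≤ jap d + ⟪(jap d)⁻¹ • d, e⟫ + 1 / 2 * ‖e‖ ^ 2 := by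
  have hJ1 := one_le_jap d
  have hJ : 0 < jap d := by linarith
  have h := norm_add_sq_real d e
  have h1 : jap (d + e) = √(jap d ^ 2 + (2 * ⟪d, e⟫ + ‖e‖ ^ 2)) := by
    rw [jap_sq, jap, h]; ring_nf
  have h2 := sqrt_sq_add_le (X := 2 * ⟪d, e⟫ + ‖e‖ ^ 2) hJ (by
    rw [jap_sq]; have : 0 ≤ ‖d + e‖ ^ 2 := by positivity
    linarith)
  rw [h1, real_inner_smul_left]
  refine h2.trans ?_
  have h3 : (2 * ⟪d, e⟫ + ‖e‖ ^ 2) / (2 * jap d) =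
      (jap d)⁻¹ * ⟪d, e⟫ + (jap d)⁻¹ * (1 / 2 * ‖e‖ ^ 2) := by field_simp
  have h4 : (jap d)⁻¹ * (1 / 2 * ‖e‖ ^ 2) ≤ 1 * (1 / 2 * ‖e‖ ^ 2) := by
    gcongr
    exact inv_le_one_of_one_le₀ hJ1
  linarith

theorem jap_sub_le (x y : E) : jap x - jap y ≤ ‖x - y‖ := by
  have h1 := norm_le_jap y
  have h0 := one_le_jap y
  have h : jap x ≤ jap y + ‖x - y‖ := by
    rw [jap, Real.sqrt_le_left (by positivity), add_sq, jap_sq]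
    have h3 : ‖x‖ ≤ ‖y‖ + ‖x - y‖ := by
      have := norm_add_le y (x - y); rwa [add_sub_cancel] at this
    have h4 : ‖x‖ ^ 2 ≤ (‖y‖ + ‖x - y‖) ^ 2 := by gcongr
    have h5 : ‖y‖ * ‖x - y‖ ≤ jap y * ‖x - y‖ := by gcongr
    linarith
  linarith

theorem norm_inv_jap_smul_le (d : E) : ‖(jap d)⁻¹ • d‖ ≤ 1 := by
  have hJ : 0 < jap d := by linarith [one_le_jap d]
  rw [norm_smul, norm_inv, Real.norm_eq_abs, abs_of_pos hJ, inv_mul_le_iff₀ hJ, mul_one]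
  exact norm_le_jap d

theorem half_le_norm_inv_jap_smul {d : E} (hd : 1 ≤ ‖d‖) : 1 / 2 ≤ ‖(jap d)⁻¹ • d‖ := by
  have hJ : 0 < jap d := by linarith [one_le_jap d]
  rw [norm_smul, norm_inv, Real.norm_eq_abs, abs_of_pos hJ, le_inv_mul_iff₀ hJ]
  linarith [jap_le d]

variable [ProperSpace E]

theorem exists_max_of_growth {ι : Type*} [Finite ι] [Nonempty ι] {X : Type*}
    [NormedAddCommGroup X] [ProperSpace X] {f : ι → X → ℝ} (hf : ∀ i, Continuous (f i))
    {B κ : ℝ} (hκ : 0 < κ) (hB : ∀ i x, f i x ≤ B - κ * ‖x‖) :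
    ∃ i x, ∀ j y, f j y ≤ f i x := by
  have h1 : ∀ i, ∃ x, ∀ y, f i y ≤ f i x := by
    intro i
    refine (hf i).exists_forall_ge' (0 : X) ?_
    have : ∀ᶠ x in cocompact X, (B - f i 0) / κ ≤ ‖x‖ :=
      (tendsto_norm_cocompact_atTop (E := X)).eventually_ge_atTop _
    filter_upwards [this] with x hx
    rw [div_le_iff₀ hκ] at hx
    linarith [hB i x]
  choose x hx using h1
  obtain ⟨i, hi⟩ := Finite.exists_max fun i => f i (x i)
  exact ⟨i, x i, fun j y => (hx j y).trans (hi j)⟩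

end Smooth

section Hamiltonian

set_option linter.unusedSectionVars false

open scoped RealInnerProductSpace

theorem le_of_update_le {m : ℕ} {f : (Fin m → ℝ) → ℝ} {a b : Fin m → ℝ}
    (h : ∀ s i, f (Function.update s i (a i)) ≤ f (Function.update s i (b i))) : f a ≤ f b := by
  classical
  have key : ∀ A : Finset (Fin m), f a ≤ f (A.piecewise b a) := by
    intro A
    induction A using Finset.induction_on with
    | empty => simp
    | insert j A hj ih =>
      rw [Finset.piecewise_insert]
      refine ih.trans ?_
      have h1 := h (A.piecewise b a) j
      have h2 : Function.update (A.piecewise b a) j (a j) = A.piecewise b a := by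
        rw [Function.update_eq_self_iff, Finset.piecewise_eq_of_notMem _ _ _ hj]
      rwa [h2] at h1
  simpa using key Finset.univ

variable {n m : ℕ} (S : Setting n m)

theorem Setting.H_le_of_s_le {k : Fin m} {p : Euc n} {r s s' : Fin m → ℝ} {y : Euc n} {ω : S.Ω}
    (h : ∀ j, s j ≤ s' j) : S.H k p r s y ω ≤ S.H k p r s' y ω :=
  le_of_update_le (f := fun s => S.H k p r s y ω) fun t i => S.H_mono_s k p r t y ω i _ _ (h i)

theorem Setting.H_le_of_r {k : Fin m} {p : Euc n} {r r' s : Fin m → ℝ} {y : Euc n} {ω : S.Ω}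
    (hk : r k ≤ r' k) (h : ∀ j, j ≠ k → r' j ≤ r j) : S.H k p r s y ω ≤ S.H k p r' s y ω :=
  le_of_update_le (f := fun r => S.H k p r s y ω) fun t i => by
    by_cases hi : i = k
    · subst hi; exact S.H_mono_rk i p t s y ω _ _ hk
    · exact S.H_antitone_r k p t s y ω i _ _ hi (h i hi)

theorem posMaxOff_nonneg (k : Fin m) (s : Fin m → ℝ) : 0 ≤ posMaxOff k s := NNReal.coe_nonneg _

theorem le_posMaxOff {k j : Fin m} (h : j ≠ k) (s : Fin m → ℝ) : s j ≤ posMaxOff k s := by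
  have : (s j).toNNReal ≤ (Finset.univ.erase k).sup fun i => (s i).toNNReal :=
    Finset.le_sup (f := fun i => (s i).toNNReal) (Finset.mem_erase.2 ⟨h, Finset.mem_univ j⟩)
  exact (Real.le_coe_toNNReal _).trans (NNReal.coe_le_coe.2 this)

theorem norm_const_le (r : ℝ) : ‖(fun _ : Fin m => r)‖ ≤ |r| := by
  rw [pi_norm_le_iff_of_nonneg (abs_nonneg r)]; intro i; rfl

theorem Setting.exists_H_le (R G M : ℝ) : ∃ C : ℝ, 0 < C ∧ ∀ k p r s y ω, ‖p‖ ≤ M → ‖r‖ ≤ R →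
    (∀ j, s j ≤ G) → S.H k p r s y ω ≤ C := by
  obtain ⟨C, hC, h⟩ := S.H_bounded (|R| + |G| + |M| + 1) (by positivity)
  refine ⟨C, hC, fun k p r s y ω hp hr hs => ?_⟩
  have h1 := S.H_le_of_s_le (k := k) (p := p) (r := r) (y := y) (ω := ω) (s' := fun _ => G) hs
  refine h1.trans ((le_abs_self _).trans (h k p r _ y ω ?_ ?_ ?_))
  · linarith [le_abs_self M, abs_nonneg R, abs_nonneg G]
  · linarith [le_abs_self R, abs_nonneg M, abs_nonneg G]
  · linarith [norm_const_le (m := m) G, abs_nonneg M, abs_nonneg R]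

theorem Setting.exists_le_H (R G M : ℝ) : ∃ C : ℝ, 0 < C ∧ ∀ k p r s y ω, ‖p‖ ≤ M → ‖r‖ ≤ R →
    (∀ j, G ≤ s j) → -C ≤ S.H k p r s y ω := by
  obtain ⟨C, hC, h⟩ := S.H_bounded (|R| + |G| + |M| + 1) (by positivity)
  refine ⟨C, hC, fun k p r s y ω hp hr hs => ?_⟩
  have h1 := S.H_le_of_s_le (k := k) (p := p) (r := r) (y := y) (ω := ω) (s := fun _ => G) hs
  refine le_trans ?_ h1
  refine (abs_le.1 (h k p r _ y ω ?_ ?_ ?_)).1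
  · linarith [le_abs_self M, abs_nonneg R, abs_nonneg G]
  · linarith [le_abs_self R, abs_nonneg M, abs_nonneg G]
  · linarith [norm_const_le (m := m) G, abs_nonneg M, abs_nonneg R]

theorem Setting.exists_sigCol_bound : ∃ A : ℝ, 0 < A ∧ ∀ k ω,
    (∀ y, ∑ i, ‖sigCol S ω k y i‖ ^ 2 ≤ A) ∧
    (∀ x y i, ‖sigCol S ω k x i - sigCol S ω k y i‖ ≤ A * ‖x - y‖) ∧
    (∀ x y, ∑ i, ‖sigCol S ω k x i - sigCol S ω k y i‖ ^ 2 ≤ A * ‖x - y‖ ^ 2) := by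
  obtain ⟨C, hC, h⟩ := S.Sig_lip
  have e1 : ∀ (x : Euc n) (c : ℝ), 0 ≤ c → (∀ a, |x a| ≤ c) → ‖x‖ ^ 2 ≤ n * c ^ 2 := by
    intro x c hc hx
    rw [EuclideanSpace.norm_sq_eq]
    calc ∑ i, ‖x i‖ ^ 2 ≤ ∑ _i : Fin n, c ^ 2 := by
          refine Finset.sum_le_sum fun i _ => ?_
          have := hx i
          rw [Real.norm_eq_abs]
          gcongr
      _ = n * c ^ 2 := by simp
  have e2 : ∀ k ω (x y : Euc n) i, ‖sigCol S ω k x i - sigCol S ω k y i‖ ^ 2 ≤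
      n * (C * ‖x - y‖) ^ 2 := fun k ω x y i =>
    e1 _ _ (by positivity) fun a => (h k ω a i).2 x y
  refine ⟨n * (n * C ^ 2) + (n + 1) * C + 1, by positivity, fun k ω => ⟨fun y => ?_, fun x y i => ?_,
    fun x y => ?_⟩⟩
  · have : ∑ i, ‖sigCol S ω k y i‖ ^ 2 ≤ ∑ _i : Fin n, n * C ^ 2 :=
      Finset.sum_le_sum fun i _ => e1 _ C hC.le fun a => (h k ω a i).1 y
    simp only [Finset.sum_const, Finset.card_univ, Fintype.card_fin, nsmul_eq_mul] at this
    have : 0 ≤ (n + 1) * C := by positivity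
    linarith
  · have h1 := e2 k ω x y i
    have h2 : ‖sigCol S ω k x i - sigCol S ω k y i‖ ≤ (n + 1) * C * ‖x - y‖ := by
      refine le_of_sq_le_sq (h1.trans ?_) (by positivity)
      have : (n : ℝ) ≤ (n + 1) ^ 2 := by nlinarith [Nat.cast_nonneg (α := ℝ) n]
      calc (n : ℝ) * (C * ‖x - y‖) ^ 2 ≤ (n + 1) ^ 2 * (C * ‖x - y‖) ^ 2 := by gcongr
        _ = _ := by ring
    refine h2.trans ?_
    gcongr
    have : (0 : ℝ) ≤ n * (n * C ^ 2) := by positivity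
    linarith
  · have : ∑ i, ‖sigCol S ω k x i - sigCol S ω k y i‖ ^ 2 ≤ ∑ _i : Fin n, n * (C * ‖x - y‖) ^ 2 :=
      Finset.sum_le_sum fun i _ => e2 k ω x y i
    simp only [Finset.sum_const, Finset.card_univ, Fintype.card_fin, nsmul_eq_mul] at this
    have h3 : (0 : ℝ) ≤ ((n + 1) * C + 1) * ‖x - y‖ ^ 2 := by positivity
    nlinarith

theorem continuous_sigCol (ω : S.Ω) (k : Fin m) (i : Fin n) :
    Continuous fun y => sigCol S ω k y i := by
  obtain ⟨A, hA, h⟩ := S.exists_sigCol_bound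
  refine (LipschitzWith.of_dist_le_mul (K := ⟨A, hA.le⟩) fun x y => ?_).continuous
  rw [dist_eq_norm, dist_eq_norm]; exact (h k ω).2.1 x y i

theorem eventually_le_rpow {C γ : ℝ} (hC : 0 < C) (hγ : 1 < γ) (a b R : ℝ) :
    ∀ᶠ K : ℝ in atTop, a + b * K ≤ C * (K / 2 - R) ^ γ := by
  have h1 : Tendsto (fun K : ℝ => K / 2 - R) atTop atTop :=
    tendsto_atTop_add_const_right _ _ (tendsto_id.atTop_div_const (by norm_num))
  have h2 := (tendsto_rpow_atTop (by linarith : 0 < γ - 1)).comp h1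
  filter_upwards [h2.eventually_ge_atTop ((|a + 2 * b * R| + 2 * |b|) / C), h1.eventually_ge_atTop 1]
    with K hK hK1
  have hpos : 0 < K / 2 - R := by linarith
  have e : (K / 2 - R) ^ γ = (K / 2 - R) ^ (γ - 1) * (K / 2 - R) := by
    rw [← Real.rpow_add_one hpos.ne']; ring_nf
  simp only [Function.comp] at hK
  rw [div_le_iff₀ hC] at hK
  rw [e]
  have h3 : (|a + 2 * b * R| + 2 * |b|) * (K / 2 - R) ≤
      (K / 2 - R) ^ (γ - 1) * C * (K / 2 - R) := by gcongr
  have h4 : a + 2 * b * R ≤ |a + 2 * b * R| * (K / 2 - R) := by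
    nlinarith [le_abs_self (a + 2 * b * R), abs_nonneg (a + 2 * b * R)]
  have h5 : 2 * b * (K / 2 - R) ≤ 2 * |b| * (K / 2 - R) := by
    have := le_abs_self b
    gcongr
  linarith

end Hamiltonian

section MacroTools

set_option linter.unusedSectionVars false

open scoped RealInnerProductSpace

theorem le_of_forall_small {x c J : ℝ} (hJ : 0 ≤ J)
    (h : ∀ κ : ℝ, 0 < κ → κ ≤ 1 → x ≤ c + κ * J) : x ≤ c := by
  refine le_of_forall_pos_le_add fun η hη => ?_
  have h1 : 0 < min 1 (η / (J + 1)) := by positivity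
  refine (h _ h1 (min_le_left _ _)).trans ?_
  have : min 1 (η / (J + 1)) * J ≤ η / (J + 1) * (J + 1) := by
    gcongr
    · exact min_le_right _ _
    · linarith
  rw [div_mul_cancel₀ _ (by positivity)] at this
  linarith

theorem sum_diffusion_le {ι E : Type*} [Fintype ι] [NormedAddCommGroup E] [InnerProductSpace ℝ E]
    {s t : ι → E} {A α β : ℝ} (hs : ∑ i, ‖s i‖ ^ 2 ≤ A) (ht : ∑ i, ‖t i‖ ^ 2 ≤ A)
    (hα : 0 ≤ α) (hβ : 0 ≤ β) (a b : ℝ) :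
    ∑ i, (α * ‖a • s i - b • t i‖ ^ 2 + β * (a ^ 2 * ‖s i‖ ^ 2 + b ^ 2 * ‖t i‖ ^ 2)) ≤
      (a ^ 2 + b ^ 2) * ((2 * α + β) * A) := by
  have h1 : ∀ i, α * ‖a • s i - b • t i‖ ^ 2 + β * (a ^ 2 * ‖s i‖ ^ 2 + b ^ 2 * ‖t i‖ ^ 2) ≤
      (2 * α + β) * a ^ 2 * ‖s i‖ ^ 2 + (2 * α + β) * b ^ 2 * ‖t i‖ ^ 2 := by
    intro i
    have h2 : ‖a • s i - b • t i‖ ^ 2 ≤ 2 * (a ^ 2 * ‖s i‖ ^ 2) + 2 * (b ^ 2 * ‖t i‖ ^ 2) := by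
      have h3 := norm_sub_le (a • s i) (b • t i)
      rw [norm_smul, norm_smul, Real.norm_eq_abs, Real.norm_eq_abs] at h3
      have h4 : ‖a • s i - b • t i‖ ^ 2 ≤ (|a| * ‖s i‖ + |b| * ‖t i‖) ^ 2 := by gcongr
      have h5 := sq_nonneg (|a| * ‖s i‖ - |b| * ‖t i‖)
      have h6 : (|a| * ‖s i‖) ^ 2 = a ^ 2 * ‖s i‖ ^ 2 := by rw [mul_pow, sq_abs]
      have h7 : (|b| * ‖t i‖) ^ 2 = b ^ 2 * ‖t i‖ ^ 2 := by rw [mul_pow, sq_abs]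
      nlinarith
    have := mul_le_mul_of_nonneg_left h2 hα
    linarith
  refine (Finset.sum_le_sum fun i _ => h1 i).trans ?_
  rw [Finset.sum_add_distrib, ← Finset.mul_sum, ← Finset.mul_sum]
  have h3 : (2 * α + β) * a ^ 2 * ∑ i, ‖s i‖ ^ 2 ≤ (2 * α + β) * a ^ 2 * A := by gcongr
  have h4 : (2 * α + β) * b ^ 2 * ∑ i, ‖t i‖ ^ 2 ≤ (2 * α + β) * b ^ 2 * A := by gcongr
  linarith

theorem JSup.const_mul {ι E : Type*} [Fintype ι] [NormedAddCommGroup E] [InnerProductSpace ℝ E]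
    {U : Set E} {σ : E → ι → E} {F : E → E → ℝ} {v : E → ℝ} (h : JSup U σ F v) {c : ℝ}
    (hc : 0 < c) : JSup U σ (fun z q => c * F z (c⁻¹ • q)) (fun z => c * v z) := by
  intro z hz q X hX
  have := h z hz (c⁻¹ • q) (c⁻¹ • X) (by
    filter_upwards [hX] with d hd
    simp only [real_inner_smul_left, _root_.smul_apply]
    have h1 : v z + c⁻¹ * ⟪q, d⟫ + 1 / 2 * (c⁻¹ * ⟪X d, d⟫) =
        c⁻¹ * (c * v z + ⟪q, d⟫ + 1 / 2 * ⟪X d, d⟫) := by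
      field_simp
    rw [h1, inv_mul_le_iff₀ hc]
    exact hd)
  simp only [real_inner_smul_left, _root_.smul_apply, ← Finset.mul_sum] at this
  rwa [inv_mul_le_iff₀ hc] at this

variable {n m : ℕ} {S : Setting n m} {p : Euc n} {r δ : ℝ} {ω : S.Ω} {v : Fin m → Euc n → ℝ}

theorem macro_two_point (h : IsMacroSoln S p r δ ω v) {k j : Fin m} {x₀ y₀ : Euc n} {l : ℝ}
    (hl : 0 < l) {P P' : Euc n} {α β : ℝ}
    (hmax : ∀ e f : Euc n, v k (x₀ + e) - l * v j (y₀ + f) ≤ v k x₀ - l * v j y₀ + ⟪P, e⟫ - ⟪P', f⟫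
      + α / 2 * ‖e - f‖ ^ 2 + β / 2 * (‖e‖ ^ 2 + ‖f‖ ^ 2)) (a b : ℝ) :
    a ^ 2 * macroF S p r δ ω v k x₀ P - b ^ 2 * (l * macroF S p r δ ω v j y₀ (l⁻¹ • P')) ≤
      ∑ i, (α * ‖a • sigCol S ω k x₀ i - b • sigCol S ω j y₀ i‖ ^ 2 +
        β * (a ^ 2 * ‖sigCol S ω k x₀ i‖ ^ 2 + b ^ 2 * ‖sigCol S ω j y₀ i‖ ^ 2)) := by
  have hF := continuous_macroF S p r δ ω h.1 j
  refine two_point (h.1 k) (continuous_const.mul (h.1 j)) (macro_jsub h.2.2.2.1 k)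
    ((macro_jsup h.2.2.2.2 j).const_mul hl) (continuous_macroF S p r δ ω h.1 k)
    (continuous_const.mul (hF.comp (continuous_fst.prodMk ((continuous_const_smul l⁻¹).comp
      continuous_snd)))) (continuous_sigCol S ω k) (continuous_sigCol S ω j) univ_mem univ_mem
    (ContinuousLinearMap.id ℝ _) α β (Eventually.of_forall fun d => ?_) a b
  exact hmax d.fst d.snd

theorem macro_value_bound (S : Setting n m) (R : ℝ) : ∃ C : ℝ, 0 < C ∧ ∀ p r δ ω v, ‖p‖ ≤ R → |r| ≤ R →
    0 < δ → δ ≤ 1 → IsMacroSoln S p r δ ω v → ∀ k y, |δ * v k y| ≤ C := by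
  obtain ⟨A, hA, hσ⟩ := S.exists_sigCol_bound
  obtain ⟨C, hC, hH⟩ := S.exists_H_le R 0 (R + 1)
  obtain ⟨C', hC', hH'⟩ := S.exists_le_H R 0 (R + 1)
  refine ⟨A + C + C', by positivity, fun p r δ ω v hp hr hδ hδ1 hv k y => ?_⟩
  obtain ⟨B, hB⟩ := hv.2.1
  have : Nonempty (Fin m) := ⟨k⟩
  have hq : ∀ κ : ℝ, 0 < κ → κ ≤ 1 → ∀ z : Euc n, ‖κ • (jap z)⁻¹ • z‖ ≤ 1 := by
    intro κ h0 h1 z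
    rw [norm_smul, Real.norm_eq_abs, abs_of_pos h0]
    have := norm_inv_jap_smul_le z
    nlinarith [norm_nonneg ((jap z)⁻¹ • z)]
  have hr' := (norm_const_le (m := m) r).trans hr
  rw [abs_le]
  constructor
  · have : -(δ * v k y) ≤ A + C := by
      refine le_of_forall_small (J := jap y) (by linarith [one_le_jap y]) fun κ hκ hκ1 => ?_
      obtain ⟨i, x, hx⟩ := exists_max_of_growth (f := fun i x => -v i x - κ * jap x)
        (fun i => ((hv.1 i).neg).sub (continuous_const.mul continuous_jap)) (B := B) hκ (fun i x => by
          have := (abs_le.1 (hB i x)).1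
          have h2 := norm_le_jap x
          nlinarith)
      have h1 := macro_jsup hv.2.2.2.2 i x (Set.mem_univ _) (-(κ • (jap x)⁻¹ • x))
        (-(κ • ContinuousLinearMap.id ℝ _)) (Eventually.of_forall fun d => by
          have := hx i (x + d)
          have h3 := jap_add_le x d
          have h4 := mul_le_mul_of_nonneg_left h3 hκ.le
          simp only [inner_neg_left, _root_.neg_apply, _root_.smul_apply,
            ContinuousLinearMap.id_apply, real_inner_smul_left, real_inner_self_eq_norm_sq] at h4 ⊢
          linarith)
      simp only [inner_neg_left, _root_.neg_apply, _root_.smul_apply, Finset.sum_neg_distrib,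
        ContinuousLinearMap.id_apply, real_inner_smul_left, real_inner_self_eq_norm_sq,
        ← Finset.mul_sum, macroF] at h1
      have h5 := hH i (p + -(κ • (jap x)⁻¹ • x)) (fun _ => r) (fun j => v i x - v j x) x ω
        ((norm_add_le _ _).trans (by rw [norm_neg]; linarith [hq κ hκ hκ1 x])) hr' (fun j => by
          linarith [hx j x])
      have h6 : κ * ∑ i_1, ‖sigCol S ω i x i_1‖ ^ 2 ≤ 1 * A := by
        gcongr; exact (hσ i ω).1 x
      have h7 := hx k y
      have h8 := one_le_jap x
      have h9 : 0 ≤ κ * jap x := by positivity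
      have h10 : -(δ * v k y) ≤ δ * (-v i x) + κ * jap y := by
        have e1 : -v k y ≤ -v i x + κ * jap y := by linarith
        have e2 := mul_le_mul_of_nonneg_left e1 hδ.le
        have e3 : 0 ≤ κ * jap y := mul_nonneg hκ.le (by linarith [one_le_jap y])
        nlinarith
      linarith
    linarith
  · have : δ * v k y ≤ A + C' := by
      refine le_of_forall_small (J := jap y) (by linarith [one_le_jap y]) fun κ hκ hκ1 => ?_
      obtain ⟨i, x, hx⟩ := exists_max_of_growth (f := fun i x => v i x - κ * jap x)
        (fun i => (hv.1 i).sub (continuous_const.mul continuous_jap)) (B := B) hκ (fun i x => by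
          have := (abs_le.1 (hB i x)).2
          have h2 := norm_le_jap x
          nlinarith)
      have h1 := macro_jsub hv.2.2.2.1 i x (Set.mem_univ _) (κ • (jap x)⁻¹ • x)
        (κ • ContinuousLinearMap.id ℝ _) (Eventually.of_forall fun d => by
          have := hx i (x + d)
          have h3 := jap_add_le x d
          have h4 := mul_le_mul_of_nonneg_left h3 hκ.le
          simp only [_root_.smul_apply,
            ContinuousLinearMap.id_apply, real_inner_smul_left, real_inner_self_eq_norm_sq] at h4 ⊢
          linarith)
      simp only [_root_.smul_apply,
        ContinuousLinearMap.id_apply, real_inner_smul_left, real_inner_self_eq_norm_sq,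
        ← Finset.mul_sum, macroF] at h1
      have h5 := hH' i (p + κ • (jap x)⁻¹ • x) (fun _ => r) (fun j => v i x - v j x) x ω
        ((norm_add_le _ _).trans (by linarith [hq κ hκ hκ1 x])) hr' (fun j => by
          linarith [hx j x])
      have h6 : κ * ∑ i_1, ‖sigCol S ω i x i_1‖ ^ 2 ≤ 1 * A := by
        gcongr; exact (hσ i ω).1 x
      have h7 := hx k y
      have h8 := one_le_jap x
      have h9 : 0 ≤ κ * jap x := by positivity
      have h10 : δ * v k y ≤ δ * v i x + κ * jap y := by
        have e1 : v k y ≤ v i x + κ * jap y := by linarith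
        have e2 := mul_le_mul_of_nonneg_left e1 hδ.le
        have e3 : 0 ≤ κ * jap y := mul_nonneg hκ.le (by linarith [one_le_jap y])
        nlinarith
      linarith
    linarith

end MacroTools

section MacroDoubling

set_option linter.unusedSectionVars false

open scoped RealInnerProductSpace

variable {n m : ℕ}

/-- The coercivity assumption together with the bound on the values of the macroscopic solution. -/
theorem exists_macro_constants (S : Setting n m) {R : ℝ} (hR : 0 < R) :
    ∃ A Cb C₁ C₂ C₃ : ℝ, 0 < A ∧ 0 < Cb ∧ 0 < C₁ ∧ 0 < C₂ ∧ 0 < C₃ ∧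
      (∀ k ω, (∀ y, ∑ i, ‖sigCol S ω k y i‖ ^ 2 ≤ A) ∧
        (∀ x y, ∑ i, ‖sigCol S ω k x i - sigCol S ω k y i‖ ^ 2 ≤ A * ‖x - y‖ ^ 2)) ∧
      (∀ p r δ ω v, ‖p‖ ≤ R → |r| ≤ R → 0 < δ → δ ≤ 1 → IsMacroSoln S p r δ ω v → ∀ k x q,
        C₁ * ‖p + q‖ ^ S.γ k + C₂ * posMaxOff k (fun j => v k x - v j x) - (Cb + C₃) ≤
          macroF S p r δ ω v k x q) ∧
      ∀ G M : ℝ, ∃ C : ℝ, 0 < C ∧ ∀ p r δ ω v, ‖p‖ ≤ R → |r| ≤ R → 0 < δ → δ ≤ 1 →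
        IsMacroSoln S p r δ ω v → ∀ k x q, ‖q‖ ≤ M → (∀ j, v k x - v j x ≤ G) →
          macroF S p r δ ω v k x q ≤ C := by
  obtain ⟨A, hA, hσ⟩ := S.exists_sigCol_bound
  obtain ⟨Cb, hCb, hv⟩ := macro_value_bound S R
  obtain ⟨C₁, C₂, C₃, h₁, h₂, h₃, hc⟩ := S.coercive R hR
  refine ⟨A, Cb, C₁, C₂, C₃, hA, hCb, h₁, h₂, h₃, fun k ω => ⟨(hσ k ω).1, (hσ k ω).2.2⟩,
    fun p r δ ω v hp hr hδ hδ1 h k x q => ?_, fun G M => ?_⟩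
  · have e1 := (abs_le.1 (hv p r δ ω v hp hr hδ hδ1 h k x)).1
    have e2 := hc k (p + q) (fun _ => r) (fun j => v k x - v j x) x ω ((norm_const_le r).trans hr)
    unfold macroF
    linarith
  · obtain ⟨C, hC, hH⟩ := S.exists_H_le R G (R + M)
    refine ⟨Cb + C, by positivity, fun p r δ ω v hp hr hδ hδ1 h k x q hq hs => ?_⟩
    have e1 := (abs_le.1 (hv p r δ ω v hp hr hδ hδ1 h k x)).2
    have e2 := hH k (p + q) (fun _ => r) (fun j => v k x - v j x) x ω
      ((norm_add_le _ _).trans (by linarith)) ((norm_const_le r).trans hr) hs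
    unfold macroF
    linarith

set_option maxHeartbeats 1000000 in
theorem macro_doubling_one (S : Setting n m) {R : ℝ} (hR : 0 < R) : ∃ K g : ℝ, 1 ≤ K ∧ 0 < g ∧
    ∀ p r δ ω v, ‖p‖ ≤ R → |r| ≤ R → 0 < δ → δ ≤ 1 → IsMacroSoln S p r δ ω v → Nonempty (Fin m) →
      ∀ κ : ℝ, 0 < κ → κ ≤ 1 → ∃ k₀ x₀ y₀, ‖x₀ - y₀‖ ≤ 1 ∧ ∀ k j x y,
        v k x - v j y - K * jap (x - y) - g - κ * jap y ≤
          v k₀ x₀ - v k₀ y₀ - K * jap (x₀ - y₀) - κ * jap y₀ := by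
  obtain ⟨A, Cb, C₁, C₂, C₃, hA, hCb, h₁, h₂, h₃, hσ, hlow, hup⟩ := exists_macro_constants S hR
  obtain ⟨K, hKγ, hK1, hKR⟩ : ∃ K : ℝ, (∀ k, 1 + Cb + C₃ + (2 * K + 1) * A ≤
      C₁ * (K / 2 - R) ^ S.γ k) ∧ 1 ≤ K ∧ 2 * R ≤ K := by
    have h : ∀ᶠ K : ℝ in atTop, ∀ k, (1 + Cb + C₃ + A) + (2 * A) * K ≤
        C₁ * (K / 2 - R) ^ S.γ k :=
      eventually_all.2 fun k => eventually_le_rpow h₁ (S.γ_gt_one k) _ _ _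
    obtain ⟨K, hK, h1, h2⟩ := (h.and ((eventually_ge_atTop 1).and (eventually_ge_atTop (2 * R)))).exists
    exact ⟨K, fun k => by linarith [hK k], h1, h2⟩
  obtain ⟨C, hC, hupC⟩ := hup 0 (K + 1)
  obtain ⟨g, hg0, hg⟩ : ∃ g : ℝ, 0 < g ∧ Cb + C₃ + C + 2 * ((2 * K + 1) * A) < C₂ * g := by
    refine ⟨(Cb + C₃ + C + 2 * ((2 * K + 1) * A) + 1) / C₂, by positivity, ?_⟩
    rw [mul_div_cancel₀ _ h₂.ne']; linarith
  obtain ⟨C', hC', hupC'⟩ := hup g (K + 1)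
  refine ⟨K, g, hK1, hg0, fun p r δ ω v hp hr hδ hδ1 hv hne κ hκ hκ1 => ?_⟩
  obtain ⟨B, hB⟩ := hv.2.1
  let gg : Fin m → Fin m → ℝ := fun k j => if k = j then 0 else g
  have ggs : ∀ k, gg k k = 0 := fun k => if_pos rfl
  have ggn : ∀ k j, k ≠ j → gg k j = g := fun k j h => if_neg h
  have ggle : ∀ k j, gg k j ≤ g := fun k j => by
    by_cases h : k = j
    · subst h; rw [ggs]; exact hg0.le
    · rw [ggn _ _ h]
  obtain ⟨⟨k, j⟩, ⟨x, y⟩, hx⟩ := exists_max_of_growth (ι := Fin m × Fin m) (X := Euc n × Euc n)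
    (f := fun i z => v i.1 z.1 - v i.2 z.2 - K * jap (z.1 - z.2) - gg i.1 i.2 - κ * jap z.2)
    (fun i => by
      have c1 := (hv.1 i.1).comp (continuous_fst (X := Euc n) (Y := Euc n))
      have c2 := (hv.1 i.2).comp (continuous_snd (X := Euc n) (Y := Euc n))
      have c3 : Continuous fun z : Euc n × Euc n => jap (z.1 - z.2) :=
        continuous_jap.comp (continuous_fst.sub continuous_snd)
      have c4 : Continuous fun z : Euc n × Euc n => jap z.2 := continuous_jap.comp continuous_snd
      exact (((c1.sub c2).sub (continuous_const.mul c3)).sub continuous_const).sub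
        (continuous_const.mul c4))
    (B := 2 * B) hκ (fun i z => by
      have e1 := (abs_le.1 (hB i.1 z.1)).2
      have e2 := (abs_le.1 (hB i.2 z.2)).1
      have e3 := norm_le_jap (z.1 - z.2)
      have e4 := norm_le_jap z.2
      have e5 : 0 ≤ gg i.1 i.2 := by
        by_cases h : i.1 = i.2
        · rw [h, ggs]
        · rw [ggn _ _ h]; exact hg0.le
      have e6 : ‖z‖ ≤ ‖z.1 - z.2‖ + ‖z.2‖ := by
        rw [Prod.norm_def, max_le_iff]
        refine ⟨?_, by linarith [norm_nonneg (z.1 - z.2)]⟩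
        have := norm_add_le (z.1 - z.2) z.2
        rwa [sub_add_cancel] at this
      have e7 := mul_le_mul_of_nonneg_left e6 hκ.le
      have e8 : κ * ‖z.1 - z.2‖ ≤ K * jap (z.1 - z.2) := by gcongr; exact hκ1.trans hK1
      have e9 := mul_le_mul_of_nonneg_left e4 hκ.le
      linarith)
  have hx' : ∀ k' j' x' y', v k' x' - v j' y' - K * jap (x' - y') - gg k' j' - κ * jap y' ≤
      v k x - v j y - K * jap (x - y) - gg k j - κ * jap y := fun k' j' x' y' => hx (k', j') (x', y')
  set P := K • (jap (x - y))⁻¹ • (x - y) with hP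
  set Q := κ • (jap y)⁻¹ • y with hQ
  have hQn : ‖Q‖ ≤ 1 := by
    rw [hQ, norm_smul, Real.norm_eq_abs, abs_of_pos hκ]
    have := norm_inv_jap_smul_le y
    calc κ * ‖(jap y)⁻¹ • y‖ ≤ 1 * 1 := by gcongr
      _ = 1 := one_mul 1
  have hPn : ‖P‖ ≤ K := by
    rw [hP, norm_smul, Real.norm_eq_abs, abs_of_pos (by linarith)]
    have := norm_inv_jap_smul_le (x - y)
    calc K * ‖(jap (x - y))⁻¹ • (x - y)‖ ≤ K * 1 := by gcongr
      _ = K := mul_one K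
  have hPQ : ‖P - Q‖ ≤ K + 1 := (norm_sub_le _ _).trans (by linarith)
  have key : ∀ a b : ℝ, a ^ 2 * macroF S p r δ ω v k x P - b ^ 2 * macroF S p r δ ω v j y (P - Q) ≤
      (a ^ 2 + b ^ 2) * ((2 * K + 1) * A) := by
    intro a b
    have := macro_two_point hv (k := k) (j := j) (x₀ := x) (y₀ := y) (l := 1) one_pos (P := P)
      (P' := P - Q) (α := K) (β := 1) (fun e f => by
        have h1 := hx' k j (x + e) (y + f)
        have h2 := mul_le_mul_of_nonneg_left (jap_add_le (x - y) (e - f)) (by linarith : 0 ≤ K)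
        have h3 := mul_le_mul_of_nonneg_left (jap_add_le y f) hκ.le
        rw [show x + e - (y + f) = x - y + (e - f) by abel] at h1
        have h4 : ⟪P, e⟫ - ⟪P - Q, f⟫ = K * ⟪(jap (x - y))⁻¹ • (x - y), e - f⟫ +
            κ * ⟪(jap y)⁻¹ • y, f⟫ := by
          rw [hP, hQ]
          simp only [inner_sub_left, inner_sub_right, real_inner_smul_left]
          ring
        have h5 : κ * ‖f‖ ^ 2 ≤ 1 * ‖f‖ ^ 2 := by gcongr
        have h6 : 0 ≤ ‖e‖ ^ 2 := by positivity
        linarith) a b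
    rw [one_mul, inv_one, one_smul] at this
    exact this.trans (sum_diffusion_le ((hσ k ω).1 x) ((hσ j ω).1 y) (by linarith) zero_le_one a b)
  have hs : ∀ i, v j y - v i y ≤ gg k i - gg k j := fun i => by linarith [hx' k i x y]
  have hkj : k = j := by
    by_contra hne'
    have g1 := ggn _ _ hne'
    have s1 : g ≤ v k x - v j x := by
      have := hx' j j x y
      rw [ggs, g1] at this
      linarith
    have l1 := hlow p r δ ω v hp hr hδ hδ1 hv k x P
    have l2 := hupC p r δ ω v hp hr hδ hδ1 hv j y (P - Q) hPQ (fun i => by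
      linarith [hs i, ggle k i])
    have l3 := le_posMaxOff (Ne.symm hne') (fun j => v k x - v j x)
    have l4 : C₂ * g ≤ C₂ * posMaxOff k (fun j => v k x - v j x) := by
      gcongr; exact s1.trans l3
    have l5 : 0 ≤ C₁ * ‖p + P‖ ^ S.γ k := by positivity
    have := key 1 1
    linarith
  subst hkj
  refine ⟨k, x, y, ?_, fun k' j' x' y' => ?_⟩
  · by_contra hxy
    push Not at hxy
    have hPl : K / 2 ≤ ‖P‖ := by
      rw [hP, norm_smul, Real.norm_eq_abs, abs_of_pos (by linarith)]
      have := half_le_norm_inv_jap_smul hxy.le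
      have := mul_le_mul_of_nonneg_left this (by linarith : 0 ≤ K)
      linarith
    have hpP : K / 2 - R ≤ ‖p + P‖ := by
      have := norm_sub_le (p + P) p
      rw [add_sub_cancel_left] at this
      linarith
    have l1 := hlow p r δ ω v hp hr hδ hδ1 hv k x P
    have l2 := hupC' p r δ ω v hp hr hδ hδ1 hv k y (P - Q) hPQ (fun i => by
      linarith [hs i, ggle k i, ggs k])
    have l3 : 0 ≤ C₂ * posMaxOff k (fun j => v k x - v j x) :=
      mul_nonneg h₂.le (posMaxOff_nonneg _ _)
    have l4 : C₁ * (K / 2 - R) ^ S.γ k ≤ C₁ * ‖p + P‖ ^ S.γ k := by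
      gcongr
      · linarith
      · linarith [S.γ_gt_one k]
    have l5 := hKγ k
    have l6 : (2 * K + 1) * A + 1 ≤ macroF S p r δ ω v k x P := by linarith
    have l7 := key (√(C' + (2 * K + 1) * A + 1)) 1
    rw [Real.sq_sqrt (by positivity)] at l7
    have l8 := mul_le_mul_of_nonneg_left l6 (by positivity : 0 ≤ C' + (2 * K + 1) * A + 1)
    linarith
  · have := hx' k' j' x' y'
    rw [ggs] at this
    linarith [ggle k' j']

end MacroDoubling

section MacroOscillation

set_option linter.unusedSectionVars false

open scoped RealInnerProductSpace

variable {n m : ℕ}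

theorem sum_diffusion_near {ι E : Type*} [Fintype ι] [NormedAddCommGroup E]
    [InnerProductSpace ℝ E] {s t : ι → E} {A K d : ℝ} (hs : ∑ i, ‖s i‖ ^ 2 ≤ A)
    (ht : ∑ i, ‖t i‖ ^ 2 ≤ A) (hst : ∑ i, ‖s i - t i‖ ^ 2 ≤ A * d ^ 2) (hK : 0 ≤ K) (hd : 0 < d) :
    K / d * ∑ i, ‖s i - t i‖ ^ 2 ≤ 4 * A * K := by
  have hA : 0 ≤ A := le_trans (Finset.sum_nonneg fun i _ => by positivity) hs
  rcases le_total d 1 with hle | hle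
  · calc K / d * ∑ i, ‖s i - t i‖ ^ 2 ≤ K / d * (A * d ^ 2) := by gcongr
      _ = A * K * d := by field_simp
      _ ≤ A * K * 1 := by gcongr
      _ ≤ 4 * A * K := by
        have : 0 ≤ A * K := by positivity
        linarith
  · have h5 := sum_diffusion_le (α := 1) (β := 0) hs ht zero_le_one le_rfl 1 1
    simp only [one_smul, one_mul, zero_mul, add_zero] at h5
    have h6 : K / d ≤ K := div_le_self hK hle
    calc K / d * ∑ i, ‖s i - t i‖ ^ 2 ≤ K * (4 * A) := by
          gcongr; linarith
      _ = 4 * A * K := by ring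

set_option maxHeartbeats 2000000 in
theorem macro_doubling_two (S : Setting n m) {R : ℝ} (hR : 0 < R) {K₁ g : ℝ} (hK₁ : 1 ≤ K₁)
    (hg : 0 < g) : ∃ C : ℝ, 0 < C ∧
    ∀ p r δ ω v, ‖p‖ ≤ R → |r| ≤ R → 0 < δ → δ ≤ 1 → IsMacroSoln S p r δ ω v →
      ∀ k₀ x₀ y₀, ‖x₀ - y₀‖ ≤ 1 → (∀ i z, v k₀ y₀ - g - K₁ * ‖z - y₀‖ ≤ v i z) →
        v k₀ x₀ - v k₀ y₀ ≤ C := by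
  obtain ⟨A, Cb, C₁, C₂, C₃, hA, hCb, h₁, h₂, h₃, hσ, hlow, hup⟩ := exists_macro_constants S hR
  obtain ⟨C, hC, hupC⟩ := hup 0 (K₁ + 2)
  obtain ⟨G, hG0, hG⟩ : ∃ G : ℝ, 0 < G ∧ Cb + C₃ + C + 2 * ((K₁ + 3) * A) < C₂ * G := by
    refine ⟨(Cb + C₃ + C + 2 * ((K₁ + 3) * A) + 1) / C₂, by positivity, ?_⟩
    rw [mul_div_cancel₀ _ h₂.ne']; linarith
  obtain ⟨C', hC', hupC'⟩ := hup (G + 1) (K₁ + 2)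
  obtain ⟨K, hKγ, hK1, hKR⟩ : ∃ K : ℝ, (∀ k, 1 + Cb + C₃ + (C' + 4 * A + 2 * A * (K₁ + 1)) * K ≤
      C₁ * (K / 2 - R) ^ S.γ k) ∧ 1 ≤ K ∧ 2 * R ≤ K := by
    have h : ∀ᶠ K : ℝ in atTop, ∀ k, (1 + Cb + C₃) + (C' + 4 * A + 2 * A * (K₁ + 1)) * K ≤
        C₁ * (K / 2 - R) ^ S.γ k :=
      eventually_all.2 fun k => eventually_le_rpow h₁ (S.γ_gt_one k) _ _ _
    obtain ⟨K, hK, h1, h2⟩ := (h.and ((eventually_ge_atTop 1).and (eventually_ge_atTop (2 * R)))).exists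
    exact ⟨K, hK, h1, h2⟩
  have hK0 : 0 < K := by linarith
  refine ⟨(K - 1) * g + K + 2 * ((K - 1) * K₁ + 1), by
    have : 0 ≤ (K - 1) * g := mul_nonneg (by linarith) hg.le
    have : 0 ≤ (K - 1) * K₁ := mul_nonneg (by linarith) (by linarith)
    linarith, fun p r δ ω v hp hr hδ hδ1 hv k₀ x₀ y₀ hxy₀ hcone => ?_⟩
  obtain ⟨B, hB⟩ := hv.2.1
  obtain ⟨M, hM⟩ : ∃ M, M = (K - 1) * K₁ + 1 := ⟨_, rfl⟩
  rw [← hM]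
  have hM1 : 1 ≤ M := by
    rw [hM]
    have : 0 ≤ (K - 1) * K₁ := mul_nonneg (by linarith) (by linarith)
    linarith
  have hMK : M ≤ (K₁ + 1) * K := by rw [hM]; nlinarith
  let φ : Fin m → Fin m → Euc n → ℝ := fun k j d => if k = j then K * ‖d‖ else G * K + K * jap d
  have φs : ∀ k d, φ k k d = K * ‖d‖ := fun k d => if_pos rfl
  have φn : ∀ k j d, k ≠ j → φ k j d = G * K + K * jap d := fun k j d h => if_neg h
  have φlow : ∀ k j d, K * ‖d‖ ≤ φ k j d := fun k j d => by
    by_cases h : k = j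
    · subst h; rw [φs]
    · rw [φn _ _ _ h]
      have : K * ‖d‖ ≤ K * jap d := by gcongr; exact norm_le_jap d
      have : 0 < G * K := by positivity
      linarith
  have φup : ∀ k j d, φ k j d ≤ G * K + K * jap d := fun k j d => by
    by_cases h : k = j
    · subst h; rw [φs]
      have : K * ‖d‖ ≤ K * jap d := by gcongr; exact norm_le_jap d
      have : 0 < G * K := by positivity
      linarith
    · rw [φn _ _ _ h]
  have φc : ∀ k j, Continuous (φ k j) := fun k j => by
    by_cases h : k = j
    · subst h
      have : φ k k = fun d => K * ‖d‖ := funext (φs k)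
      rw [this]; fun_prop
    · have : φ k j = fun d => G * K + K * jap d := funext fun d => φn k j d h
      rw [this]
      exact continuous_const.add (continuous_const.mul continuous_jap)
  clear_value φ
  have : Nonempty (Fin m) := ⟨k₀⟩
  obtain ⟨⟨k, j⟩, ⟨x, y⟩, hx⟩ := exists_max_of_growth (ι := Fin m × Fin m) (X := Euc n × Euc n)
    (f := fun i z => v i.1 z.1 - K * v i.2 z.2 - φ i.1 i.2 (z.1 - z.2) - M * jap (z.2 - y₀))
    (fun i => by
      have c1 := (hv.1 i.1).comp (continuous_fst (X := Euc n) (Y := Euc n))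
      have c2 := (hv.1 i.2).comp (continuous_snd (X := Euc n) (Y := Euc n))
      have c3 : Continuous fun z : Euc n × Euc n => φ i.1 i.2 (z.1 - z.2) :=
        (φc i.1 i.2).comp (continuous_fst.sub continuous_snd)
      have c4 : Continuous fun z : Euc n × Euc n => jap (z.2 - y₀) :=
        continuous_jap.comp (continuous_snd.sub continuous_const)
      exact ((c1.sub (continuous_const.mul c2)).sub c3).sub (continuous_const.mul c4))
    (B := B + K * B + ‖y₀‖) (κ := 1) one_pos (fun i z => by
      have e1 := (abs_le.1 (hB i.1 z.1)).2
      have e2 := mul_le_mul_of_nonneg_left (abs_le.1 (hB i.2 z.2)).1 hK0.le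
      have e3 := φlow i.1 i.2 (z.1 - z.2)
      have e4 := norm_le_jap (z.2 - y₀)
      have e6 : ‖z‖ ≤ ‖z.1 - z.2‖ + ‖z.2‖ := by
        rw [Prod.norm_def, max_le_iff]
        refine ⟨?_, by linarith [norm_nonneg (z.1 - z.2)]⟩
        have := norm_add_le (z.1 - z.2) z.2
        rwa [sub_add_cancel] at this
      have e7 : ‖z.2‖ ≤ ‖z.2 - y₀‖ + ‖y₀‖ := by
        have := norm_add_le (z.2 - y₀) y₀
        rwa [sub_add_cancel] at this
      have e8 : 1 * ‖z.1 - z.2‖ ≤ K * ‖z.1 - z.2‖ := by gcongr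
      have e9 : 1 * ‖z.2 - y₀‖ ≤ M * jap (z.2 - y₀) := by gcongr
      linarith)
  have hx' : ∀ k' j' x' y', v k' x' - K * v j' y' - φ k' j' (x' - y') - M * jap (y' - y₀) ≤
      v k x - K * v j y - φ k j (x - y) - M * jap (y - y₀) := fun k' j' x' y' => hx (k', j') (x', y')
  obtain ⟨Q, hQ⟩ : ∃ Q, Q = M • (jap (y - y₀))⁻¹ • (y - y₀) := ⟨_, rfl⟩
  have hQn : ‖Q‖ ≤ M := by
    rw [hQ, norm_smul, Real.norm_eq_abs, abs_of_pos (by linarith)]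
    have := norm_inv_jap_smul_le (y - y₀)
    calc M * ‖(jap (y - y₀))⁻¹ • (y - y₀)‖ ≤ M * 1 := by gcongr
      _ = M := mul_one M
  have hPQ : ∀ P : Euc n, ‖P‖ ≤ K → ‖K⁻¹ • (P - Q)‖ ≤ K₁ + 2 := by
    intro P hP
    rw [norm_smul, norm_inv, Real.norm_eq_abs, abs_of_pos hK0, inv_mul_le_iff₀ hK0]
    have := norm_sub_le P Q
    linarith
  have hs : ∀ i, K * (v j y - v i y) ≤ φ k i (x - y) - φ k j (x - y) := fun i => by
    linarith [hx' k i x y]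
  have hkj : k = j := by
    by_contra hne'
    have g1 := φn _ _ (x - y) hne'
    obtain ⟨P, hP⟩ : ∃ P, P = K • (jap (x - y))⁻¹ • (x - y) := ⟨_, rfl⟩
    have hPn : ‖P‖ ≤ K := by
      rw [hP, norm_smul, Real.norm_eq_abs, abs_of_pos (by linarith)]
      have := norm_inv_jap_smul_le (x - y)
      calc K * ‖(jap (x - y))⁻¹ • (x - y)‖ ≤ K * 1 := by gcongr
        _ = K := mul_one K
    have key := macro_two_point hv (k := k) (j := j) (x₀ := x) (y₀ := y) (l := K) hK0 (P := P)
      (P' := P - Q) (α := K) (β := M) (fun e f => by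
        have h1 := hx' k j (x + e) (y + f)
        have h2 := mul_le_mul_of_nonneg_left (jap_add_le (x - y) (e - f)) hK0.le
        have h3 := mul_le_mul_of_nonneg_left (jap_add_le (y - y₀) f) (by linarith : 0 ≤ M)
        rw [show x + e - (y + f) = x - y + (e - f) by abel, φn _ _ _ hne', φn _ _ _ hne',
          show y + f - y₀ = y - y₀ + f by abel] at h1
        have h4 : ⟪P, e⟫ - ⟪P - Q, f⟫ = K * ⟪(jap (x - y))⁻¹ • (x - y), e - f⟫ +
            M * ⟪(jap (y - y₀))⁻¹ • (y - y₀), f⟫ := by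
          rw [hP, hQ]
          simp only [inner_sub_left, inner_sub_right, real_inner_smul_left]
          ring
        have h6 : 0 ≤ M * ‖e‖ ^ 2 := by positivity
        linarith only [h1, h2, h3, h4, h6]) 1 1
    have l0 := key.trans (sum_diffusion_le ((hσ k ω).1 x) ((hσ j ω).1 y) hK0.le (by linarith) 1 1)
    have s1 : G * K ≤ v k x - v j x := by
      have := hx' j j x y
      rw [φs, g1] at this
      have : K * ‖x - y‖ ≤ K * jap (x - y) := by gcongr; exact norm_le_jap _
      linarith
    have l1 := hlow p r δ ω v hp hr hδ hδ1 hv k x P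
    have l2 := hupC p r δ ω v hp hr hδ hδ1 hv j y (K⁻¹ • (P - Q)) (hPQ P hPn) (fun i => by
      have e1 := hs i
      have e2 := φup k i (x - y)
      by_contra hcon
      push Not at hcon
      have := mul_pos hK0 hcon
      linarith)
    have l3 := le_posMaxOff (Ne.symm hne') (fun j => v k x - v j x)
    have l4 : C₂ * (G * K) ≤ C₂ * posMaxOff k (fun j => v k x - v j x) := by
      gcongr; exact s1.trans l3
    have l5 : 0 ≤ C₁ * ‖p + P‖ ^ S.γ k := by positivity
    have l6 := mul_le_mul_of_nonneg_left l2 hK0.le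
    have l7 : (2 * K + M) * A ≤ ((K₁ + 3) * K) * A := by gcongr; linarith
    have l8 := mul_lt_mul_of_pos_right hG hK0
    have l9 : Cb + C₃ ≤ (Cb + C₃) * K := le_mul_of_one_le_right (by positivity) hK1
    linarith
  subst hkj
  have hxy : x = y := by
    by_contra hne'
    have hd : x - y ≠ 0 := sub_ne_zero.2 hne'
    have hd0 : 0 < ‖x - y‖ := norm_pos_iff.2 hd
    obtain ⟨P, hP⟩ : ∃ P, P = K • (‖x - y‖)⁻¹ • (x - y) := ⟨_, rfl⟩
    have hPn : ‖P‖ = K := by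
      rw [hP, norm_smul, norm_smul, Real.norm_eq_abs, abs_of_pos hK0, norm_inv, norm_norm,
        inv_mul_cancel₀ hd0.ne', mul_one]
    have key := macro_two_point hv (k := k) (j := k) (x₀ := x) (y₀ := y) (l := K) hK0 (P := P)
      (P' := P - Q) (α := K / ‖x - y‖) (β := M) (fun e f => by
        have h1 := hx' k k (x + e) (y + f)
        have h2 := mul_le_mul_of_nonneg_left (norm_add_le_taylor hd (e - f)) hK0.le
        have h3 := mul_le_mul_of_nonneg_left (jap_add_le (y - y₀) f) (by linarith : 0 ≤ M)
        rw [show x + e - (y + f) = x - y + (e - f) by abel, φs, φs,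
          show y + f - y₀ = y - y₀ + f by abel] at h1
        have h4 : ⟪P, e⟫ - ⟪P - Q, f⟫ = K * ⟪(‖x - y‖)⁻¹ • (x - y), e - f⟫ +
            M * ⟪(jap (y - y₀))⁻¹ • (y - y₀), f⟫ := by
          rw [hP, hQ]
          simp only [inner_sub_left, inner_sub_right, real_inner_smul_left]
          ring
        have h5 : K * (1 / (2 * ‖x - y‖) * ‖e - f‖ ^ 2) = K / ‖x - y‖ / 2 * ‖e - f‖ ^ 2 := by
          field_simp
        have h6 : 0 ≤ M * ‖e‖ ^ 2 := by positivity
        linarith only [h1, h2, h3, h4, h5, h6]) 1 1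
    simp only [one_pow, one_mul, one_smul] at key
    rw [Finset.sum_add_distrib, ← Finset.mul_sum, ← Finset.mul_sum, Finset.sum_add_distrib] at key
    have d1 := sum_diffusion_near ((hσ k ω).1 x) ((hσ k ω).1 y) ((hσ k ω).2 x y) hK0.le hd0
    have d2 : M * (∑ i, ‖sigCol S ω k x i‖ ^ 2 + ∑ i, ‖sigCol S ω k y i‖ ^ 2) ≤
        ((K₁ + 1) * K) * (A + A) := by
      have n1 : 0 ≤ ∑ i, ‖sigCol S ω k x i‖ ^ 2 := Finset.sum_nonneg fun _ _ => sq_nonneg _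
      have n2 : 0 ≤ ∑ i, ‖sigCol S ω k y i‖ ^ 2 := Finset.sum_nonneg fun _ _ => sq_nonneg _
      exact mul_le_mul hMK (add_le_add ((hσ k ω).1 x) ((hσ k ω).1 y)) (add_nonneg n1 n2)
        (mul_nonneg (by linarith) hK0.le)
    have hpP : K / 2 - R ≤ ‖p + P‖ := by
      have := norm_sub_le (p + P) p
      rw [add_sub_cancel_left] at this
      linarith
    have l1 := hlow p r δ ω v hp hr hδ hδ1 hv k x P
    have l2 := hupC' p r δ ω v hp hr hδ hδ1 hv k y (K⁻¹ • (P - Q)) (hPQ P hPn.le) (fun i => by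
      have e1 := hs i
      have e2 := φup k i (x - y)
      rw [φs] at e1
      have e3 : K * jap (x - y) ≤ K * (1 + ‖x - y‖) := by gcongr; exact jap_le _
      by_contra hcon
      push Not at hcon
      have := mul_lt_mul_of_pos_left hcon hK0
      linarith)
    have l3 : 0 ≤ C₂ * posMaxOff k (fun j => v k x - v j x) :=
      mul_nonneg h₂.le (posMaxOff_nonneg _ _)
    have l4 : C₁ * (K / 2 - R) ^ S.γ k ≤ C₁ * ‖p + P‖ ^ S.γ k :=
      mul_le_mul_of_nonneg_left (Real.rpow_le_rpow (by linarith) hpP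
        (by linarith [S.γ_gt_one k])) h₁.le
    have l5 := hKγ k
    have l6 := mul_le_mul_of_nonneg_left l2 hK0.le
    linarith
  subst hxy
  have f1 := hx' k₀ k₀ x₀ y₀
  rw [φs, φs] at f1
  simp only [sub_self, norm_zero, mul_zero, sub_zero] at f1
  have f2 := mul_le_mul_of_nonneg_left (hcone k x) (by linarith : 0 ≤ K - 1)
  have f3 : M * ‖x - y₀‖ ≤ M * jap (x - y₀) := by gcongr; exact norm_le_jap _
  have f4 : K * ‖x₀ - y₀‖ ≤ K * 1 := by gcongr
  have f5 : jap (0 : Euc n) ≤ 2 := (jap_le 0).trans (by rw [norm_zero]; norm_num)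
  have f6 : M * jap (0 : Euc n) ≤ M * 2 := by gcongr
  have f7 : (K - 1) * (K₁ * ‖x - y₀‖) ≤ M * ‖x - y₀‖ := by
    rw [hM]; linarith [norm_nonneg (x - y₀)]
  linarith

/-- The components of the macroscopic solution stay within bounded distance of each other,
uniformly in `δ`. -/
theorem exists_macro_osc_bound (S : Setting n m) {R : ℝ} (hR : 0 < R) : ∃ C : ℝ, 0 < C ∧
    ∀ p r δ ω v, ‖p‖ ≤ R → |r| ≤ R → 0 < δ → δ ≤ 1 → IsMacroSoln S p r δ ω v →
      ∀ k j x, |v k x - v j x| ≤ C := by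
  obtain ⟨K, g, hK1, hg, h1⟩ := macro_doubling_one S hR
  obtain ⟨C, hC, h2⟩ := macro_doubling_two S hR (K₁ := K + 1) (by linarith) hg
  refine ⟨g + 2 * K + C, by linarith, fun p r δ ω v hp hr hδ hδ1 hv => ?_⟩
  have hmain : ∀ k j x, v k x - v j x ≤ g + 2 * K + C := by
    intro k j x
    refine le_of_forall_small (J := jap x) (by linarith [one_le_jap x]) fun κ hκ hκ1 => ?_
    obtain ⟨k₀, x₀, y₀, hxy, hmax⟩ := h1 p r δ ω v hp hr hδ hδ1 hv ⟨k⟩ κ hκ hκ1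
    have h3 := h2 p r δ ω v hp hr hδ hδ1 hv k₀ x₀ y₀ hxy fun i z => by
      have e1 := hmax k₀ i x₀ z
      have e2 := jap_sub_le (x₀ - z) (x₀ - y₀)
      rw [sub_sub_sub_cancel_left, norm_sub_rev] at e2
      have e3 := mul_le_mul_of_nonneg_left e2 (by linarith : 0 ≤ K)
      have e4 := mul_le_mul_of_nonneg_left (jap_sub_le z y₀) hκ.le
      have e5 : κ * ‖z - y₀‖ ≤ 1 * ‖z - y₀‖ := by gcongr
      linarith
    have e1 := hmax k j x x
    rw [sub_self] at e1
    have f5 : jap (0 : Euc n) ≤ 2 := (jap_le 0).trans (by rw [norm_zero]; norm_num)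
    have f6 : K * jap (0 : Euc n) ≤ K * 2 := by gcongr
    have f7 : 0 ≤ κ * jap y₀ := mul_nonneg hκ.le (by linarith [one_le_jap y₀])
    have f8 : 0 ≤ K * jap (x₀ - y₀) := mul_nonneg (by linarith) (by linarith [one_le_jap (x₀ - y₀)])
    linarith
  intro k j x
  rw [abs_le]
  constructor <;> linarith [hmain k j x, hmain j k x]

end MacroOscillation

section Perturbation

set_option linter.unusedSectionVars false

open scoped RealInnerProductSpace

section General

variable {ι E : Type*} [Fintype ι] [NormedAddCommGroup E] [InnerProductSpace ℝ E]

/-- Subtracting a test function whose Hessian is bounded above by `c`. -/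
theorem JSub.sub_test {U : Set E} {σ : E → ι → E} {F : E → E → ℝ} {w φ : E → ℝ} {g : E → E} {c : ℝ}
    (h : JSub U σ F w) (hφ : ∀ z d, φ (z + d) ≤ φ z + ⟪g z, d⟫ + c / 2 * ‖d‖ ^ 2) :
    JSub U σ (fun z q => F z (q + g z) - c * ∑ i, ‖σ z i‖ ^ 2) (fun z => w z - φ z) := by
  intro z hz q X hX
  have h1 := h z hz (q + g z) (X + c • ContinuousLinearMap.id ℝ E) (by
    filter_upwards [hX] with d hd
    have h2 := hφ z d
    simp only [inner_add_left, _root_.add_apply, _root_.smul_apply, real_inner_smul_left,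
      ContinuousLinearMap.id_apply, real_inner_self_eq_norm_sq]
    linarith)
  simp only [inner_add_left, _root_.add_apply, _root_.smul_apply, real_inner_smul_left,
    ContinuousLinearMap.id_apply, real_inner_self_eq_norm_sq, Finset.sum_add_distrib,
    ← Finset.mul_sum] at h1
  linarith

/-- Rescaling of a supersolution. -/
theorem JSup.rescale {σ : E → ι → E} {F : E → E → ℝ} {v : E → ℝ} (h : JSup Set.univ σ F v)
    {ε μ : ℝ} (hε : 0 < ε) (hμ : 0 < μ) :
    JSup Set.univ (fun x i => √ε • σ (ε⁻¹ • x) i) (fun x q => μ * F (ε⁻¹ • x) (μ⁻¹ • q))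
      (fun x => ε * μ * v (ε⁻¹ • x)) := by
  intro x _ q X hX
  have h1 := h (ε⁻¹ • x) (Set.mem_univ _) (μ⁻¹ • q) ((ε / μ) • X) (by
    have hT : Tendsto (fun d : E => ε • d) (𝓝 0) (𝓝 0) :=
      (continuous_const_smul ε).tendsto' 0 0 (smul_zero _)
    filter_upwards [hT.eventually hX] with d hd
    rw [smul_add, inv_smul_smul₀ hε.ne'] at hd
    simp only [real_inner_smul_left, real_inner_smul_right, _root_.smul_apply, map_smul] at hd ⊢
    have h2 : 0 < ε * μ := mul_pos hε hμ
    refine le_of_mul_le_mul_left ?_ h2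
    have h3 : ε * μ * (v (ε⁻¹ • x) + μ⁻¹ * ⟪q, d⟫ + 1 / 2 * (ε / μ * ⟪X d, d⟫)) =
        ε * μ * v (ε⁻¹ • x) + ε * ⟪q, d⟫ + 1 / 2 * (ε * (ε * ⟪X d, d⟫)) := by
      field_simp
    rw [h3]
    exact hd)
  have h4 := mul_le_mul_of_nonneg_left h1 hμ.le
  refine le_trans (le_of_eq ?_) h4
  rw [Finset.mul_sum]
  refine Finset.sum_congr rfl fun i _ => ?_
  simp only [map_smul, real_inner_smul_left, real_inner_smul_right, _root_.smul_apply]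
  rw [← mul_assoc, Real.mul_self_sqrt hε.le]
  field_simp

end General

variable {n m : ℕ}

theorem Setting.exists_lipschitz_rs (S : Setting n m) (R : ℝ) : ∃ C : ℝ, 0 < C ∧
    ∀ k p r₁ r₂ s₁ s₂ y ω, ‖r₁‖ ≤ R → ‖r₂‖ ≤ R → ‖s₁‖ ≤ R → ‖s₂‖ ≤ R →
      S.H k p r₁ s₁ y ω ≤ S.H k p r₂ s₂ y ω + C * (‖r₁ - r₂‖ + ‖s₁ - s₂‖) := by
  obtain ⟨C, hC, h⟩ := S.H_cont (|R| + 1) (by positivity)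
  have hR : R ≤ |R| + 1 := (le_abs_self R).trans (by linarith)
  refine ⟨C, hC, fun k p r₁ r₂ s₁ s₂ y ω h1 h2 h3 h4 => ?_⟩
  have := h k p p r₁ r₂ s₁ s₂ y y ω (h1.trans hR) (h2.trans hR) (h3.trans hR) (h4.trans hR)
  simp only [sub_self, norm_zero, mul_zero, zero_add, add_zero] at this
  linarith [(abs_le.1 this).2]

/-- Convexity comparison for multiples `μ > 1` of a corrector. -/
theorem Setting.exists_convex_above (S : Setting n m) (R C₀ : ℝ) (hR : 0 ≤ R) (hC₀ : 0 ≤ C₀) :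
    ∃ C : ℝ, 0 < C ∧ ∀ k p P e (r θ μ : ℝ) u s s' y ω, ‖p‖ ≤ R → |r| ≤ R → 0 ≤ θ → θ ≤ 1 →
      1 < μ → μ ≤ 2 → ‖e‖ ≤ μ - 1 → r - θ ≤ u k → (∀ j, j ≠ k → u j ≤ r + θ) →
      (∀ j, |s j| ≤ C₀) → (∀ j, μ * s j ≤ s' j) →
      μ * S.H k (p + μ⁻¹ • P) (fun _ => r) s y ω ≤
        S.H k (p + e + P) u s' y ω + C * ((μ - 1) + θ) := by
  obtain ⟨C₅, hC₅, h5⟩ := S.exists_lipschitz_rs (R + 1 + 2 * C₀)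
  obtain ⟨C₄, hC₄, h4⟩ := S.H_bounded (R + 1 + 2 * C₀) (by positivity)
  refine ⟨2 * C₅ * C₀ + C₄ + C₅, by positivity, ?_⟩
  intro k p P e r θ μ u s s' y ω hp hr hθ hθ1 hμ hμ2 he huk huj hs hs'
  have hμ0 : 0 < μ := by linarith
  have hr1 : ‖(fun _ : Fin m => r)‖ ≤ R + 1 + 2 * C₀ := (norm_const_le r).trans (by linarith)
  have ns : ‖s‖ ≤ C₀ := (pi_norm_le_iff_of_nonneg hC₀).2 hs
  have nμs : ‖μ • s‖ ≤ 2 * C₀ := by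
    rw [norm_smul, Real.norm_eq_abs, abs_of_pos hμ0]
    exact mul_le_mul hμ2 ns (norm_nonneg _) (by norm_num)
  have nd : ‖s - μ • s‖ ≤ (μ - 1) * C₀ := by
    rw [show s - μ • s = -((μ - 1) • s) by rw [sub_smul, one_smul]; abel, norm_neg, norm_smul,
      Real.norm_eq_abs, abs_of_pos (by linarith)]
    exact mul_le_mul_of_nonneg_left ns (by linarith)
  obtain ⟨u', hu'⟩ : ∃ u' : Fin m → ℝ, u' = fun j => if j = k then r - θ else r + θ := ⟨_, rfl⟩
  have hu'k : u' k = r - θ := by rw [hu']; exact if_pos rfl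
  have hu'j : ∀ j, j ≠ k → u' j = r + θ := fun j hj => by rw [hu']; exact if_neg hj
  have nu : ‖(fun _ : Fin m => r) - u'‖ ≤ θ := by
    refine (pi_norm_le_iff_of_nonneg hθ).2 fun j => ?_
    rw [Pi.sub_apply, Real.norm_eq_abs]
    by_cases hj : j = k
    · subst hj; rw [hu'k, sub_sub_cancel, abs_of_nonneg hθ]
    · rw [hu'j j hj, sub_add_cancel_left, abs_neg, abs_of_nonneg hθ]
  have nu' : ‖u'‖ ≤ R + 1 + 2 * C₀ := by
    have h1 := norm_sub_le (fun _ : Fin m => r) ((fun _ : Fin m => r) - u')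
    rw [sub_sub_cancel] at h1
    have h2 := (norm_const_le (m := m) r)
    linarith
  have e1 : S.H k (p + e + P) u (μ • s) y ω ≤ S.H k (p + e + P) u s' y ω :=
    S.H_le_of_s_le hs'
  have e2 : S.H k (p + e + P) u' (μ • s) y ω ≤ S.H k (p + e + P) u (μ • s) y ω :=
    S.H_le_of_r (by rw [hu'k]; exact huk) fun j hj => by rw [hu'j j hj]; exact huj j hj
  have e3 := h5 k (p + e + P) (fun _ => r) u' (μ • s) (μ • s) y ω hr1 nu' (by linarith) (by linarith)
  have e4 := h5 k (p + μ⁻¹ • P) (fun _ => r) (fun _ => r) s (μ • s) y ω hr1 hr1 (by linarith)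
    (by linarith)
  rw [sub_self, norm_zero] at e3 e4
  have hz : ‖p - (μ - 1)⁻¹ • e‖ ≤ R + 1 := by
    have h1 := norm_sub_le p ((μ - 1)⁻¹ • e)
    have h2 : ‖(μ - 1)⁻¹ • e‖ ≤ 1 := by
      rw [norm_smul, norm_inv, Real.norm_eq_abs, abs_of_pos (by linarith),
        inv_mul_le_iff₀ (by linarith)]
      linarith
    linarith
  have hμ1 : (μ - 1) ≠ 0 := by linarith
  have e5 := (S.H_convex_p k (fun _ => r) (μ • s) y ω).2 (Set.mem_univ (p + e + P))
    (Set.mem_univ (p - (μ - 1)⁻¹ • e)) (inv_nonneg.2 hμ0.le)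
    (sub_nonneg.2 (inv_le_one_of_one_le₀ hμ.le)) (add_sub_cancel _ _)
  have e6 : μ⁻¹ • (p + e + P) + (1 - μ⁻¹) • (p - (μ - 1)⁻¹ • e) = p + μ⁻¹ • P := by
    have : (1 - μ⁻¹) * (μ - 1)⁻¹ = μ⁻¹ := by field_simp
    simp only [smul_add, smul_sub, sub_smul (1 : ℝ), one_smul]
    have h2 : ((μ - 1)⁻¹ • e - μ⁻¹ • (μ - 1)⁻¹ • e) = μ⁻¹ • e := by
      rw [smul_smul, ← sub_smul]; congr 1; linarith only [this]
    rw [show μ⁻¹ • p + μ⁻¹ • e + μ⁻¹ • P + (p - (μ - 1)⁻¹ • e - (μ⁻¹ • p - μ⁻¹ • (μ - 1)⁻¹ • e)) =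
      p + μ⁻¹ • P + μ⁻¹ • e - ((μ - 1)⁻¹ • e - μ⁻¹ • (μ - 1)⁻¹ • e) by abel, h2]
    abel
  rw [e6] at e5
  have e7 := (abs_le.1 (h4 k (p - (μ - 1)⁻¹ • e) (fun _ => r) (μ • s) y ω (by linarith) hr1
    (by linarith))).2
  simp only [smul_eq_mul] at e5
  have e8 := mul_le_mul_of_nonneg_left e5 hμ0.le
  have e9 : ∀ a b : ℝ, μ * (μ⁻¹ * a + (1 - μ⁻¹) * b) = a + (μ - 1) * b := fun a b => by field_simp
  rw [e9] at e8
  have e10 := mul_le_mul_of_nonneg_left e7 (by linarith : 0 ≤ μ - 1)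
  have e11 := mul_le_mul_of_nonneg_left e4 hμ0.le
  have e12 : μ * (C₅ * (0 + ‖s - μ • s‖)) ≤ 2 * (C₅ * ((μ - 1) * C₀)) := by
    rw [zero_add]
    exact mul_le_mul hμ2 (mul_le_mul_of_nonneg_left nd hC₅.le)
      (mul_nonneg hC₅.le (norm_nonneg _)) (by norm_num)
  have e13 := mul_le_mul_of_nonneg_left nu hC₅.le
  have e14 : 0 ≤ (2 * C₅ * C₀ + C₄) * θ := by positivity
  have e15 : 0 ≤ C₅ * (μ - 1) := mul_nonneg hC₅.le (by linarith)
  linarith only [e1, e2, e3, e8, e10, e11, e12, e13, e14, e15]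

/-- Convexity comparison for multiples `μ < 1` of a corrector. -/
theorem Setting.exists_convex_below (S : Setting n m) (R C₀ : ℝ) (hR : 0 ≤ R) (hC₀ : 0 ≤ C₀) :
    ∃ C : ℝ, 0 < C ∧ ∀ k p P e (r θ μ : ℝ) u s s' y ω, ‖p‖ ≤ R → |r| ≤ R → 0 ≤ θ → θ ≤ 1 →
      0 < μ → μ < 1 → ‖e‖ ≤ 1 - μ → u k ≤ r + θ → (∀ j, j ≠ k → r - θ ≤ u j) →
      (∀ j, |s j| ≤ C₀) → (∀ j, s' j ≤ μ * s j) →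
      S.H k (p + e + P) u s' y ω ≤
        μ * S.H k (p + μ⁻¹ • P) (fun _ => r) s y ω + C * ((1 - μ) + θ) := by
  obtain ⟨C₅, hC₅, h5⟩ := S.exists_lipschitz_rs (R + 1 + C₀)
  obtain ⟨C₄, hC₄, h4⟩ := S.H_bounded (R + 1 + C₀) (by positivity)
  refine ⟨C₅ * C₀ + C₄ + C₅, by positivity, ?_⟩
  intro k p P e r θ μ u s s' y ω hp hr hθ hθ1 hμ0 hμ1 he huk huj hs hs'
  have hr1 : ‖(fun _ : Fin m => r)‖ ≤ R + 1 + C₀ := (norm_const_le r).trans (by linarith)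
  have ns : ‖s‖ ≤ C₀ := (pi_norm_le_iff_of_nonneg hC₀).2 hs
  have nμs : ‖μ • s‖ ≤ C₀ := by
    rw [norm_smul, Real.norm_eq_abs, abs_of_pos hμ0]
    exact (mul_le_of_le_one_left (norm_nonneg _) hμ1.le).trans ns
  have nd : ‖μ • s - s‖ ≤ (1 - μ) * C₀ := by
    rw [show μ • s - s = -((1 - μ) • s) by rw [sub_smul, one_smul]; abel, norm_neg, norm_smul,
      Real.norm_eq_abs, abs_of_pos (by linarith)]
    exact mul_le_mul_of_nonneg_left ns (by linarith)
  obtain ⟨u', hu'⟩ : ∃ u' : Fin m → ℝ, u' = fun j => if j = k then r + θ else r - θ := ⟨_, rfl⟩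
  have hu'k : u' k = r + θ := by rw [hu']; exact if_pos rfl
  have hu'j : ∀ j, j ≠ k → u' j = r - θ := fun j hj => by rw [hu']; exact if_neg hj
  have nu : ‖u' - (fun _ : Fin m => r)‖ ≤ θ := by
    refine (pi_norm_le_iff_of_nonneg hθ).2 fun j => ?_
    rw [Pi.sub_apply, Real.norm_eq_abs]
    by_cases hj : j = k
    · subst hj; rw [hu'k, add_sub_cancel_left, abs_of_nonneg hθ]
    · rw [hu'j j hj, sub_sub_cancel_left, abs_neg, abs_of_nonneg hθ]
  have nu' : ‖u'‖ ≤ R + 1 + C₀ := by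
    have h1 := norm_add_le (u' - (fun _ : Fin m => r)) (fun _ : Fin m => r)
    rw [sub_add_cancel] at h1
    have h2 := (norm_const_le (m := m) r)
    linarith
  have e1 : S.H k (p + e + P) u s' y ω ≤ S.H k (p + e + P) u (μ • s) y ω :=
    S.H_le_of_s_le hs'
  have e2 : S.H k (p + e + P) u (μ • s) y ω ≤ S.H k (p + e + P) u' (μ • s) y ω :=
    S.H_le_of_r (by rw [hu'k]; exact huk) fun j hj => by rw [hu'j j hj]; exact huj j hj
  have e3 := h5 k (p + e + P) u' (fun _ => r) (μ • s) (μ • s) y ω nu' hr1 (by linarith) (by linarith)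
  have e4 := h5 k (p + μ⁻¹ • P) (fun _ => r) (fun _ => r) (μ • s) s y ω hr1 hr1 (by linarith)
    (by linarith)
  rw [sub_self, norm_zero] at e3 e4
  have hz : ‖p + (1 - μ)⁻¹ • e‖ ≤ R + 1 := by
    have h1 := norm_add_le p ((1 - μ)⁻¹ • e)
    have h2 : ‖(1 - μ)⁻¹ • e‖ ≤ 1 := by
      rw [norm_smul, norm_inv, Real.norm_eq_abs, abs_of_pos (by linarith),
        inv_mul_le_iff₀ (by linarith)]
      linarith
    linarith
  have hμ2 : (1 - μ) ≠ 0 := by linarith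
  have e5 := (S.H_convex_p k (fun _ => r) (μ • s) y ω).2 (Set.mem_univ (p + μ⁻¹ • P))
    (Set.mem_univ (p + (1 - μ)⁻¹ • e)) hμ0.le (sub_nonneg.2 hμ1.le) (add_sub_cancel _ _)
  have e6 : μ • (p + μ⁻¹ • P) + (1 - μ) • (p + (1 - μ)⁻¹ • e) = p + e + P := by
    rw [smul_add, smul_add, smul_inv_smul₀ hμ0.ne', smul_inv_smul₀ hμ2, sub_smul, one_smul]
    abel
  rw [e6] at e5
  have e7 := (abs_le.1 (h4 k (p + (1 - μ)⁻¹ • e) (fun _ => r) (μ • s) y ω (by linarith) hr1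
    (by linarith))).2
  simp only [smul_eq_mul] at e5
  have e10 := mul_le_mul_of_nonneg_left e7 (by linarith : 0 ≤ 1 - μ)
  have e11 := mul_le_mul_of_nonneg_left e4 hμ0.le
  have e12 : μ * (C₅ * (0 + ‖μ • s - s‖)) ≤ 1 * (C₅ * ((1 - μ) * C₀)) := by
    rw [zero_add]
    exact mul_le_mul hμ1.le (mul_le_mul_of_nonneg_left nd hC₅.le)
      (mul_nonneg hC₅.le (norm_nonneg _)) (by norm_num)
  have e13 := mul_le_mul_of_nonneg_left nu hC₅.le
  have e14 : 0 ≤ (C₅ * C₀ + C₄) * θ := by positivity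
  have e15 : 0 ≤ C₅ * (1 - μ) := mul_nonneg hC₅.le (by linarith)
  linarith only [e1, e2, e3, e5, e10, e11, e12, e13, e14, e15]

end Perturbation

section EffectiveHamiltonian

set_option linter.unusedSectionVars false

open scoped RealInnerProductSpace

variable {n m : ℕ}

/-- The macroscopic solutions `w p r δ` for a fixed realisation, together with the uniform
convergence `δ w_k → -H̄` on balls of radius `R / δ`, for all components. -/
structure MacroConv (S : Setting n (m + 1)) (ω : S.Ω) (Hb : Euc n → ℝ → ℝ)
    (w : Euc n → ℝ → ℝ → Fin (m + 1) → Euc n → ℝ) : Prop where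
  sol : ∀ p r δ, 0 < δ → IsMacroSoln S p r δ ω (w p r δ)
  conv : ∀ p r R η, 0 < η → ∀ᶠ δ in 𝓝[>] (0 : ℝ), ∀ k x, ‖x‖ ≤ R →
    |δ * w p r δ k (δ⁻¹ • x) + Hb p r| ≤ η

theorem continuous_inv_jap_smul : Continuous fun z : Euc n => (jap z)⁻¹ • z :=
  (continuous_jap.inv₀ fun z => by linarith [one_le_jap z]).smul continuous_id

theorem MacroConv.abs_le {S : Setting n (m + 1)} {R : ℝ} : ∃ C : ℝ, 0 < C ∧
    ∀ {ω : S.Ω} {Hb : Euc n → ℝ → ℝ} {w : Euc n → ℝ → ℝ → Fin (m + 1) → Euc n → ℝ},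
      MacroConv S ω Hb w → ∀ p r, ‖p‖ ≤ R → |r| ≤ R → |Hb p r| ≤ C := by
  obtain ⟨C, hC, h⟩ := macro_value_bound S R
  refine ⟨C, hC, fun {ω Hb w} hw p r hp hr => ?_⟩
  refine le_of_forall_pos_le_add fun η hη => ?_
  have e1 := hw.conv p r 1 η hη
  have e2 : ∀ᶠ δ in 𝓝[>] (0 : ℝ), 0 < δ ∧ δ < 1 :=
    Ioo_mem_nhdsGT one_pos
  obtain ⟨δ, h1, h2, h3⟩ := (e1.and e2).exists
  have h4 := h1 0 0 (by simp)
  have h5 := h p r δ ω (w p r δ) hp hr h2 h3.le (hw.sol p r δ h2) 0 (δ⁻¹ • 0)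
  calc |Hb p r| = |(δ * w p r δ 0 (δ⁻¹ • 0) + Hb p r) - δ * w p r δ 0 (δ⁻¹ • 0)| := by ring_nf
    _ ≤ |δ * w p r δ 0 (δ⁻¹ • 0) + Hb p r| + |δ * w p r δ 0 (δ⁻¹ • 0)| := abs_sub _ _
    _ ≤ C + η := by linarith

set_option maxHeartbeats 1000000 in
theorem macro_compare (S : Setting n (m + 1)) {R : ℝ} (hR : 0 < R) : ∃ C : ℝ, 0 < C ∧
    ∀ p p' r r' δ ω v v', ‖p‖ ≤ R → |r| ≤ R → 0 < δ → δ ≤ 1 → r ≤ r' →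
      IsMacroSoln S p r δ ω v → IsMacroSoln S p' r' δ ω v' →
      ∀ η, ‖p' - p‖ < η → η ≤ 1 → δ * v' 0 0 - (1 + η) * (δ * v 0 0) ≤ C * η := by
  obtain ⟨C₀, hC₀, hosc⟩ := exists_macro_osc_bound S hR
  obtain ⟨C, hC, hcv⟩ := S.exists_convex_above R C₀ hR.le hC₀.le
  obtain ⟨A, hA, hσ⟩ := S.exists_sigCol_bound
  refine ⟨C, hC, fun p p' r r' δ ω v v' hp hr hδ hδ1 hrr hv hv' η hη hη1 => ?_⟩
  have hη0 : 0 < η := (norm_nonneg _).trans_lt hη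
  obtain ⟨B, hB⟩ := hv.2.1
  obtain ⟨B', hB'⟩ := hv'.2.1
  obtain ⟨Λ, hΛ⟩ := hv.2.2.1
  refine le_of_forall_small (J := A + 2) (by linarith) fun κ₀ hκ₀ hκ₀1 => ?_
  obtain ⟨κ, hκ⟩ : ∃ κ, κ = κ₀ * (η - ‖p' - p‖) := ⟨_, rfl⟩
  have hκ0 : 0 < κ := hκ ▸ mul_pos hκ₀ (by linarith)
  have hκ1 : κ ≤ η - ‖p' - p‖ := hκ ▸ mul_le_of_le_one_left (by linarith) hκ₀1
  have hκ2 : κ ≤ κ₀ := hκ ▸ mul_le_of_le_one_right hκ₀.le (by linarith [norm_nonneg (p' - p)])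
  have hμ : 0 < 1 + η := by linarith
  obtain ⟨k, y, hmax⟩ := exists_max_of_growth
    (f := fun i x => v' i x - (1 + η) * v i x - κ * jap x)
    (fun i => ((hv'.1 i).sub (continuous_const.mul (hv.1 i))).sub
      (continuous_const.mul continuous_jap)) (B := B' + (1 + η) * B) hκ0 (fun i x => by
      have h1 := (abs_le.1 (hB' i x)).2
      have h2 := mul_le_mul_of_nonneg_left (abs_le.1 (hB i x)).1 hμ.le
      have h3 := mul_le_mul_of_nonneg_left (norm_le_jap x) hκ0.le
      linarith)
  have hF' := continuous_macroF S p' r' δ ω hv'.1 k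
  have hF := continuous_macroF S p r δ ω hv.1 k
  have hg : Continuous fun z : Euc n => κ • (jap z)⁻¹ • z :=
    continuous_inv_jap_smul.const_smul κ
  have hs : Continuous fun z : Euc n => ∑ i, ‖sigCol S ω k z i‖ ^ 2 :=
    continuous_finsetSum _ fun i _ => (continuous_sigCol S ω k i).norm.pow 2
  obtain ⟨P, -, hP⟩ := exists_common_gradient (w := fun z => v' k z - κ * jap z)
    (v := fun z => (1 + η) * v k z) ((hv'.1 k).sub (continuous_const.mul continuous_jap))
    (Λ := (1 + η) * Λ) (C := A) (by positivity) hA.le (fun a b => by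
      have := (hΛ k).dist_le_mul a b
      rw [Real.dist_eq, dist_eq_norm] at this
      rw [← mul_sub, abs_mul, abs_of_pos hμ, mul_assoc]
      exact mul_le_mul_of_nonneg_left this hμ.le)
    ((macro_jsub hv'.2.2.2.1 k).sub_test (φ := fun z => κ * jap z)
      (g := fun z => κ • (jap z)⁻¹ • z) (c := κ) (fun z d => by
        have := mul_le_mul_of_nonneg_left (jap_add_le z d) hκ0.le
        rw [real_inner_smul_left _ _ κ]
        linarith))
    ((macro_jsup hv.2.2.2.2 k).const_mul hμ)
    ((hF'.comp (continuous_fst.prodMk (continuous_snd.add (hg.comp continuous_fst)))).sub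
      (continuous_const.mul (hs.comp continuous_fst)))
    (continuous_const.mul (hF.comp (continuous_fst.prodMk
      (continuous_snd.const_smul (1 + η)⁻¹))))
    (continuous_sigCol S ω k) (fun i a b => (hσ k ω).2.1 a b i) (z₀ := y) univ_mem
    (ContinuousLinearMap.id ℝ _) (ContinuousLinearMap.id ℝ _) (fun _ _ => rfl) (fun _ _ => rfl)
    (Eventually.of_forall fun z => by
      have := hmax k z
      simp only [ContinuousLinearMap.id_apply]
      linarith)
  simp only [ContinuousLinearMap.id_apply, macroF] at hP
  have hjy : ‖κ • (jap y)⁻¹ • y‖ ≤ κ := by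
    rw [norm_smul, Real.norm_eq_abs, abs_of_pos hκ0]
    exact mul_le_of_le_one_right hκ0.le (norm_inv_jap_smul_le y)
  have h1 := hcv k p P (p' - p + κ • (jap y)⁻¹ • y) r 0 (1 + η) (fun _ => r)
    (fun j => v k y - v j y) (fun j => v' k y - v' j y) y ω hp hr le_rfl zero_le_one (by linarith)
    (by linarith) ((norm_add_le _ _).trans (by linarith)) (by linarith) (fun j _ => by linarith)
    (fun j => hosc p r δ ω v hp hr hδ hδ1 hv k j y) (fun j => by linarith [hmax j y])
  rw [show p + (p' - p + κ • (jap y)⁻¹ • y) + P = p' + (P + κ • (jap y)⁻¹ • y) by abel] at h1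
  have h2 := S.H_colmon k (p' + (P + κ • (jap y)⁻¹ • y)) (fun _ => r') (fun _ => r)
    (fun j => v' k y - v' j y) y ω (fun _ => by rw [abs_of_nonneg (by linarith)])
  have h3 := mul_le_mul_of_nonneg_left ((hσ k ω).1 y) hκ0.le
  have h4 := mul_le_mul_of_nonneg_left (hmax 0 0) hδ.le
  have f5 : jap (0 : Euc n) ≤ 2 := (jap_le 0).trans (by rw [norm_zero]; norm_num)
  have h5 : δ * (κ * jap (0 : Euc n)) ≤ 1 * (κ * 2) :=
    mul_le_mul hδ1 (mul_le_mul_of_nonneg_left f5 hκ0.le)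
      (mul_nonneg hκ0.le (by linarith [one_le_jap (0 : Euc n)])) zero_le_one
  have h6 : 0 ≤ δ * (κ * jap y) :=
    mul_nonneg hδ.le (mul_nonneg hκ0.le (by linarith [one_le_jap y]))
  have h7 := mul_le_mul_of_nonneg_right hκ2 (by linarith : 0 ≤ A + 2)
  linarith only [hP, h1, h2, h3, h4, h5, h6, h7]

/-- The effective Hamiltonian is nondecreasing in `r` and locally Lipschitz in `p`. -/
theorem MacroConv.le_add {S : Setting n (m + 1)} {ω : S.Ω} {Hb : Euc n → ℝ → ℝ}
    {w : Euc n → ℝ → ℝ → Fin (m + 1) → Euc n → ℝ} (hw : MacroConv S ω Hb w) {R : ℝ} (hR : 0 < R) :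
    ∃ C : ℝ, 0 < C ∧ ∀ p p' r r' η, ‖p‖ ≤ R → |r| ≤ R → r ≤ r' → ‖p' - p‖ < η → η ≤ 1 →
      Hb p r ≤ Hb p' r' + C * η := by
  obtain ⟨C, hC, h⟩ := macro_compare S hR
  obtain ⟨C', hC', h'⟩ := MacroConv.abs_le (S := S) (R := R)
  refine ⟨C + C', by linarith, fun p p' r r' η hp hr hrr hη hη1 => ?_⟩
  have hη0 : 0 < η := (norm_nonneg _).trans_lt hη
  refine le_of_forall_pos_le_add fun θ hθ => ?_
  have e1 := hw.conv p r 1 (θ / 3) (by linarith)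
  have e2 := hw.conv p' r' 1 (θ / 3) (by linarith)
  have e3 : ∀ᶠ δ in 𝓝[>] (0 : ℝ), 0 < δ ∧ δ < 1 := Ioo_mem_nhdsGT one_pos
  obtain ⟨δ, h1, h2, h3, h4⟩ := (e1.and (e2.and e3)).exists
  have g1 := h1 0 0 (by simp)
  have g2 := h2 0 0 (by simp)
  rw [smul_zero] at g1 g2
  have g3 := h p p' r r' δ ω _ _ hp hr h3 h4.le hrr (hw.sol p r δ h3) (hw.sol p' r' δ h3) η hη hη1
  have g4 := (_root_.abs_le.1 (h' hw p r hp hr)).1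
  have g5 := mul_le_mul_of_nonneg_left (_root_.abs_le.1 g1).2 (by linarith : 0 ≤ 1 + η)
  have g6 := mul_le_mul_of_nonneg_left g4 hη0.le
  have g7 := mul_le_mul_of_nonneg_right hη1 hθ.le
  linarith [(_root_.abs_le.1 g2).1]

end EffectiveHamiltonian

section HalfRelaxed

set_option linter.unusedSectionVars false

open scoped RealInnerProductSpace

variable {n m : ℕ}

/-- `U` is the half-relaxed upper limit, jointly over the components, of `W ε` as `ε → 0⁺`, on
`{t > 0}`. -/
def IsUpperLim (W : ℝ → Fin (m + 1) → SpT n → ℝ) (U : SpT n → ℝ) : Prop :=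
  ∀ z, 0 < z.snd → (∀ c, U z < c → ∀ᶠ q in 𝓝[>] (0 : ℝ) ×ˢ 𝓝 z, ∀ k, W q.1 k q.2 < c) ∧
    ∀ c, c < U z → ∃ᶠ q in 𝓝[>] (0 : ℝ) ×ˢ 𝓝 z, ∃ k, c < W q.1 k q.2

/-- The test function `⟪q, z - z₀⟫ + C ‖z - z₀‖²`. -/
def parab (z₀ q : SpT n) (C : ℝ) (z : SpT n) : ℝ := ⟪q, z - z₀⟫ + C * ‖z - z₀‖ ^ 2

theorem continuous_parab (z₀ q : SpT n) (C : ℝ) : Continuous (parab z₀ q C) := by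
  unfold parab; fun_prop

theorem parab_add (z₀ q : SpT n) (C : ℝ) (z d : SpT n) :
    parab z₀ q C (z + d) =
      parab z₀ q C z + ⟪q + (2 * C) • (z - z₀), d⟫ + 2 * C / 2 * ‖d‖ ^ 2 := by
  unfold parab
  rw [show z + d - z₀ = (z - z₀) + d by abel, norm_add_sq_real, inner_add_right, inner_add_left,
    real_inner_smul_left]
  ring

set_option maxHeartbeats 1000000 in
theorem exists_penalized_max {W : ℝ → Fin (m + 1) → SpT n → ℝ} {U : SpT n → ℝ}
    (hW : ∀ ε, 0 < ε → ∀ k, Continuous (W ε k)) (hU : IsUpperLim W U) {z₀ : SpT n}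
    (hz₀ : 0 < z₀.snd) {q : SpT n} {C : ℝ}
    (hjet : ∀ᶠ d in 𝓝 (0 : SpT n), U (z₀ + d) ≤ U z₀ + ⟪q, d⟫ + C * ‖d‖ ^ 2)
    {ψ : ℝ → Fin (m + 1) → SpT n → ℝ} (hψ : ∀ ε, 0 < ε → ∀ k, Continuous (ψ ε k)) {c : ℝ}
    (hc : ∀ η, 0 < η → ∀ᶠ ε in 𝓝[>] (0 : ℝ), ∀ k z, ‖z - z₀‖ ≤ 1 → |ψ ε k z - c| ≤ η) {τ : ℝ}
    (hτ : 0 < τ) :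
    ∃ ε k z, 0 < ε ∧ ε ≤ τ ∧ 0 < z.snd ∧ ‖z - z₀‖ ≤ τ ∧ |ψ ε k z - c| ≤ τ ∧
      (∀ᶠ z' in 𝓝 z, W ε k z' - parab z₀ q (|C| + 1) z' - ψ ε k z' ≤
        W ε k z - parab z₀ q (|C| + 1) z - ψ ε k z) ∧
      (∀ j, W ε j z - ψ ε j z ≤ W ε k z - ψ ε k z) ∧ U z₀ - τ ≤ W ε k z ∧
      ∀ j, W ε j z ≤ U z₀ + τ := by
  obtain ⟨φ, hφ⟩ : ∃ φ, φ = parab z₀ q (|C| + 1) := ⟨_, rfl⟩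
  rw [← hφ]
  have hφc : Continuous φ := hφ ▸ continuous_parab _ _ _
  have hφ0 : φ z₀ = 0 := by rw [hφ]; simp [parab]
  have t1 : ∀ᶠ z in 𝓝 z₀, U z ≤ U z₀ + φ z - ‖z - z₀‖ ^ 2 := by
    have hT : Tendsto (fun z : SpT n => z - z₀) (𝓝 z₀) (𝓝 0) := by
      have : Tendsto (fun z : SpT n => z - z₀) (𝓝 z₀) (𝓝 (z₀ - z₀)) :=
        tendsto_id.sub tendsto_const_nhds
      rwa [sub_self] at this
    filter_upwards [hT.eventually hjet] with z hz
    rw [add_sub_cancel] at hz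
    rw [hφ]
    unfold parab
    have := mul_le_mul_of_nonneg_right (le_abs_self C) (sq_nonneg ‖z - z₀‖)
    linarith
  have t2 : ∀ᶠ z in 𝓝 z₀, |φ z| ≤ τ / 2 := by
    have := (hφc.abs.tendsto' z₀ 0 (by simp [hφ0])).eventually (Iic_mem_nhds (by linarith : 0 < τ / 2))
    exact this
  have t3 : ∀ᶠ z : SpT n in 𝓝 z₀, 0 < z.snd := isOpen_upperHalf.mem_nhds hz₀
  obtain ⟨ρ₀, hρ₀, hball⟩ := Metric.eventually_nhds_iff.1 (t1.and (t2.and t3))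
  obtain ⟨ρ, hρ⟩ : ∃ ρ, ρ = min (ρ₀ / 2) (min τ 1) := ⟨_, rfl⟩
  have hρ0 : 0 < ρ := by rw [hρ]; positivity
  have hρ1 : ρ ≤ ρ₀ / 2 := hρ ▸ min_le_left _ _
  have hρτ : ρ ≤ τ := hρ ▸ (min_le_right _ _).trans (min_le_left _ _)
  have hρ2 : ρ ≤ 1 := hρ ▸ (min_le_right _ _).trans (min_le_right _ _)
  have hK : ∀ z ∈ Metric.closedBall z₀ ρ, U z ≤ U z₀ + φ z - ‖z - z₀‖ ^ 2 ∧ |φ z| ≤ τ / 2 ∧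
      0 < z.snd := fun z hz => hball (lt_of_le_of_lt hz (by linarith))
  obtain ⟨θ, hθ⟩ : ∃ θ, θ = min (ρ ^ 2 / 8) (τ / 12) := ⟨_, rfl⟩
  have hθ0 : 0 < θ := by rw [hθ]; positivity
  have hθρ : θ ≤ ρ ^ 2 / 8 := hθ ▸ min_le_left _ _
  have hθτ : θ ≤ τ / 12 := hθ ▸ min_le_right _ _
  have hcomp : IsCompact (Metric.closedBall z₀ ρ) := isCompact_closedBall _ _
  have b1 : ∀ᶠ ε in 𝓝[>] (0 : ℝ), ∀ z ∈ Metric.closedBall z₀ ρ, ∀ k,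
      W ε k z < U z₀ + φ z - ‖z - z₀‖ ^ 2 + θ := by
    have h1 : {p : ℝ × SpT n | ∀ k, W p.1 k p.2 < U z₀ + φ p.2 - ‖p.2 - z₀‖ ^ 2 + θ} ∈
        𝓝[>] (0 : ℝ) ×ˢ 𝓝ˢ (Metric.closedBall z₀ ρ) := by
      refine hcomp.mem_prod_nhdsSet_of_forall fun z hz => ?_
      have h2 := (hK z hz).1
      have h3 := (hU z (hK z hz).2.2).1 (U z + θ / 2) (by linarith)
      have h4 : ∀ᶠ z' in 𝓝 z, U z + θ / 2 < U z₀ + φ z' - ‖z' - z₀‖ ^ 2 + θ := by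
        have hcont : Continuous fun z' : SpT n => U z₀ + φ z' - ‖z' - z₀‖ ^ 2 + θ := by fun_prop
        exact hcont.tendsto z |>.eventually (lt_mem_nhds (by linarith))
      filter_upwards [h3, h4.prod_inr (𝓝[>] (0 : ℝ))] with p hp1 hp2 k
      exact (hp1 k).trans hp2
    obtain ⟨pa, hpa, pb, hpb, h⟩ := eventually_prod_iff.1 h1
    filter_upwards [hpa] with ε hε z hz k
    exact h hε (hpb.self_of_nhdsSet z hz) k
  have b2 := hc θ hθ0
  have b3 : ∀ᶠ ε in 𝓝[>] (0 : ℝ), 0 < ε ∧ ε < τ := Ioo_mem_nhdsGT hτ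
  have b4 : ∀ᶠ z in 𝓝 z₀, ‖z - z₀‖ < ρ := by
    filter_upwards [Metric.ball_mem_nhds z₀ hρ0] with z hz
    rwa [Metric.mem_ball, dist_eq_norm] at hz
  have b5 : ∀ᶠ z in 𝓝 z₀, |φ z| < θ := by
    exact (hφc.abs.tendsto' z₀ 0 (by simp [hφ0])).eventually (gt_mem_nhds hθ0)
  obtain ⟨⟨ε, z₁⟩, ⟨k₁, hk₁⟩, ⟨hb1, hb2, hε, hετ⟩, hz₁ρ, hz₁φ⟩ :=
    (((hU z₀ hz₀).2 (U z₀ - θ) (by linarith)).and_eventually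
      ((b1.and (b2.and b3)).prod_mk (b4.and b5))).exists
  dsimp only at hk₁ hb1 hb2 hε hετ hz₁ρ hz₁φ
  have hmax : ∀ k, ∃ z ∈ Metric.closedBall z₀ ρ, ∀ z' ∈ Metric.closedBall z₀ ρ,
      W ε k z' - φ z' - ψ ε k z' ≤ W ε k z - φ z - ψ ε k z := fun k =>
    hcomp.exists_isMaxOn (Metric.nonempty_closedBall.2 hρ0.le)
      (((hW ε hε k).sub hφc).sub (hψ ε hε k)).continuousOn
  choose zz hzz hzmax using hmax
  obtain ⟨k, hk⟩ := Finite.exists_max fun k => W ε k (zz k) - φ (zz k) - ψ ε k (zz k)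
  have hm : ∀ j, ∀ z' ∈ Metric.closedBall z₀ ρ,
      W ε j z' - φ z' - ψ ε j z' ≤ W ε k (zz k) - φ (zz k) - ψ ε k (zz k) := fun j z' hz' =>
    (hzmax j z' hz').trans (hk j)
  have hzK := hzz k
  have hzn : ‖zz k - z₀‖ ≤ ρ := by rwa [Metric.mem_closedBall, dist_eq_norm] at hzK
  have hz₁K : z₁ ∈ Metric.closedBall z₀ ρ := by
    rw [Metric.mem_closedBall, dist_eq_norm]; exact hz₁ρ.le
  obtain ⟨hz1, hz2, hz3⟩ := hK (zz k) hzK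
  have m1 := hm k₁ z₁ hz₁K
  have m2 := abs_le.1 (hb2 k₁ z₁ (by linarith))
  have m3 := abs_le.1 (hb2 k (zz k) (by linarith))
  have m4 := hb1 (zz k) hzK k
  have m5 := abs_lt.1 hz₁φ
  have m6 := abs_le.1 hz2
  have hlt : ‖zz k - z₀‖ < ρ := by
    refine lt_of_pow_lt_pow_left₀ 2 hρ0.le ?_
    have : 0 < ρ ^ 2 := by positivity
    linarith
  refine ⟨ε, k, zz k, hε, hετ.le, hz3, hzn.trans hρτ, abs_le.2 ⟨by linarith, by linarith⟩, ?_, ?_,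
    by linarith, fun j => ?_⟩
  · have : ∀ᶠ z' in 𝓝 (zz k), z' ∈ Metric.ball z₀ ρ :=
      Metric.isOpen_ball.mem_nhds (by rwa [Metric.mem_ball, dist_eq_norm])
    filter_upwards [this] with z' hz'
    exact hm k z' (Metric.ball_subset_closedBall hz')
  · intro j
    linarith [hm j (zz k) hzK]
  · have := hb1 (zz k) hzK j
    have := sq_nonneg ‖zz k - z₀‖
    linarith

end HalfRelaxed

section LimitJets

set_option linter.unusedSectionVars false

open scoped RealInnerProductSpace

variable {n m : ℕ}

theorem sum_norm_epsCol_le {S : Setting n (m + 1)} {A : ℝ} {ω : S.Ω} {k : Fin (m + 1)}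
    (hA : ∀ y, ∑ i, ‖sigCol S ω k y i‖ ^ 2 ≤ A) {ε : ℝ} (hε : 0 < ε) (z : SpT n) :
    ∑ i, ‖epsCol S ε ω k z i‖ ^ 2 ≤ ε * A := by
  have : ∀ i, ‖epsCol S ε ω k z i‖ ^ 2 = ε * ‖sigCol S ω k (ε⁻¹ • z.fst) i‖ ^ 2 := fun i => by
    rw [norm_sq_eq]
    change ‖√ε • sigCol S ω k (ε⁻¹ • z.fst) i‖ ^ 2 + ‖(0 : ℝ)‖ ^ 2 = _
    rw [norm_smul, Real.norm_eq_abs, mul_pow, sq_abs, Real.sq_sqrt hε.le, norm_zero]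
    ring
  rw [Finset.sum_congr rfl fun i _ => this i, ← Finset.mul_sum]
  exact mul_le_mul_of_nonneg_left (hA _) hε.le

theorem continuous_epsCol (S : Setting n (m + 1)) (ε : ℝ) (ω : S.Ω) (k : Fin (m + 1)) (i : Fin n) :
    Continuous fun z => epsCol S ε ω k z i :=
  continuous_pr.comp ((((continuous_sigCol S ω k i).comp
    (continuous_fst'.const_smul ε⁻¹)).const_smul √ε).prodMk continuous_const)

theorem rescale_lipschitz {w : Euc n → ℝ} {Λ : NNReal} (hw : LipschitzWith Λ w) {ε μ : ℝ}
    (hε : 0 < ε) (hμ : 0 < μ) (a b : Euc n) :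
    |ε * μ * w (ε⁻¹ • a) - ε * μ * w (ε⁻¹ • b)| ≤ μ * Λ * ‖a - b‖ := by
  have h := hw.dist_le_mul (ε⁻¹ • a) (ε⁻¹ • b)
  rw [Real.dist_eq, dist_eq_norm, ← smul_sub, norm_smul, Real.norm_eq_abs,
    abs_of_pos (inv_pos.2 hε)] at h
  rw [← mul_sub, abs_mul, abs_of_pos (mul_pos hε hμ)]
  calc ε * μ * |w (ε⁻¹ • a) - w (ε⁻¹ • b)| ≤ ε * μ * (Λ * (ε⁻¹ * ‖a - b‖)) :=
        mul_le_mul_of_nonneg_left h (mul_pos hε hμ).le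
    _ = μ * Λ * ‖a - b‖ := by field_simp

/-- The coupling of the perturbed test function with the corrector at scale `ε`. -/
theorem exists_corrector_gradient {S : Setting n (m + 1)} {ω : S.Ω} {k : Fin (m + 1)} {A ε μ : ℝ}
    (hσ : (∀ y, ∑ i, ‖sigCol S ω k y i‖ ^ 2 ≤ A) ∧
      ∀ x y i, ‖sigCol S ω k x i - sigCol S ω k y i‖ ≤ A * ‖x - y‖) (hA : 0 < A)
    (hε : 0 < ε) (hμ : 0 < μ) {W : SpT n → ℝ} (hW : Continuous W) {F₁ : SpT n → SpT n → ℝ}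
    (hF₁ : Continuous fun z : SpT n × SpT n => F₁ z.1 z.2)
    (h₁ : JSub (upperHalf n) (epsCol S ε ω k) F₁ W) {v : Euc n → ℝ} {Λ : NNReal}
    (hv : LipschitzWith Λ v) {F₂ : Euc n → Euc n → ℝ}
    (hF₂ : Continuous fun z : Euc n × Euc n => F₂ z.1 z.2)
    (h₂ : JSup Set.univ (sigCol S ω k) F₂ v) {z₀ q z : SpT n} {C : ℝ} (hC : 0 ≤ C)
    (hz : 0 < z.snd)
    (hmax : ∀ᶠ z' in 𝓝 z, W z' - parab z₀ q C z' - ε * μ * v (ε⁻¹ • z'.fst) ≤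
      W z - parab z₀ q C z - ε * μ * v (ε⁻¹ • z.fst)) :
    ∃ P : Euc n, F₁ z (pr P 0 + (q + (2 * C) • (z - z₀))) - 2 * C * (ε * A) ≤
      μ * F₂ (ε⁻¹ • z.fst) (μ⁻¹ • P) := by
  obtain ⟨P, -, hP⟩ := exists_common_gradient (w := fun z => W z - parab z₀ q C z)
    (v := fun x => ε * μ * v (ε⁻¹ • x)) (hW.sub (continuous_parab _ _ _))
    (Λ := μ * Λ) (C := √ε * (A * ε⁻¹)) (mul_nonneg hμ.le Λ.2)
    (mul_nonneg (Real.sqrt_nonneg _) (mul_nonneg hA.le (inv_nonneg.2 hε.le)))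
    (rescale_lipschitz hv hε hμ)
    (h₁.sub_test (φ := parab z₀ q C) (g := fun z => q + (2 * C) • (z - z₀)) (c := 2 * C)
      fun z d => (parab_add z₀ q C z d).le)
    (h₂.rescale hε hμ)
    ((hF₁.comp (continuous_fst.prodMk (continuous_snd.add (by fun_prop)))).sub
      (continuous_const.mul (continuous_finsetSum _ fun i _ =>
        ((continuous_epsCol S ε ω k i).norm.pow 2).comp continuous_fst)))
    (continuous_const.mul (hF₂.comp ((continuous_fst.const_smul ε⁻¹).prodMk
      (continuous_snd.const_smul μ⁻¹))))
    (continuous_epsCol S ε ω k) (fun i x y => by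
      rw [← smul_sub, norm_smul, Real.norm_eq_abs, abs_of_nonneg (Real.sqrt_nonneg _), mul_assoc]
      refine mul_le_mul_of_nonneg_left ?_ (Real.sqrt_nonneg _)
      have := hσ.2 (ε⁻¹ • x) (ε⁻¹ • y) i
      rwa [← smul_sub, norm_smul, Real.norm_eq_abs, abs_of_pos (inv_pos.2 hε), ← mul_assoc] at this)
    (isOpen_upperHalf.mem_nhds hz) proj₁ incl₁ (fun a h => inner_pr a 0 h |>.trans (by simp))
    (fun _ _ => rfl) (by simpa using hmax)
  refine ⟨P, ?_⟩
  have h3 := mul_le_mul_of_nonneg_left (sum_norm_epsCol_le hσ.1 hε z) (by linarith : 0 ≤ 2 * C)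
  have hP' : F₁ z (pr P 0 + (q + (2 * C) • (z - z₀))) - 2 * C * ∑ i, ‖epsCol S ε ω k z i‖ ^ 2 ≤
    μ * F₂ (ε⁻¹ • z.fst) (μ⁻¹ • P) := hP
  linarith

theorem abs_scaled_sub_le {x h η μ : ℝ} (hμ : 0 < μ) (hμ2 : μ ≤ 2) (hx : |x + h| ≤ η / 2) :
    |μ * x - -(μ * h)| ≤ η := by
  rw [show μ * x - -(μ * h) = μ * (x + h) by ring, abs_mul, abs_of_pos hμ]
  calc μ * |x + h| ≤ 2 * (η / 2) := mul_le_mul hμ2 hx (abs_nonneg _) zero_le_two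
    _ = η := by ring

theorem norm_fst_le_of_near {z z₀ : SpT n} (h : ‖z - z₀‖ ≤ 1) : ‖z.fst‖ ≤ ‖z₀.fst‖ + 1 := by
  have h1 := norm_fst_le' (z - z₀)
  have h2 : ‖z.fst - z₀.fst‖ ≤ 1 := h1.trans h
  have h3 := norm_sub_norm_le z.fst z₀.fst
  linarith

theorem MacroConv.continuous_corrector {S : Setting n (m + 1)} {ω : S.Ω} {Hb : Euc n → ℝ → ℝ}
    {w : Euc n → ℝ → ℝ → Fin (m + 1) → Euc n → ℝ} (hw : MacroConv S ω Hb w) (p : Euc n) (r c : ℝ)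
    {ε : ℝ} (hε : 0 < ε) (k : Fin (m + 1)) :
    Continuous fun z : SpT n => c * w p r ε k (ε⁻¹ • z.fst) :=
  continuous_const.mul (((hw.sol p r ε hε).1 k).comp (continuous_fst'.const_smul ε⁻¹))

set_option maxHeartbeats 1000000 in
/-- The upper half-relaxed limit is a subsolution of the effective equation. -/
theorem jet1Sub_of_isUpperLim {S : Setting n (m + 1)} {ω : S.Ω} {Hb : Euc n → ℝ → ℝ}
    {w : Euc n → ℝ → ℝ → Fin (m + 1) → Euc n → ℝ} (hw : MacroConv S ω Hb w)
    {u₀ : Fin (m + 1) → Euc n → ℝ} {u : ℝ → Fin (m + 1) → Euc n × ℝ → ℝ}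
    (hu : ∀ ε, 0 < ε → IsEpsSoln S ε ω u₀ (u ε)) {U : SpT n → ℝ}
    (hU : IsUpperLim (fun ε k => onSpT (u ε k)) U) : Jet1Sub Hb U := by
  intro z₀ hz₀ q C hjet
  obtain ⟨R, hR⟩ : ∃ R, R = max ‖q.fst‖ |U z₀| + 1 := ⟨_, rfl⟩
  have hp : ‖q.fst‖ ≤ R := by rw [hR]; linarith [le_max_left ‖q.fst‖ |U z₀|]
  have hr : |U z₀| ≤ R := by rw [hR]; linarith [le_max_right ‖q.fst‖ |U z₀|]
  have hR0 : 0 < R := by rw [hR]; linarith [le_max_right ‖q.fst‖ |U z₀|, abs_nonneg (U z₀)]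
  obtain ⟨C₀, hC₀, hosc⟩ := exists_macro_osc_bound S hR0
  obtain ⟨C₁, hC₁, hcv⟩ := S.exists_convex_above R C₀ hR0.le hC₀.le
  obtain ⟨A, hA, hσ⟩ := S.exists_sigCol_bound
  obtain ⟨D, hD⟩ : ∃ D, D = |C| + 1 := ⟨_, rfl⟩
  have hD0 : 1 ≤ D := by rw [hD]; linarith [abs_nonneg C]
  obtain ⟨h, hh⟩ : ∃ h, h = Hb q.fst (U z₀) := ⟨_, rfl⟩
  rw [← hh]
  refine le_of_forall_small (J := |h| + 2 + A + 2 * C₁)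
    (by linarith [abs_nonneg h]) fun τ hτ hτ1 => ?_
  obtain ⟨τ', hτ'⟩ : ∃ τ', τ' = τ / (2 * D) := ⟨_, rfl⟩
  have hτ'0 : 0 < τ' := hτ' ▸ div_pos hτ (by linarith)
  have hDτ : 2 * D * τ' = τ := by rw [hτ']; field_simp
  have hτ'τ : τ' ≤ τ := hτ' ▸ div_le_self hτ.le (by linarith)
  have hμ : 0 < 1 + τ := by linarith
  obtain ⟨ε, k, z, hε, hετ, hz, hzτ, hψτ, hloc, hcol, hlow, hup⟩ :=
    exists_penalized_max (W := fun ε k => onSpT (u ε k))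
      (fun ε hε k => continuous_onSpT ((hu ε hε).1 k)) hU hz₀ hjet
      (ψ := fun ε k z => ε * (1 + τ) * w q.fst (U z₀) ε k (ε⁻¹ • z.fst))
      (fun ε hε k => hw.continuous_corrector _ _ _ hε k) (c := -((1 + τ) * h)) (fun η hη => by
        filter_upwards [hw.conv q.fst (U z₀) (‖z₀.fst‖ + 1) (η / 2) (by linarith)] with ε hε k z hz
        rw [mul_comm ε, mul_assoc]
        exact abs_scaled_sub_le hμ (by linarith) (hh ▸ hε k z.fst (norm_fst_le_of_near hz)))
      hτ'0
  rw [← hD] at hloc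
  obtain ⟨hs1, ⟨B, hB⟩, ⟨Λ, hΛ⟩, hsub, hsup⟩ := hw.sol q.fst (U z₀) ε hε
  obtain ⟨P, hP⟩ := exists_corrector_gradient ⟨(hσ k ω).1, (hσ k ω).2.1⟩ hA hε hμ
    (continuous_onSpT ((hu ε hε).1 k)) (continuous_epsF S ε ω (hu ε hε).1 k)
    (eps_jsub hε (hu ε hε).2.2.1 k) (hΛ k)
    (continuous_macroF S q.fst (U z₀) ε ω hs1 k) (macro_jsup hsup k) (by linarith) hz hloc
  have n1 : ‖(2 * D) • (z - z₀)‖ ≤ τ := by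
    rw [norm_smul, Real.norm_eq_abs, abs_of_pos (by linarith), ← hDτ]
    exact mul_le_mul_of_nonneg_left hzτ (by linarith)
  have n2 := (norm_fst_le' ((2 * D) • (z - z₀))).trans n1
  have n3 := (norm_snd_le' ((2 * D) • (z - z₀))).trans n1
  have h1 := hcv k q.fst P ((2 * D) • (z - z₀)).fst (U z₀) τ' (1 + τ) (fun j => onSpT (u ε j) z)
    (fun j => w q.fst (U z₀) ε k (ε⁻¹ • z.fst) - w q.fst (U z₀) ε j (ε⁻¹ • z.fst))
    (fun j => (onSpT (u ε k) z - onSpT (u ε j) z) / ε) (ε⁻¹ • z.fst) ω hp hr hτ'0.le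
    (by linarith) (by linarith) (by linarith) (by linarith) hlow (fun j _ => hup j)
    (fun j => hosc _ _ _ ω _ hp hr hε (by linarith) (hw.sol _ _ ε hε) k j _) (fun j => by
      rw [le_div_iff₀ hε]
      have := hcol j
      linarith)
  have h2 : epsF S ε ω (u ε) k z (pr P 0 + (q + (2 * D) • (z - z₀))) =
      q.snd + ((2 * D) • (z - z₀)).snd +
        S.H k (q.fst + ((2 * D) • (z - z₀)).fst + P) (fun j => onSpT (u ε j) z)
          (fun j => (onSpT (u ε k) z - onSpT (u ε j) z) / ε) (ε⁻¹ • z.fst) ω := by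
    unfold epsF
    rw [show (pr P (0 : ℝ) + (q + (2 * D) • (z - z₀))).fst =
        P + (q.fst + ((2 * D) • (z - z₀)).fst) from rfl,
      show (pr P (0 : ℝ) + (q + (2 * D) • (z - z₀))).snd =
        0 + (q.snd + ((2 * D) • (z - z₀)).snd) from rfl, zero_add, add_comm P]
  rw [h2] at hP
  unfold macroF at hP
  have h3 := (abs_le.1 hψτ).2
  have h4 := (abs_le.1 (Real.norm_eq_abs _ ▸ n3)).1
  have h5 := mul_le_mul_of_nonneg_right (neg_abs_le h) hτ.le
  have h6 : 2 * D * (ε * A) ≤ τ * A := by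
    rw [← hDτ, ← mul_assoc]
    exact mul_le_mul_of_nonneg_right (mul_le_mul_of_nonneg_left hετ (by linarith)) hA.le
  have h7 := mul_le_mul_of_nonneg_left hτ'τ hC₁.le
  linarith only [hP, h1, h3, h4, h5, h6, h7, hτ'τ]

set_option maxHeartbeats 1000000 in
/-- The lower half-relaxed limit is a supersolution of the effective equation. -/
theorem jet1Sup_of_isUpperLim_neg {S : Setting n (m + 1)} {ω : S.Ω} {Hb : Euc n → ℝ → ℝ}
    {w : Euc n → ℝ → ℝ → Fin (m + 1) → Euc n → ℝ} (hw : MacroConv S ω Hb w)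
    {u₀ : Fin (m + 1) → Euc n → ℝ} {u : ℝ → Fin (m + 1) → Euc n × ℝ → ℝ}
    (hu : ∀ ε, 0 < ε → IsEpsSoln S ε ω u₀ (u ε)) {V : SpT n → ℝ}
    (hV : IsUpperLim (fun ε k z => -onSpT (u ε k) z) fun z => -V z) : Jet1Sup Hb V := by
  intro z₀ hz₀ q C hjet
  obtain ⟨R, hR⟩ : ∃ R, R = max ‖q.fst‖ |V z₀| + 1 := ⟨_, rfl⟩
  have hp : ‖q.fst‖ ≤ R := by rw [hR]; linarith [le_max_left ‖q.fst‖ |V z₀|]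
  have hr : |V z₀| ≤ R := by rw [hR]; linarith [le_max_right ‖q.fst‖ |V z₀|]
  have hR0 : 0 < R := by rw [hR]; linarith [le_max_right ‖q.fst‖ |V z₀|, abs_nonneg (V z₀)]
  obtain ⟨C₀, hC₀, hosc⟩ := exists_macro_osc_bound S hR0
  obtain ⟨C₁, hC₁, hcv⟩ := S.exists_convex_below R C₀ hR0.le hC₀.le
  obtain ⟨A, hA, hσ⟩ := S.exists_sigCol_bound
  obtain ⟨D, hD⟩ : ∃ D, D = |C| + 1 := ⟨_, rfl⟩
  have hD0 : 1 ≤ D := by rw [hD]; linarith [abs_nonneg C]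
  obtain ⟨h, hh⟩ : ∃ h, h = Hb q.fst (V z₀) := ⟨_, rfl⟩
  rw [← hh]
  suffices hs : -(q.snd + h) ≤ 0 by linarith
  refine le_of_forall_small (J := |h| + 2 + A + 2 * C₁)
    (by linarith [abs_nonneg h]) fun τ₀ hτ₀ hτ₀1 => ?_
  obtain ⟨τ, hτe⟩ : ∃ τ, τ = τ₀ / 2 := ⟨_, rfl⟩
  have hτ : 0 < τ := by linarith
  have hτ1 : τ ≤ 1 / 2 := by linarith
  obtain ⟨τ', hτ'⟩ : ∃ τ', τ' = τ / (2 * D) := ⟨_, rfl⟩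
  have hτ'0 : 0 < τ' := hτ' ▸ div_pos hτ (by linarith)
  have hDτ : 2 * D * τ' = τ := by rw [hτ']; field_simp
  have hτ'τ : τ' ≤ τ := hτ' ▸ div_le_self hτ.le (by linarith)
  have hμ : 0 < 1 - τ := by linarith
  obtain ⟨ε, k, z, hε, hετ, hz, hzτ, hψτ, hloc, hcol, hlow, hup⟩ :=
    exists_penalized_max (W := fun ε k z => -onSpT (u ε k) z)
      (fun ε hε k => (continuous_onSpT ((hu ε hε).1 k)).neg) hV hz₀ (q := -q) (C := C)
      (by filter_upwards [hjet] with d hd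
          rw [inner_neg_left]
          linarith)
      (ψ := fun ε k z => ε * (1 - τ) * -w q.fst (V z₀) ε k (ε⁻¹ • z.fst))
      (fun ε hε k => by
        have := (hw.continuous_corrector q.fst (V z₀) (ε * (1 - τ)) hε k).neg
        exact this.congr fun z => by simp) (c := -((1 - τ) * -h)) (fun η hη => by
        filter_upwards [hw.conv q.fst (V z₀) (‖z₀.fst‖ + 1) (η / 2) (by linarith)] with ε hε k z hz
        rw [mul_comm ε, mul_assoc]
        refine abs_scaled_sub_le hμ (by linarith) ?_
        rw [mul_neg, ← neg_add, abs_neg, hh]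
        exact hε k z.fst (norm_fst_le_of_near hz))
      hτ'0
  rw [← hD] at hloc
  obtain ⟨hs1, ⟨B, hB⟩, ⟨Λ, hΛ⟩, hsub, hsup⟩ := hw.sol q.fst (V z₀) ε hε
  have hF₁ : Continuous fun z : SpT n × SpT n => -epsF S ε ω (u ε) k z.1 (-z.2) :=
    ((continuous_epsF S ε ω (hu ε hε).1 k).comp (continuous_fst.prodMk continuous_snd.neg)).neg
  have hF₂ : Continuous fun z : Euc n × Euc n =>
      -macroF S q.fst (V z₀) ε ω (w q.fst (V z₀) ε) k z.1 (-z.2) :=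
    ((continuous_macroF S q.fst (V z₀) ε ω hs1 k).comp
      (continuous_fst.prodMk continuous_snd.neg)).neg
  have hΛ' : LipschitzWith Λ fun x => -w q.fst (V z₀) ε k x := (hΛ k).neg
  obtain ⟨P, hP⟩ := exists_corrector_gradient ⟨(hσ k ω).1, (hσ k ω).2.1⟩ hA hε hμ
    (continuous_onSpT ((hu ε hε).1 k)).neg hF₁ (eps_jsup hε (hu ε hε).2.2.2.1 k).neg hΛ'
    hF₂ (macro_jsub hsub k).neg (by linarith) hz hloc
  have n1 : ‖(2 * D) • (z - z₀)‖ ≤ τ := by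
    rw [norm_smul, Real.norm_eq_abs, abs_of_pos (by linarith), ← hDτ]
    exact mul_le_mul_of_nonneg_left hzτ (by linarith)
  have n2 := (norm_fst_le' ((2 * D) • (z - z₀))).trans n1
  have n3 := (norm_snd_le' ((2 * D) • (z - z₀))).trans n1
  have h1 := hcv k q.fst (-P) (-((2 * D) • (z - z₀)).fst) (V z₀) τ' (1 - τ)
    (fun j => onSpT (u ε j) z)
    (fun j => w q.fst (V z₀) ε k (ε⁻¹ • z.fst) - w q.fst (V z₀) ε j (ε⁻¹ • z.fst))
    (fun j => (onSpT (u ε k) z - onSpT (u ε j) z) / ε) (ε⁻¹ • z.fst) ω hp hr hτ'0.le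
    (by linarith) (by linarith) (by linarith) (by rw [norm_neg]; linarith)
    (by linarith [hlow]) (fun j _ => by linarith [hup j])
    (fun j => hosc _ _ _ ω _ hp hr hε (by linarith) (hw.sol _ _ ε hε) k j _) (fun j => by
      rw [div_le_iff₀ hε]
      have := hcol j
      linarith)
  have h2 : epsF S ε ω (u ε) k z (-(pr P 0 + (-q + (2 * D) • (z - z₀)))) =
      q.snd - ((2 * D) • (z - z₀)).snd +
        S.H k (q.fst + -((2 * D) • (z - z₀)).fst + -P) (fun j => onSpT (u ε j) z)
          (fun j => (onSpT (u ε k) z - onSpT (u ε j) z) / ε) (ε⁻¹ • z.fst) ω := by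
    unfold epsF
    rw [show (-(pr P (0 : ℝ) + (-q + (2 * D) • (z - z₀)))).fst =
        -(P + (-q.fst + ((2 * D) • (z - z₀)).fst)) from rfl,
      show (-(pr P (0 : ℝ) + (-q + (2 * D) • (z - z₀)))).snd =
        -(0 + (-q.snd + ((2 * D) • (z - z₀)).snd)) from rfl,
      show -(P + (-q.fst + ((2 * D) • (z - z₀)).fst)) =
        q.fst + -((2 * D) • (z - z₀)).fst + -P by abel]
    ring
  rw [h2] at hP
  unfold macroF at hP
  rw [← smul_neg] at hP
  have h3 := (abs_le.1 hψτ).2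
  have h4 := (abs_le.1 (Real.norm_eq_abs _ ▸ n3)).1
  have h5 := mul_le_mul_of_nonneg_right (neg_abs_le h) hτ.le
  have h6 : 2 * D * (ε * A) ≤ τ * A := by
    rw [← hDτ, ← mul_assoc]
    exact mul_le_mul_of_nonneg_right (mul_le_mul_of_nonneg_left hετ (by linarith)) hA.le
  have h7 := mul_le_mul_of_nonneg_left hτ'τ hC₁.le
  have h8 : 0 ≤ τ * (|h| + 2 + A + 2 * C₁) :=
    mul_nonneg hτ.le (by linarith [abs_nonneg h])
  have h9 : τ₀ * (|h| + 2 + A + 2 * C₁) = 2 * (τ * (|h| + 2 + A + 2 * C₁)) := by rw [hτe]; ring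
  linarith only [hP, h1, h3, h4, h5, h6, h7, hτ'τ, h8, h9]

end LimitJets

section LimitExistence

set_option linter.unusedSectionVars false

variable {n m : ℕ}

theorem MacroConv.of_tendsto {S : Setting n (m + 1)} {ω : S.Ω} {Hb : Euc n → ℝ → ℝ}
    {v : Euc n → ℝ → ℝ → Fin (m + 1) → Euc n → ℝ}
    (hv : ∀ p r δ, 0 < δ → IsMacroSoln S p r δ ω (v p r δ))
    (hconv : ∀ R, 0 < R → ∀ p r, Tendsto (fun δ : ℝ => ⨆ y ∈ Metric.ball (0 : Euc n) (R / δ),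
      |δ * v p r δ 0 y + Hb p r|) (𝓝[>] (0 : ℝ)) (𝓝 0)) : MacroConv S ω Hb v := by
  refine ⟨hv, fun p r R η hη => ?_⟩
  obtain ⟨C, hC, hosc⟩ := exists_macro_osc_bound S (R := max ‖p‖ |r| + 1) (by positivity)
  have e1 := (hconv (|R| + 1) (by positivity) p r).eventually
    (gt_mem_nhds (show (0 : ℝ) < η / 2 by linarith))
  have e2 : ∀ᶠ δ in 𝓝[>] (0 : ℝ), 0 < δ ∧ δ < min 1 (η / (2 * C)) :=
    Ioo_mem_nhdsGT (lt_min one_pos (by positivity))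
  filter_upwards [e1, e2] with δ h1 ⟨h2, h3⟩ k x hx
  have hδ1 : δ ≤ 1 := (h3.trans_le (min_le_left _ _)).le
  have hδC : δ * C ≤ η / 2 := by
    have := mul_le_mul_of_nonneg_right (h3.trans_le (min_le_right _ _)).le hC.le
    rwa [show η / (2 * C) * C = η / 2 by field_simp] at this
  obtain ⟨B, hB⟩ := (hv p r δ h2).2.1
  have hM : ∀ y, |δ * v p r δ 0 y + Hb p r| ≤ δ * B + |Hb p r| := fun y =>
    (abs_add_le _ _).trans (by
      rw [abs_mul, abs_of_pos h2]
      linarith [mul_le_mul_of_nonneg_left (hB 0 y) h2.le])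
  have hmem : δ⁻¹ • x ∈ Metric.ball (0 : Euc n) ((|R| + 1) / δ) := by
    rw [mem_ball_zero_iff, norm_smul, Real.norm_eq_abs, abs_of_pos (inv_pos.2 h2), div_eq_inv_mul]
    exact mul_lt_mul_of_pos_left (by linarith [le_abs_self R]) (inv_pos.2 h2)
  have h4 : |δ * v p r δ 0 (δ⁻¹ • x) + Hb p r| ≤
      ⨆ y ∈ Metric.ball (0 : Euc n) ((|R| + 1) / δ), |δ * v p r δ 0 y + Hb p r| := by
    refine le_ciSup_of_le ⟨δ * B + |Hb p r|, ?_⟩ (δ⁻¹ • x) ?_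
    · rintro _ ⟨y, rfl⟩
      exact Real.iSup_le (fun _ => hM y) ((abs_nonneg _).trans (hM y))
    · exact (ciSup_pos (f := fun _ => |δ * v p r δ 0 (δ⁻¹ • x) + Hb p r|) hmem).ge
  have h5 := hosc p r δ ω (v p r δ) (by linarith [le_max_left ‖p‖ |r|])
    (by linarith [le_max_right ‖p‖ |r|]) h2 hδ1 (hv p r δ h2) k 0 (δ⁻¹ • x)
  have h6 := mul_le_mul_of_nonneg_left h5 h2.le
  calc |δ * v p r δ k (δ⁻¹ • x) + Hb p r|
      = |(δ * v p r δ 0 (δ⁻¹ • x) + Hb p r) +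
          δ * (v p r δ k (δ⁻¹ • x) - v p r δ 0 (δ⁻¹ • x))| := by ring_nf
    _ ≤ |δ * v p r δ 0 (δ⁻¹ • x) + Hb p r| +
          |δ * (v p r δ k (δ⁻¹ • x) - v p r δ 0 (δ⁻¹ • x))| := abs_add_le _ _
    _ ≤ η := by rw [abs_mul δ, abs_of_pos h2]; linarith

theorem exists_isUpperLim {W : ℝ → Fin (m + 1) → SpT n → ℝ}
    (hW : ∀ z : SpT n, 0 < z.snd → ∃ M, ∀ᶠ q in 𝓝[>] (0 : ℝ) ×ˢ 𝓝 z, ∀ k, |W q.1 k q.2| ≤ M) :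
    ∃ U, IsUpperLim W U := by
  refine ⟨fun z => limsup (fun q : ℝ × SpT n => ⨆ k, W q.1 k q.2) (𝓝[>] (0 : ℝ) ×ˢ 𝓝 z),
    fun z hz => ?_⟩
  obtain ⟨M, hM⟩ := hW z hz
  have hfin : ∀ q : ℝ × SpT n, BddAbove (Set.range fun k => W q.1 k q.2) := fun q =>
    (Set.finite_range _).bddAbove
  have h1 : IsBoundedUnder (· ≤ ·) (𝓝[>] (0 : ℝ) ×ˢ 𝓝 z)
      fun q : ℝ × SpT n => ⨆ k, W q.1 k q.2 :=
    isBoundedUnder_of_eventually_le (a := M) (by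
      filter_upwards [hM] with q hq
      exact ciSup_le fun k => (abs_le.1 (hq k)).2)
  have h2 : IsBoundedUnder (· ≥ ·) (𝓝[>] (0 : ℝ) ×ˢ 𝓝 z)
      fun q : ℝ × SpT n => ⨆ k, W q.1 k q.2 :=
    isBoundedUnder_of_eventually_ge (a := -M) (by
      filter_upwards [hM] with q hq
      exact (abs_le.1 (hq 0)).1.trans (le_ciSup (hfin q) 0))
  refine ⟨fun c hc => ?_, fun c hc => ?_⟩
  · filter_upwards [eventually_lt_of_limsup_lt hc h1] with q hq k
    exact (le_ciSup (hfin q) k).trans_lt hq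
  · refine (frequently_lt_of_lt_limsup h2.isCoboundedUnder_le hc).mono fun q hq => ?_
    exact exists_lt_of_lt_ciSup hq

theorem IsUpperLim.le {W : ℝ → Fin (m + 1) → SpT n → ℝ} {U : SpT n → ℝ} (hU : IsUpperLim W U)
    {z : SpT n} (hz : 0 < z.snd) {c : ℝ}
    (h : ∀ᶠ q in 𝓝[>] (0 : ℝ) ×ˢ 𝓝 z, ∀ k, W q.1 k q.2 ≤ c) : U z ≤ c := by
  by_contra! hc
  obtain ⟨q, ⟨k, hk⟩, h'⟩ := (((hU z hz).2 c hc).and_eventually h).exists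
  exact absurd (h' k) (not_le.2 hk)

theorem IsUpperLim.ge {W : ℝ → Fin (m + 1) → SpT n → ℝ} {U : SpT n → ℝ} (hU : IsUpperLim W U)
    {z : SpT n} (hz : 0 < z.snd) {c : ℝ}
    (h : ∀ᶠ q in 𝓝[>] (0 : ℝ) ×ˢ 𝓝 z, ∃ k, c ≤ W q.1 k q.2) : c ≤ U z := by
  by_contra! hc
  obtain ⟨q, h', k, hk⟩ := (((hU z hz).1 c hc).and h).exists
  exact absurd (h' k) (not_lt.2 hk)

theorem IsUpperLim.eventually_le {W : ℝ → Fin (m + 1) → SpT n → ℝ} {U : SpT n → ℝ}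
    (hU : IsUpperLim W U) {z : SpT n} (hz : 0 < z.snd) {c : ℝ} (hc : U z < c) :
    ∀ᶠ z' in 𝓝 z, U z' ≤ c := by
  obtain ⟨pa, hpa, pb, hpb, h⟩ := eventually_prod_iff.1 ((hU z hz).1 c hc)
  filter_upwards [eventually_eventually_nhds.2 hpb, isOpen_upperHalf.mem_nhds hz] with z' hz' hz'0
  exact hU.le hz'0 (eventually_prod_iff.2 ⟨pa, hpa, pb, hz', fun ha _ hb k => (h ha hb k).le⟩)

theorem IsUpperLim.neg_le {W : ℝ → Fin (m + 1) → SpT n → ℝ} {U V : SpT n → ℝ}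
    (hU : IsUpperLim W U) (hV : IsUpperLim (fun ε k z => -W ε k z) fun z => -V z) {z : SpT n}
    (hz : 0 < z.snd) : V z ≤ U z := by
  refine le_of_forall_gt_imp_ge_of_dense fun c hc => ?_
  have := hV.ge hz (c := -c) (by
    filter_upwards [(hU z hz).1 c hc] with q hq
    exact ⟨0, by linarith [hq 0]⟩)
  linarith

end LimitExistence

section Barrier

set_option linter.unusedSectionVars false

open scoped RealInnerProductSpace

variable {n m : ℕ}

theorem exists_pos_max {ι X : Type*} [Finite ι] [NormedAddCommGroup X] [ProperSpace X]
    {K : Set X} (hK : IsClosed K) {f : ι → X → ℝ} (hf : ∀ i, Continuous (f i)) {ρ : ℝ}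
    (hneg : ∀ i, ∀ x ∈ K, ρ < ‖x‖ → f i x ≤ 0) (hpos : ∃ i, ∃ x ∈ K, 0 < f i x) :
    ∃ i, ∃ x ∈ K, 0 < f i x ∧ ∀ j, ∀ y ∈ K, f j y ≤ f i x := by
  obtain ⟨i₀, x₀, hx₀, h₀⟩ := hpos
  have hc : IsCompact (K ∩ Metric.closedBall 0 ρ) :=
    (isCompact_closedBall (0 : X) ρ).inter_left hK
  have hx₀' : ‖x₀‖ ≤ ρ := by
    by_contra! h
    exact absurd (hneg i₀ x₀ hx₀ h) (not_le.2 h₀)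
  choose x hx hmax using fun i => hc.exists_isMaxOn
    ⟨x₀, hx₀, mem_closedBall_zero_iff.2 hx₀'⟩ (hf i).continuousOn
  have : Nonempty ι := ⟨i₀⟩
  obtain ⟨i, hi⟩ := Finite.exists_max fun i => f i (x i)
  have hi₀ : 0 < f i (x i) := h₀.trans_le
    ((hmax i₀ (⟨hx₀, mem_closedBall_zero_iff.2 hx₀'⟩ : x₀ ∈ K ∩ Metric.closedBall 0 ρ)).trans
      (hi i₀))
  refine ⟨i, x i, (hx i).1, hi₀, fun j y hy => ?_⟩
  rcases le_or_gt ‖y‖ ρ with h | h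
  · exact (hmax j (⟨hy, mem_closedBall_zero_iff.2 h⟩ : y ∈ K ∩ Metric.closedBall 0 ρ)).trans (hi j)
  · exact (hneg j y hy h).trans hi₀.le

theorem norm_le_fst_add_snd (z : SpT n) : ‖z‖ ≤ ‖z.fst‖ + |z.snd| := by
  refine abs_le_of_sq_le_sq' ?_ (by positivity) |>.2
  rw [norm_sq_eq, Real.norm_eq_abs]
  nlinarith [norm_nonneg z.fst, abs_nonneg z.snd]

theorem sq_posPart_add_le (s d : ℝ) :
    (max (s + d) 0) ^ 2 ≤ (max s 0) ^ 2 + 2 * max s 0 * d + d ^ 2 := by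
  rcases le_total s 0 with h | h <;> rcases le_total (s + d) 0 with h' | h' <;>
    simp only [h, h', max_eq_left, max_eq_right] <;> nlinarith

set_option maxHeartbeats 1000000 in
/-- Comparison of a subsolution with a barrier which is quadratic in space. -/
theorem eps_barrier {S : Setting n (m + 1)} {ω : S.Ω} {ε A Q B T : ℝ} (hε : 0 < ε) (hQ : 0 < Q)
    (hA : ∀ k y, ∑ i, ‖sigCol S ω k y i‖ ^ 2 ≤ A)
    {W : Fin (m + 1) → SpT n → ℝ} (hW : ∀ k, Continuous (W k))
    {F : Fin (m + 1) → SpT n → SpT n → ℝ}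
    (hJ : ∀ k, JSub (upperHalf n) (epsCol S ε ω k) (F k) (W k))
    {a a' : Fin (m + 1) → ℝ → ℝ} (ha : ∀ k, Continuous (a k))
    (ha' : ∀ k t, 0 < t → ∃ c, ∀ᶠ d in 𝓝 (0 : ℝ), a k (t + d) ≤ a k t + a' k t * d + c * d ^ 2)
    {x₀ : Euc n} (hB : ∀ k z, 0 ≤ z.snd → z.snd ≤ T + 1 → W k z ≤ B)
    (hstart : ∀ k x, W k (pr x 0) ≤ a k 0 + Q * ‖x - x₀‖ ^ 2)
    (hcontact : ∀ k z b, 0 < z.snd → z.snd < T + 1 →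
      (∀ j, W j z - a j z.snd ≤ W k z - a k z.snd) →
      Q * ‖z.fst - x₀‖ ^ 2 < W k z - a k z.snd → a' k z.snd ≤ b →
      2 * Q * (ε * A) < F k z (pr ((2 * Q) • (z.fst - x₀)) b)) :
    ∀ k t, 0 ≤ t → t ≤ T → W k (pr x₀ t) ≤ a k t := by
  by_contra! hbad
  obtain ⟨k₀, t₀, ht₀, ht₀T, hbad⟩ := hbad
  obtain ⟨N, hN⟩ : ∃ N, N = |B| + ∑ k, |a k (T + 1)| := ⟨_, rfl⟩
  have hN0 : 0 ≤ N := hN ▸ add_nonneg (abs_nonneg _) (Finset.sum_nonneg fun _ _ => abs_nonneg _)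
  have hNk : ∀ k, B - a k (T + 1) ≤ N := fun k => by
    have := Finset.single_le_sum (f := fun k => |a k (T + 1)|) (fun _ _ => abs_nonneg _)
      (Finset.mem_univ k)
    rw [hN]
    linarith [le_abs_self B, neg_abs_le (a k (T + 1))]
  have hbd : ∀ k, ∃ M, ∀ t, 0 ≤ t → t ≤ T + 1 → -a k t ≤ M := fun k => by
    obtain ⟨M, hM⟩ := (isCompact_Icc (a := (0 : ℝ)) (b := T + 1)).bddAbove_image
      (ha k).neg.continuousOn
    exact ⟨M, fun t h0 h1 => hM ⟨t, ⟨h0, h1⟩, rfl⟩⟩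
  choose M hM using hbd
  obtain ⟨M', hM'⟩ : ∃ M', M' = |B| + ∑ k, |M k| := ⟨_, rfl⟩
  have hM'0 : 0 ≤ M' := hM' ▸ add_nonneg (abs_nonneg _) (Finset.sum_nonneg fun _ _ => abs_nonneg _)
  have hM'k : ∀ k, B + M k ≤ M' := fun k => by
    have := Finset.single_le_sum (f := fun k => |M k|) (fun _ _ => abs_nonneg _)
      (Finset.mem_univ k)
    rw [hM']
    linarith [le_abs_self B, le_abs_self (M k)]
  have hclosed : IsClosed {z : SpT n | 0 ≤ z.snd ∧ z.snd ≤ T + 1} :=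
    (isClosed_le continuous_const continuous_snd').inter
      (isClosed_le continuous_snd' continuous_const)
  obtain ⟨k, z, ⟨hz0, hz1⟩, hfz, hmax⟩ := exists_pos_max hclosed
    (f := fun k z => W k z - a k z.snd - Q * ‖z.fst - x₀‖ ^ 2 - N * (max (z.snd - T) 0) ^ 2)
    (ρ := ‖x₀‖ + (T + 1) + (1 + M' / Q)) (fun k => by
      have h1 := continuous_fst' (E₁ := Euc n) (E₂ := ℝ)
      have h2 := continuous_snd' (E₁ := Euc n) (E₂ := ℝ)
      have h3 := (ha k).comp h2
      have h4 := hW k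
      exact ((h4.sub h3).sub (continuous_const.mul ((h1.sub continuous_const).norm.pow 2))).sub
        (continuous_const.mul (((h2.sub continuous_const).max continuous_const).pow 2)))
    (by
      rintro k z ⟨h0, h1⟩ hz
      have e1 := norm_le_fst_add_snd z
      rw [abs_of_nonneg h0] at e1
      have e2 := norm_sub_norm_le z.fst x₀
      have e3 : 1 + M' / Q ≤ ‖z.fst - x₀‖ := by linarith
      have e0 : 0 ≤ M' / Q := div_nonneg hM'0 hQ.le
      have e4 : 1 + M' / Q ≤ ‖z.fst - x₀‖ ^ 2 := by nlinarith
      have e5 := mul_le_mul_of_nonneg_left e4 hQ.le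
      have e6 : Q * (1 + M' / Q) = Q + M' := by field_simp
      have e7 := mul_nonneg hN0 (sq_nonneg (max (z.snd - T) 0))
      linarith [hB k z h0 h1, hM k z.snd h0 h1, hM'k k])
    ⟨k₀, pr x₀ t₀, ⟨ht₀, by change t₀ ≤ T + 1; linarith⟩, by
      change 0 < W k₀ (pr x₀ t₀) - a k₀ t₀ - Q * ‖x₀ - x₀‖ ^ 2 - N * (max (t₀ - T) 0) ^ 2
      rw [sub_self, norm_zero, max_eq_right (by linarith : t₀ - T ≤ 0)]
      linarith⟩
  have hNp := mul_nonneg hN0 (sq_nonneg (max (z.snd - T) 0))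
  have hQp := mul_nonneg hQ.le (sq_nonneg ‖z.fst - x₀‖)
  have hzpos : 0 < z.snd := by
    rcases hz0.lt_or_eq with h | h
    · exact h
    · have := hstart k z.fst
      rw [show pr z.fst (0 : ℝ) = z by rw [h]; rfl] at this
      rw [← h] at hfz hNp
      linarith
  have hzlt : z.snd < T + 1 := by
    rcases hz1.lt_or_eq with h | h
    · exact h
    · rw [h, add_sub_cancel_left, max_eq_left zero_le_one] at hfz
      linarith [hB k z hz0 hz1, hNk k]
  obtain ⟨c, hc⟩ := ha' k z.snd hzpos
  obtain ⟨b, hb⟩ : ∃ b, b = a' k z.snd + N * (2 * max (z.snd - T) 0) := ⟨_, rfl⟩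
  have hcon := hcontact k z b hzpos hzlt (fun j => by linarith [hmax j z ⟨hz0, hz1⟩])
    (by linarith) (by
      rw [hb]; linarith [mul_nonneg hN0 (mul_nonneg zero_le_two (le_max_right (z.snd - T) 0))])
  have hsnd0 : Tendsto (fun h : SpT n => h.snd) (𝓝 0) (𝓝 0) := continuous_snd'.tendsto' _ _ rfl
  have hin : ∀ᶠ h : SpT n in 𝓝 0, 0 ≤ (z + h).snd ∧ (z + h).snd ≤ T + 1 := by
    have h1 : Tendsto (fun h : SpT n => z.snd + h.snd) (𝓝 0) (𝓝 z.snd) := by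
      simpa using tendsto_const_nhds.add hsnd0
    filter_upwards [h1.eventually (Icc_mem_nhds hzpos hzlt)] with h hh
    exact hh
  have htest := hJ k z hzpos (pr ((2 * Q) • (z.fst - x₀)) b)
    ((2 * Q) • (incl₁.comp proj₁) + (2 * (c + N)) • (incl₂.comp proj₂)) (by
      filter_upwards [hsnd0.eventually hc, hin] with h h1 h2
      have h3 := hmax k (z + h) h2
      have h4 := sq_posPart_add_le (z.snd - T) h.snd
      rw [show z.snd - T + h.snd = z.snd + h.snd - T by ring] at h4
      have h5 := mul_le_mul_of_nonneg_left h4 hN0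
      have h6 : ‖(z + h).fst - x₀‖ ^ 2 =
          ‖z.fst - x₀‖ ^ 2 + 2 * ⟪z.fst - x₀, h.fst⟫ + ‖h.fst‖ ^ 2 := by
        rw [← norm_add_sq_real]
        congr 2
        change z.fst + h.fst - x₀ = _
        abel
      rw [h6] at h3
      simp only [WithLp.add_snd] at h3
      rw [inner_pr, real_inner_smul_left]
      simp only [_root_.add_apply, _root_.smul_apply, ContinuousLinearMap.comp_apply,
        incl₁_apply, incl₂_apply, proj₁_apply, inner_add_left, real_inner_smul_left, inner_pr,
        inner_zero_left, real_inner_self_eq_norm_sq]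
      rw [show (proj₂ h : ℝ) = h.snd from rfl]
      simp only [RCLike.inner_apply, conj_trivial]
      rw [hb]
      linarith)
  have hsum : ∑ i, ⟪((2 * Q) • (incl₁.comp proj₁) + (2 * (c + N)) • (incl₂.comp proj₂) :
      SpT n →L[ℝ] SpT n) (epsCol S ε ω k z i), epsCol S ε ω k z i⟫ =
      2 * Q * ∑ i, ‖epsCol S ε ω k z i‖ ^ 2 := by
    rw [Finset.mul_sum]
    refine Finset.sum_congr rfl fun i _ => ?_
    unfold epsCol
    rw [norm_sq_eq]
    simp only [_root_.add_apply, _root_.smul_apply, ContinuousLinearMap.comp_apply,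
        incl₁_apply, incl₂_apply, proj₁_apply, inner_add_left, real_inner_smul_left, inner_pr,
        inner_zero_left, real_inner_self_eq_norm_sq]
    rw [show (proj₂ (pr (√ε • sigCol S ω k (ε⁻¹ • z.fst) i) (0 : ℝ)) : ℝ) = 0 from rfl]
    simp [pr]
  rw [hsum] at htest
  have := mul_le_mul_of_nonneg_left (sum_norm_epsCol_le (hA k) hε z) (by linarith : 0 ≤ 2 * Q)
  linarith

end Barrier

section Estimates

open scoped RealInnerProductSpace

variable {n m : ℕ}

theorem norm_two_smul_le {E : Type*} [NormedAddCommGroup E] [NormedSpace ℝ E] {Q M : ℝ}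
    (hQ : 0 < Q) {y : E} (h : Q * ‖y‖ ^ 2 ≤ M) : ‖(2 * Q) • y‖ ≤ 4 * Q * M + 1 := by
  rw [norm_smul, Real.norm_eq_abs, abs_of_pos (by linarith)]
  have h1 : 0 ≤ M := (mul_nonneg hQ.le (sq_nonneg ‖y‖)).trans h
  have h2 : 0 ≤ 4 * Q * M := mul_nonneg (by linarith) h1
  have h3 := mul_le_mul_of_nonneg_left h (by linarith : 0 ≤ 4 * Q)
  nlinarith [sq_nonneg (2 * Q * ‖y‖ - 1)]

theorem exists_quadratic_modulus {u₀ : Fin (m + 1) → Euc n → ℝ} (huc : ∀ k, UniformContinuous (u₀ k))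
    {B : ℝ} (hB : ∀ k x, |u₀ k x| ≤ B) {η : ℝ} (hη : 0 < η) :
    ∃ Q, 0 < Q ∧ ∀ k x y, u₀ k x ≤ u₀ k y + η + Q * ‖x - y‖ ^ 2 := by
  have hB0 : 0 ≤ B := (abs_nonneg _).trans (hB 0 0)
  choose δ hδ h using fun k => Metric.uniformContinuous_iff.1 (huc k) η hη
  obtain ⟨i, hi⟩ := Finite.exists_min δ
  have hs : 0 < δ i ^ 2 := pow_pos (hδ i) 2
  refine ⟨(2 * B + 1) / δ i ^ 2, div_pos (by linarith) hs, fun k x y => ?_⟩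
  rcases lt_or_ge ‖x - y‖ (δ i) with hxy | hxy
  · have h1 := h k (a := x) (b := y) (by rw [dist_eq_norm]; exact hxy.trans_le (hi k))
    rw [Real.dist_eq] at h1
    have h2 : 0 ≤ (2 * B + 1) / δ i ^ 2 * ‖x - y‖ ^ 2 :=
      mul_nonneg (div_nonneg (by linarith) hs.le) (sq_nonneg _)
    linarith [le_abs_self (u₀ k x - u₀ k y)]
  · have h1 : δ i ^ 2 ≤ ‖x - y‖ ^ 2 := pow_le_pow_left₀ (hδ i).le hxy 2
    have h2 : (2 * B + 1) / δ i ^ 2 * δ i ^ 2 ≤ (2 * B + 1) / δ i ^ 2 * ‖x - y‖ ^ 2 :=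
      mul_le_mul_of_nonneg_left h1 (div_nonneg (by linarith) hs.le)
    rw [div_mul_cancel₀ _ hs.ne'] at h2
    linarith [(abs_le.1 (hB k x)).2, (abs_le.1 (hB k y)).1]

set_option maxHeartbeats 1000000 in
theorem exists_eps_bound (S : Setting n (m + 1)) {u₀ : Fin (m + 1) → Euc n → ℝ} {B : ℝ}
    (hB : ∀ k x, |u₀ k x| ≤ B) : ∃ K, 0 < K ∧ ∀ ω ε u, 0 < ε → ε ≤ 1 → IsEpsSoln S ε ω u₀ u →
      ∀ k x t, 0 ≤ t → |u k (x, t)| ≤ B + K * t := by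
  have hB0 : 0 ≤ B := (abs_nonneg _).trans (hB 0 0)
  obtain ⟨A, hA, hsig⟩ := S.exists_sigCol_bound
  obtain ⟨C, hC, hHle⟩ := S.exists_H_le 0 0 2
  obtain ⟨C', hC', hleH⟩ := S.exists_le_H 0 0 2
  refine ⟨C + C' + 2 * A + 1, by linarith, fun ω ε u hε hε1 hu k x t ht => ?_⟩
  obtain ⟨hcont, hbdd, hsub, hsup, hini⟩ := hu
  obtain ⟨M, hM⟩ := hbdd (t + 1) (by linarith)
  have hM0 : 0 ≤ M := (abs_nonneg _).trans (hM 0 0 0 ⟨le_rfl, by linarith⟩)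
  obtain ⟨Q, hQ⟩ : ∃ Q, Q = 1 / (4 * (M + 1)) := ⟨_, rfl⟩
  have hQ0 : 0 < Q := hQ ▸ div_pos one_pos (by linarith)
  have hQM : 4 * Q * (M + 1) = 1 := by rw [hQ]; field_simp
  have hQ1 : Q ≤ 1 := by nlinarith
  have hQA : 2 * Q * (ε * A) ≤ 2 * A := by
    have h1 : Q * ε ≤ 1 := mul_le_one₀ hQ1 hε.le hε1
    nlinarith
  have hp : ∀ y : Euc n, Q * ‖y‖ ^ 2 ≤ M → ‖(2 * Q) • y‖ ≤ 2 := fun y hy =>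
    (norm_two_smul_le hQ0 hy).trans (by linarith)
  have ha' : ∀ (_ : Fin (m + 1)) (s : ℝ), 0 < s → ∃ c, ∀ᶠ d in 𝓝 (0 : ℝ),
      B + (C + C' + 2 * A + 1) * (s + d) ≤ B + (C + C' + 2 * A + 1) * s +
        (C + C' + 2 * A + 1) * d + c * d ^ 2 := fun _ s _ =>
    ⟨0, Eventually.of_forall fun d => by linarith⟩
  have ha : ∀ _ : Fin (m + 1), Continuous fun s => B + (C + C' + 2 * A + 1) * s := fun _ => by
    fun_prop
  rw [_root_.abs_le]
  constructor
  · have := eps_barrier (S := S) (ω := ω) (T := t) (B := M) hε hQ0 (fun k => (hsig k ω).1)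
      (W := fun k z => -onSpT (u k) z) (fun k => (continuous_onSpT (hcont k)).neg) (fun k => (eps_jsup hε hsup k).neg)
      (a' := fun _ _ => C + C' + 2 * A + 1) ha ha' (x₀ := x)
      (fun k z h0 h1 => (neg_le_abs _).trans (hM k z.fst z.snd ⟨h0, h1⟩))
      (fun k y => by
        change -u k (y, 0) ≤ _
        rw [hini]
        have := mul_nonneg hQ0.le (sq_nonneg ‖y - x‖)
        linarith [(_root_.abs_le.1 (hB k y)).1])
      (fun k z b h0 h1 hmax hpos hb => by
        have hKt : 0 ≤ (C + C' + 2 * A + 1) * z.snd := mul_nonneg (by linarith) h0.le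
        have hQp := mul_nonneg hQ0.le (sq_nonneg ‖z.fst - x‖)
        have huk : onSpT (u k) z < 0 := by linarith
        have hu0 : ∀ j, onSpT (u k) z ≤ onSpT (u j) z := fun j => by linarith [hmax j]
        have e1 := S.H_le_of_r (k := k) (p := -(2 * Q) • (z.fst - x))
          (s := fun j => (onSpT (u k) z - onSpT (u j) z) / ε) (y := ε⁻¹ • z.fst) (ω := ω)
          (r := fun j => onSpT (u j) z) (r' := fun j => min (onSpT (u j) z) 0)
          (le_min le_rfl huk.le) (fun j _ => min_le_left _ _)
        have e2 := S.H_colmon k (-(2 * Q) • (z.fst - x)) (fun _ => 0)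
          (fun j => min (onSpT (u j) z) 0) (fun j => (onSpT (u k) z - onSpT (u j) z) / ε)
          (ε⁻¹ • z.fst) ω (fun i => by
            rw [zero_sub, zero_sub, abs_neg, abs_of_nonpos (min_le_right _ _)]
            exact neg_le_neg (le_min ((min_le_left _ _).trans (hu0 i)) (min_le_right _ _)))
        have e3 := hHle k (-(2 * Q) • (z.fst - x)) (fun _ => 0)
          (fun j => (onSpT (u k) z - onSpT (u j) z) / ε) (ε⁻¹ • z.fst) ω
          (by
            rw [neg_smul, norm_neg]
            have := (neg_le_abs _).trans (hM k z.fst z.snd ⟨h0.le, h1.le⟩)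
            exact hp _ (by change -onSpT (u k) z ≤ M at this; linarith))
          (by simp)
          (fun j => div_nonpos_of_nonpos_of_nonneg (by linarith [hu0 j]) hε.le)
        change 2 * Q * (ε * A) < -(-b + S.H k (-((2 * Q) • (z.fst - x))) _ _ _ ω)
        rw [← neg_smul]
        linarith) k t ht le_rfl
    have h2 : -u k (x, t) ≤ B + (C + C' + 2 * A + 1) * t := this
    linarith
  · have := eps_barrier (S := S) (ω := ω) (T := t) (B := M) hε hQ0 (fun k => (hsig k ω).1)
      (fun k => continuous_onSpT (hcont k)) (fun k => eps_jsub hε hsub k)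
      (a' := fun _ _ => C + C' + 2 * A + 1) ha ha' (x₀ := x)
      (fun k z h0 h1 => (le_abs_self _).trans (hM k z.fst z.snd ⟨h0, h1⟩))
      (fun k y => by
        change u k (y, 0) ≤ _
        rw [hini]
        have := mul_nonneg hQ0.le (sq_nonneg ‖y - x‖)
        linarith [(_root_.abs_le.1 (hB k y)).2])
      (fun k z b h0 h1 hmax hpos hb => by
        have hKt : 0 ≤ (C + C' + 2 * A + 1) * z.snd := mul_nonneg (by linarith) h0.le
        have hQp := mul_nonneg hQ0.le (sq_nonneg ‖z.fst - x‖)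
        have huk : 0 < onSpT (u k) z := by linarith
        have hu0 : ∀ j, onSpT (u j) z ≤ onSpT (u k) z := fun j => by linarith [hmax j]
        have e1 := S.H_le_of_r (k := k) (p := (2 * Q) • (z.fst - x))
          (s := fun j => (onSpT (u k) z - onSpT (u j) z) / ε) (y := ε⁻¹ • z.fst) (ω := ω)
          (r' := fun j => onSpT (u j) z) (r := fun j => max (onSpT (u j) z) 0)
          (max_le le_rfl huk.le) (fun j _ => le_max_left _ _)
        have e2 := S.H_colmon k ((2 * Q) • (z.fst - x)) (fun j => max (onSpT (u j) z) 0)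
          (fun _ => 0) (fun j => (onSpT (u k) z - onSpT (u j) z) / ε)
          (ε⁻¹ • z.fst) ω (fun i => by
            rw [sub_zero, sub_zero, abs_of_nonneg (le_max_right _ _)]
            exact max_le ((hu0 i).trans (le_max_left _ _)) (le_max_right _ _))
        have e3 := hleH k ((2 * Q) • (z.fst - x)) (fun _ => 0)
          (fun j => (onSpT (u k) z - onSpT (u j) z) / ε) (ε⁻¹ • z.fst) ω
          (by
            have := (le_abs_self _).trans (hM k z.fst z.snd ⟨h0.le, h1.le⟩)
            exact hp _ (by change onSpT (u k) z ≤ M at this; linarith))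
          (by simp)
          (fun j => div_nonneg (by linarith [hu0 j]) hε.le)
        change 2 * Q * (ε * A) < b + S.H k ((2 * Q) • (z.fst - x)) _ _ _ ω
        linarith) k t ht le_rfl
    exact this

theorem eventually_exp_le (D c s : ℝ) (hD : 0 ≤ D) : ∀ᶠ d in 𝓝 (0 : ℝ),
    D * Real.exp (-(c * (s + d))) ≤ D * Real.exp (-(c * s)) - D * c * Real.exp (-(c * s)) * d +
      D * Real.exp (-(c * s)) * c ^ 2 * d ^ 2 := by
  have h0 : Tendsto (fun d : ℝ => |-(c * d)|) (𝓝 0) (𝓝 0) :=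
    Continuous.tendsto' (by fun_prop) _ _ (by simp)
  filter_upwards [h0.eventually (Iic_mem_nhds one_pos)] with d hd
  have h1 := (_root_.abs_le.1 (Real.abs_exp_sub_one_sub_id_le hd)).2
  have h2 : Real.exp (-(c * (s + d))) = Real.exp (-(c * s)) * Real.exp (-(c * d)) := by
    rw [← Real.exp_add]; ring_nf
  have h3 := mul_le_mul_of_nonneg_left h1 (mul_nonneg hD (Real.exp_pos (-(c * s))).le)
  rw [h2]
  linarith

set_option maxHeartbeats 1000000 in
theorem exists_eps_upper (S : Setting n (m + 1)) {u₀ : Fin (m + 1) → Euc n → ℝ}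
    (huc : ∀ k, UniformContinuous (u₀ k)) {B : ℝ} (hB : ∀ k x, |u₀ k x| ≤ B) {T η : ℝ}
    (hT : 0 < T) (hη : 0 < η) : ∃ K C, 0 < K ∧ 0 < C ∧ ∀ ω ε u, 0 < ε → ε ≤ 1 →
      IsEpsSoln S ε ω u₀ u → ∀ k j x t, 0 ≤ t → t ≤ T →
        u k (x, t) ≤ u₀ j x + η + K * t + 2 * B * Real.exp (-(C / ε * t)) := by
  have hB0 : 0 ≤ B := (abs_nonneg _).trans (hB 0 0)
  obtain ⟨A, hA, hsig⟩ := S.exists_sigCol_bound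
  obtain ⟨K₀, hK₀, hbd⟩ := exists_eps_bound S hB
  obtain ⟨M, hM⟩ : ∃ M, M = B + K₀ * (T + 1) + 1 := ⟨_, rfl⟩
  have hM0 : 0 < M := by
    have := mul_pos hK₀ (by linarith : 0 < T + 1)
    linarith
  obtain ⟨C₁, C₂, C₃, hC₁, hC₂, hC₃, hcoer⟩ := S.coercive M hM0
  obtain ⟨Q, hQ, hmod⟩ := exists_quadratic_modulus huc hB hη
  refine ⟨C₃ + 2 * Q * A + 1, C₂, by
    have := mul_pos hQ hA
    linarith, hC₂, fun ω ε u hε hε1 hu k j x t ht htT => ?_⟩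
  obtain ⟨K, hK⟩ : ∃ K, K = C₃ + 2 * Q * A + 1 := ⟨_, rfl⟩
  rw [← hK]
  obtain ⟨D, hD⟩ : ∃ D : Fin (m + 1) → ℝ, D = fun i => if i = j then 0 else 2 * B := ⟨_, rfl⟩
  have hDj : D j = 0 := by rw [hD]; simp
  have hDi : ∀ i, i ≠ j → D i = 2 * B := fun i hi => by rw [hD]; simp [hi]
  have hD0 : ∀ i, 0 ≤ D i := fun i => by
    by_cases hi : i = j
    · rw [hi, hDj]
    · rw [hDi i hi]; linarith
  have hDB : ∀ i, D i ≤ 2 * B := fun i => by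
    by_cases hi : i = j
    · rw [hi, hDj]; linarith
    · rw [hDi i hi]
  have hM' : ∀ k z, 0 ≤ z.snd → z.snd ≤ T + 1 → |onSpT (u k) z| ≤ M := fun k z h0 h1 => by
    have h2 : |onSpT (u k) z| ≤ B + K₀ * z.snd := hbd ω ε u hε hε1 hu k z.fst z.snd h0
    have := mul_le_mul_of_nonneg_left h1 hK₀.le
    linarith
  have hu' := hu
  obtain ⟨hcont, -, hsub, -, hini⟩ := hu'
  have hQA : 2 * Q * (ε * A) ≤ 2 * Q * A := by
    have := mul_le_mul_of_nonneg_right hε1 (mul_nonneg hQ.le hA.le)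
    linarith
  have key := eps_barrier (S := S) (ω := ω) (T := T) (B := M) hε hQ (fun k => (hsig k ω).1)
      (fun k => continuous_onSpT (hcont k)) (fun k => eps_jsub hε hsub k) (x₀ := x)
      (a := fun i s => u₀ j x + η + K * s + D i * Real.exp (-(C₂ / ε * s)))
      (a' := fun i s => K - D i * (C₂ / ε) * Real.exp (-(C₂ / ε * s)))
      (fun i => by fun_prop)
      (fun i s _ => ⟨D i * Real.exp (-(C₂ / ε * s)) * (C₂ / ε) ^ 2, by
        filter_upwards [eventually_exp_le (D i) (C₂ / ε) s (hD0 i)] with d hd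
        linarith⟩)
      (fun k z h0 h1 => (le_abs_self _).trans (hM' k z h0 h1))
      (fun i y => by
        change u i (y, 0) ≤ _
        rw [hini, mul_zero, mul_zero, neg_zero, Real.exp_zero]
        by_cases hi : i = j
        · rw [hi]
          linarith [hmod j y x, hD0 j]
        · have := mul_nonneg hQ.le (sq_nonneg ‖y - x‖)
          rw [hDi i hi]
          linarith [(_root_.abs_le.1 (hB i y)).2, (_root_.abs_le.1 (hB j x)).1])
      (fun i z b h0 h1 hmax hpos hb => by
        have hr : ‖fun l => onSpT (u l) z‖ ≤ M :=
          (pi_norm_le_iff_of_nonneg hM0.le).2 fun l => hM' l z h0.le h1.le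
        have e1 := hcoer i ((2 * Q) • (z.fst - x)) (fun l => onSpT (u l) z)
          (fun l => (onSpT (u i) z - onSpT (u l) z) / ε) (ε⁻¹ • z.fst) ω hr
        have e2 : 0 ≤ C₁ * ‖(2 * Q) • (z.fst - x)‖ ^ S.γ i :=
          mul_nonneg hC₁.le (Real.rpow_nonneg (norm_nonneg _) _)
        have e3 : D i * (C₂ / ε) * Real.exp (-(C₂ / ε * z.snd)) ≤
            C₂ * posMaxOff i fun l => (onSpT (u i) z - onSpT (u l) z) / ε := by
          by_cases hi : i = j
          · rw [hi, hDj, zero_mul, zero_mul]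
            exact mul_nonneg hC₂.le (posMaxOff_nonneg _ _)
          · refine le_trans ?_ (mul_le_mul_of_nonneg_left (le_posMaxOff (Ne.symm hi) _) hC₂.le)
            have h2 := hmax j
            rw [hDj, zero_mul] at h2
            have h3 : D i * Real.exp (-(C₂ / ε * z.snd)) ≤ onSpT (u i) z - onSpT (u j) z := by
              linarith
            have h4 := mul_le_mul_of_nonneg_left h3 (div_pos hC₂ hε).le
            calc _ = C₂ / ε * (D i * Real.exp (-(C₂ / ε * z.snd))) := by ring
              _ ≤ _ := h4
              _ = _ := by ring
        change 2 * Q * (ε * A) < b + S.H i ((2 * Q) • (z.fst - x)) _ _ _ ω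
        linarith) k t ht htT
  have e1 : u k (x, t) ≤ u₀ j x + η + K * t + D k * Real.exp (-(C₂ / ε * t)) := key
  have := mul_le_mul_of_nonneg_right (hDB k) (Real.exp_pos (-(C₂ / ε * t))).le
  linarith

set_option maxHeartbeats 1000000 in
theorem exists_eps_lower (S : Setting n (m + 1)) {u₀ : Fin (m + 1) → Euc n → ℝ}
    (huc : ∀ k, UniformContinuous (u₀ k)) {B : ℝ} (hB : ∀ k x, |u₀ k x| ≤ B) {T η : ℝ}
    (hT : 0 < T) (hη : 0 < η) : ∃ K, 0 < K ∧ ∀ ω ε u, 0 < ε → ε ≤ 1 →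
      IsEpsSoln S ε ω u₀ u → ∀ k x t c, 0 ≤ t → t ≤ T → (∀ j, c ≤ u₀ j x) →
        c - η - K * t ≤ u k (x, t) := by
  have hB0 : 0 ≤ B := (abs_nonneg _).trans (hB 0 0)
  obtain ⟨A, hA, hsig⟩ := S.exists_sigCol_bound
  obtain ⟨K₀, hK₀, hbd⟩ := exists_eps_bound S hB
  obtain ⟨M, hM⟩ : ∃ M, M = B + K₀ * (T + 1) + 1 := ⟨_, rfl⟩
  have hM0 : 0 < M := by
    have := mul_pos hK₀ (by linarith : 0 < T + 1)
    linarith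
  obtain ⟨Q, hQ, hmod⟩ := exists_quadratic_modulus huc hB hη
  obtain ⟨C, hC, hHle⟩ := S.exists_H_le M 0 (4 * Q * (M + (B + η)) + 1)
  refine ⟨C + 2 * Q * A + 1, by
    have := mul_pos hQ hA
    linarith, fun ω ε u hε hε1 hu k x t c ht htT hc => ?_⟩
  have hcB := (hc 0).trans ((le_abs_self _).trans (hB 0 x))
  obtain ⟨K, hK⟩ : ∃ K, K = C + 2 * Q * A + 1 := ⟨_, rfl⟩
  have hK0 : 0 < K := by
    have := mul_pos hQ hA
    linarith
  rw [← hK]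
  have hM' : ∀ k z, 0 ≤ z.snd → z.snd ≤ T + 1 → |onSpT (u k) z| ≤ M := fun k z h0 h1 => by
    have h2 : |onSpT (u k) z| ≤ B + K₀ * z.snd := hbd ω ε u hε hε1 hu k z.fst z.snd h0
    have := mul_le_mul_of_nonneg_left h1 hK₀.le
    linarith
  have hu' := hu
  obtain ⟨hcont, -, -, hsup, hini⟩ := hu'
  have hQA : 2 * Q * (ε * A) ≤ 2 * Q * A := by
    have := mul_le_mul_of_nonneg_right hε1 (mul_nonneg hQ.le hA.le)
    linarith
  have key := eps_barrier (S := S) (ω := ω) (T := T) (B := M) hε hQ (fun k => (hsig k ω).1)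
      (W := fun k z => -onSpT (u k) z)
      (fun k => (continuous_onSpT (hcont k)).neg) (fun k => (eps_jsup hε hsup k).neg) (x₀ := x)
      (a := fun _ s => -c + η + K * s) (a' := fun _ _ => K) (fun i => by fun_prop)
      (fun i s _ => ⟨0, Eventually.of_forall fun d => by linarith⟩)
      (fun k z h0 h1 => (neg_le_abs _).trans (hM' k z h0 h1))
      (fun i y => by
        change -u i (y, 0) ≤ _
        rw [hini, mul_zero]
        have := hmod i x y
        rw [norm_sub_rev] at this
        linarith [hc i])
      (fun i z b h0 h1 hmax hpos hb => by
        have hr : ‖fun l => onSpT (u l) z‖ ≤ M :=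
          (pi_norm_le_iff_of_nonneg hM0.le).2 fun l => hM' l z h0.le h1.le
        have hKz := mul_pos hK0 h0
        have e3 := hHle i (-((2 * Q) • (z.fst - x))) (fun l => onSpT (u l) z)
          (fun l => (onSpT (u i) z - onSpT (u l) z) / ε) (ε⁻¹ • z.fst) ω
          (by
            rw [norm_neg]
            refine norm_two_smul_le hQ ?_
            linarith [(neg_le_abs _).trans (hM' i z h0.le h1.le)]) hr
          (fun l => div_nonpos_of_nonpos_of_nonneg (by linarith [hmax l]) hε.le)
        change 2 * Q * (ε * A) < -(-b + S.H i (-((2 * Q) • (z.fst - x))) _ _ _ ω)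
        linarith) k t ht htT
  have e1 : -u k (x, t) ≤ -c + η + K * t := key
  linarith

end Estimates

section Comparison

open scoped RealInnerProductSpace

variable {n m : ℕ}

theorem sq_norm_add_sub (z w d : SpT n) :
    ‖z + d - w‖ ^ 2 = ‖z - w‖ ^ 2 + 2 * ⟪z - w, d⟫ + ‖d‖ ^ 2 := by
  rw [← norm_add_sq_real]
  congr 2
  abel

theorem norm_snd_sq_le (d : SpT n) : d.snd ^ 2 ≤ ‖d‖ ^ 2 := by
  rw [norm_sq_eq, Real.norm_eq_abs, sq_abs]
  linarith [sq_nonneg ‖d.fst‖]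

theorem norm_fst_sq_le (d : SpT n) : ‖d.fst‖ ^ 2 ≤ ‖d‖ ^ 2 := by
  rw [norm_sq_eq]
  linarith [sq_nonneg ‖d.snd‖]

theorem exists_max_doubled {U V : SpT n → ℝ} {K : Set (SpT n)} (hK : IsCompact K)
    (hne : K.Nonempty) (hU : ∀ z ∈ K, ∀ c, U z < c → ∀ᶠ z' in 𝓝 z, U z' ≤ c)
    (hV : ∀ z ∈ K, ∀ c, c < V z → ∀ᶠ z' in 𝓝 z, c ≤ V z') {f : SpT n × SpT n → ℝ}
    (hf : Continuous f) :
    ∃ z ∈ K, ∃ w ∈ K, ∀ z' ∈ K, ∀ w' ∈ K, U z' - V w' - f (z', w') ≤ U z - V w - f (z, w) := by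
  have husc : UpperSemicontinuousOn (fun q : SpT n × SpT n => U q.1 - V q.2 - f q) (K ×ˢ K) := by
    rintro ⟨z, w⟩ ⟨hz, hw⟩ c hc
    obtain ⟨e, he⟩ : ∃ e, e = (c - (U z - V w - f (z, w))) / 4 := ⟨_, rfl⟩
    have he0 : 0 < e := by
      change U z - V w - f (z, w) < c at hc
      linarith
    have h1 := (continuous_fst.tendsto (z, w)).eventually (hU z hz (U z + e) (by linarith))
    have h2 := (continuous_snd.tendsto (z, w)).eventually (hV w hw (V w - e) (by linarith))
    have h3 := (hf.tendsto (z, w)).eventually (Ioi_mem_nhds (by linarith : f (z, w) - e < f (z, w)))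
    refine Filter.Eventually.filter_mono nhdsWithin_le_nhds ?_
    filter_upwards [h1, h2, h3] with q h1 h2 h3
    have h3' : f (z, w) - e < f q := h3
    linarith
  obtain ⟨⟨z, w⟩, ⟨hz, hw⟩, hmax⟩ := husc.exists_isMaxOn (hne.prod hne) (hK.prod hK)
  exact ⟨z, hz, w, hw, fun z' hz' w' hw' => hmax (⟨hz', hw'⟩ : (z', w') ∈ K ×ˢ K)⟩

set_option maxHeartbeats 2000000 in
/-- Comparison principle for the effective equation. -/
theorem jet1_comparison {Hb : Euc n → ℝ → ℝ}
    (hHb : ∀ R, 0 < R → ∃ C, 0 < C ∧ ∀ p p' r r' η, ‖p‖ ≤ R → |r| ≤ R → r ≤ r' →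
      ‖p' - p‖ < η → η ≤ 1 → Hb p r ≤ Hb p' r' + C * η) {U V : SpT n → ℝ}
    (hU : ∀ z, 0 < z.snd → ∀ c, U z < c → ∀ᶠ z' in 𝓝 z, U z' ≤ c)
    (hV : ∀ z, 0 < z.snd → ∀ c, c < V z → ∀ᶠ z' in 𝓝 z, c ≤ V z')
    (hbd : ∀ T, ∃ B, ∀ z, 0 < z.snd → z.snd ≤ T → |U z| ≤ B ∧ |V z| ≤ B)
    (hsub : Jet1Sub Hb U) (hsup : Jet1Sup Hb V) {g : Euc n → ℝ} {d : ℝ} (hd : 0 ≤ d)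
    (hg : ∀ η, 0 < η → ∃ Q, 0 < Q ∧ ∀ x y, g x ≤ g y + η + Q * ‖x - y‖ ^ 2)
    (hini : ∀ η, 0 < η → ∃ K, 0 < K ∧ ∀ z, 0 < z.snd → z.snd ≤ 1 →
      U z ≤ g z.fst + d + η + K * z.snd ∧ g z.fst - η - K * z.snd ≤ V z)
    {z : SpT n} (hz : 0 < z.snd) : U z ≤ V z + d := by
  by_contra! hbad
  obtain ⟨T, hT⟩ : ∃ T, T = z.snd := ⟨_, rfl⟩
  have hT0 : 0 < T := hT ▸ hz
  obtain ⟨θ, hθ⟩ : ∃ θ, θ = U z - V z - d := ⟨_, rfl⟩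
  have hθ0 : 0 < θ := by linarith
  obtain ⟨B, hB⟩ := hbd (T + 1)
  have hB0 : 0 ≤ B := (abs_nonneg _).trans (hB z hz (by linarith)).1
  obtain ⟨K, hK, hKini⟩ := hini (θ / 16) (by linarith)
  obtain ⟨Q, hQ, hQg⟩ := hg (θ / 16) (by linarith)
  obtain ⟨τ, hτ⟩ : ∃ τ, τ = min (θ / (4 * K)) (min T 1) := ⟨_, rfl⟩
  have hτ0 : 0 < τ := hτ ▸ lt_min (div_pos hθ0 (by linarith)) (lt_min hT0 one_pos)
  have hτT : τ ≤ T := hτ ▸ (min_le_right _ _).trans (min_le_left _ _)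
  have hτ1 : τ ≤ 1 := hτ ▸ (min_le_right _ _).trans (min_le_right _ _)
  have hKτ : K * τ ≤ θ / 4 := by
    have := mul_le_mul_of_nonneg_left (hτ ▸ min_le_left (θ / (4 * K)) (min T 1) : τ ≤ θ / (4 * K)) hK.le
    rwa [show K * (θ / (4 * K)) = θ / 4 by field_simp] at this
  obtain ⟨a, ha⟩ : ∃ a, a = Q + (2 * B + 1) / (τ / 2) ^ 2 := ⟨_, rfl⟩
  have hτ2 : 0 < (τ / 2) ^ 2 := pow_pos (by linarith) 2
  have haQ : Q ≤ a := by
    have := div_pos (by linarith : 0 < 2 * B + 1) hτ2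
    linarith
  have ha0 : 0 < a := hQ.trans_le haQ
  have haτ : 2 * B + 1 ≤ a * (τ / 2) ^ 2 := by
    rw [ha, add_mul, div_mul_cancel₀ _ hτ2.ne']
    linarith [mul_pos hQ hτ2]
  obtain ⟨σ, hσ⟩ : ∃ σ, σ = θ / (8 * (T + 1)) := ⟨_, rfl⟩
  have hσ0 : 0 < σ := hσ ▸ div_pos hθ0 (by linarith)
  have hσT : σ * T ≤ θ / 8 := by
    have : σ * (T + 1) = θ / 8 := by rw [hσ]; field_simp
    linarith
  obtain ⟨C, hC, hCHb⟩ := hHb (2 * a * (τ / 2) + B + 1) (by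
    have := mul_pos ha0 hτ0
    linarith)
  obtain ⟨e, he⟩ : ∃ e, e = min 1 (σ / (2 * C)) := ⟨_, rfl⟩
  have he0 : 0 < e := he ▸ lt_min one_pos (div_pos hσ0 (by linarith))
  have he1 : e ≤ 1 := he ▸ min_le_left _ _
  have heC : C * e ≤ σ / 2 := by
    have := mul_le_mul_of_nonneg_left (he ▸ min_le_right 1 (σ / (2 * C)) : e ≤ σ / (2 * C)) hC.le
    rwa [show C * (σ / (2 * C)) = σ / 2 by field_simp] at this
  obtain ⟨κ, hκ, hκz, hκe⟩ : ∃ κ, 0 < κ ∧ κ * ‖z.fst‖ ^ 2 ≤ θ / 8 ∧ 4 * κ * (2 * B) < e ^ 2 := by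
    have h1 : 0 < ‖z.fst‖ ^ 2 + 1 := by linarith [sq_nonneg ‖z.fst‖]
    have h2 : 0 < 8 * B + 1 := by linarith
    have h3 : 0 < e ^ 2 := pow_pos he0 2
    refine ⟨min (θ / 8 / (‖z.fst‖ ^ 2 + 1)) (e ^ 2 / 2 / (8 * B + 1)),
      lt_min (div_pos (by linarith) h1) (div_pos (by linarith) h2), ?_, ?_⟩
    · have h4 := mul_le_mul_of_nonneg_right (min_le_left (θ / 8 / (‖z.fst‖ ^ 2 + 1))
        (e ^ 2 / 2 / (8 * B + 1))) h1.le
      rw [div_mul_cancel₀ _ h1.ne'] at h4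
      have h5 : 0 < min (θ / 8 / (‖z.fst‖ ^ 2 + 1)) (e ^ 2 / 2 / (8 * B + 1)) :=
        lt_min (div_pos (by linarith) h1) (div_pos (by linarith) h2)
      linarith
    · have h4 := mul_le_mul_of_nonneg_right (min_le_right (θ / 8 / (‖z.fst‖ ^ 2 + 1))
        (e ^ 2 / 2 / (8 * B + 1))) h2.le
      rw [div_mul_cancel₀ _ h2.ne'] at h4
      have h5 : 0 < min (θ / 8 / (‖z.fst‖ ^ 2 + 1)) (e ^ 2 / 2 / (8 * B + 1)) :=
        lt_min (div_pos (by linarith) h1) (div_pos (by linarith) h2)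
      linarith
  obtain ⟨N, hN⟩ : ∃ N, N = 2 * B + 1 := ⟨_, rfl⟩
  have hN0 : 0 < N := by linarith
  obtain ⟨f, hf⟩ : ∃ f : SpT n × SpT n → ℝ, f = fun q => a * ‖q.1 - q.2‖ ^ 2 + σ * q.1.snd +
      κ * ‖q.1.fst‖ ^ 2 + N * (max (q.1.snd - T) 0) ^ 2 + N * (max (q.2.snd - T) 0) ^ 2 := ⟨_, rfl⟩
  have hfc : Continuous f := by
    rw [hf]
    have h1 : Continuous fun q : SpT n × SpT n => q.1.snd := continuous_snd'.comp continuous_fst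
    have h2 : Continuous fun q : SpT n × SpT n => q.2.snd := continuous_snd'.comp continuous_snd
    have h3 : Continuous fun q : SpT n × SpT n => q.1.fst := continuous_fst'.comp continuous_fst
    fun_prop
  have hfz : ∀ z' w', f (z', w') = a * ‖z' - w'‖ ^ 2 + σ * z'.snd + κ * ‖z'.fst‖ ^ 2 +
      N * (max (z'.snd - T) 0) ^ 2 + N * (max (w'.snd - T) 0) ^ 2 := fun z' w' => by rw [hf]
  -- points at which the doubled function is large stay in a compact set
  have hlarge : ∀ z' w', 0 < z'.snd → z'.snd ≤ T + 1 → 0 < w'.snd → w'.snd ≤ T + 1 →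
      d + θ / 2 < U z' - V w' - f (z', w') →
      τ / 4 ≤ z'.snd ∧ τ / 4 ≤ w'.snd ∧ z'.snd < T + 1 ∧ w'.snd < T + 1 ∧ ‖z' - w'‖ ≤ τ / 2 ∧
        κ * ‖z'.fst‖ ^ 2 ≤ 2 * B ∧ V w' ≤ U z' := by
    intro z' w' hz0 hz1 hw0 hw1 hlt
    rw [hfz] at hlt
    have p1 := mul_nonneg ha0.le (sq_nonneg ‖z' - w'‖)
    have p2 := mul_pos hσ0 hz0
    have p3 := mul_nonneg hκ.le (sq_nonneg ‖z'.fst‖)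
    have p4 := mul_nonneg hN0.le (sq_nonneg (max (z'.snd - T) 0))
    have p5 := mul_nonneg hN0.le (sq_nonneg (max (w'.snd - T) 0))
    have b1 := (_root_.abs_le.1 (hB z' hz0 hz1).1).2
    have b2 := (_root_.abs_le.1 (hB w' hw0 hw1).2).1
    have hzw : ‖z' - w'‖ ≤ τ / 2 := by
      by_contra! h
      have h1 := mul_le_mul_of_nonneg_left (pow_le_pow_left₀ (by linarith) h.le 2) ha0.le
      linarith
    have hts : |z'.snd - w'.snd| ≤ τ / 2 := by
      have := norm_snd_le' (z' - w')
      rw [Real.norm_eq_abs] at this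
      exact this.trans hzw
    have hsum : τ < z'.snd + w'.snd := by
      by_contra! h
      have h1 := (hKini z' hz0 (by linarith)).1
      have h2 := (hKini w' hw0 (by linarith)).2
      have h3 := hQg z'.fst w'.fst
      have h4 : ‖z'.fst - w'.fst‖ ^ 2 ≤ ‖z' - w'‖ ^ 2 := norm_fst_sq_le (z' - w')
      have h5 := mul_le_mul haQ h4 (sq_nonneg _) ha0.le
      have h6 := mul_le_mul_of_nonneg_left h hK.le
      linarith
    have habs := _root_.abs_le.1 hts
    refine ⟨by linarith, by linarith, ?_, ?_, hzw, by linarith, by linarith⟩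
    · refine hz1.lt_of_ne fun h => ?_
      rw [h, add_sub_cancel_left, max_eq_left zero_le_one] at hlt
      rw [h] at p2
      linarith
    · refine hw1.lt_of_ne fun h => ?_
      rw [h, add_sub_cancel_left, max_eq_left zero_le_one] at hlt
      linarith
  have hstar : d + θ / 2 < U z - V z - f (z, z) := by
    rw [hfz, sub_self, norm_zero, ← hT, sub_self, max_self]
    linarith
  obtain ⟨ρ, hρ⟩ : ∃ ρ, ρ = ‖z‖ + (2 * B / κ + 1) + (T + 1) + τ / 2 := ⟨_, rfl⟩
  have hBκ : 0 ≤ 2 * B / κ := div_nonneg (by linarith) hκ.le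
  obtain ⟨Kc, hKc⟩ : ∃ Kc : Set (SpT n), Kc = {w | τ / 4 ≤ w.snd ∧ w.snd ≤ T + 1} ∩
      Metric.closedBall 0 ρ := ⟨_, rfl⟩
  have hmemK : ∀ w, w ∈ Kc ↔ (τ / 4 ≤ w.snd ∧ w.snd ≤ T + 1) ∧ ‖w‖ ≤ ρ := fun w => by
    rw [hKc]; simp
  have hcomp : IsCompact Kc := by
    rw [hKc]
    exact (isCompact_closedBall (0 : SpT n) ρ).inter_left
      ((isClosed_le continuous_const continuous_snd').inter
        (isClosed_le continuous_snd' continuous_const))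
  have hzK : z ∈ Kc := (hmemK z).2 ⟨⟨by linarith, by linarith⟩, by linarith⟩
  obtain ⟨z₁, hz₁, w₁, hw₁, hmaxK⟩ := exists_max_doubled hcomp ⟨z, hzK⟩
    (fun w hw => hU w (by linarith [((hmemK w).1 hw).1.1]))
    (fun w hw => hV w (by linarith [((hmemK w).1 hw).1.1])) hfc
  have hlt₁ := hstar.trans_le (hmaxK z hzK z hzK)
  have hmax : ∀ z' w', 0 < z'.snd → z'.snd ≤ T + 1 → 0 < w'.snd → w'.snd ≤ T + 1 →
      U z' - V w' - f (z', w') ≤ U z₁ - V w₁ - f (z₁, w₁) := by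
    intro z' w' hz0 hz1 hw0 hw1
    by_contra! hlt
    obtain ⟨c1, c2, -, -, c5, c6, -⟩ := hlarge z' w' hz0 hz1 hw0 hw1 (hlt₁.trans hlt)
    have h1 : ‖z'.fst‖ ≤ 2 * B / κ + 1 := by
      by_contra! h
      have h2 : 2 * B / κ + 1 ≤ ‖z'.fst‖ ^ 2 := by nlinarith
      have h3 := mul_le_mul_of_nonneg_left h2 hκ.le
      rw [mul_add, mul_div_cancel₀ _ hκ.ne'] at h3
      linarith
    have h2 := norm_le_fst_add_snd z'
    rw [abs_of_pos hz0] at h2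
    have h3 : ‖w'‖ ≤ ‖z'‖ + ‖z' - w'‖ := by
      have := norm_sub_le z' (z' - w')
      rwa [sub_sub_cancel] at this
    have hz00 := norm_nonneg z
    exact absurd (hmaxK z' ((hmemK z').2 ⟨⟨c1, hz1⟩, by linarith⟩) w'
      ((hmemK w').2 ⟨⟨c2, hw1⟩, by linarith⟩)) (not_le.2 hlt)
  have hz₁0 : 0 < z₁.snd := by linarith [((hmemK z₁).1 hz₁).1.1]
  have hw₁0 : 0 < w₁.snd := by linarith [((hmemK w₁).1 hw₁).1.1]
  obtain ⟨-, -, hzT, hwT, hzw, hκ₁, hVU⟩ := hlarge z₁ w₁ hz₁0 ((hmemK z₁).1 hz₁).1.2 hw₁0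
    ((hmemK w₁).1 hw₁).1.2 hlt₁
  have hnear : ∀ y : SpT n, 0 < y.snd → y.snd < T + 1 →
      ∀ᶠ h in 𝓝 (0 : SpT n), 0 < (y + h).snd ∧ (y + h).snd ≤ T + 1 := fun y h0 h1 => by
    have h2 : Tendsto (fun h : SpT n => (y + h).snd) (𝓝 0) (𝓝 y.snd) :=
      (continuous_snd'.comp (continuous_const.add continuous_id)).tendsto' _ _ (by simp)
    filter_upwards [h2.eventually (Ioo_mem_nhds h0 h1)] with h hh
    exact ⟨hh.1, hh.2.le⟩
  have hsub₁ := hsub z₁ hz₁0 ((2 * a) • (z₁ - w₁) + pr ((2 * κ) • z₁.fst)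
      (σ + N * (2 * max (z₁.snd - T) 0))) (a + κ + N) (by
    filter_upwards [hnear z₁ hz₁0 hzT] with h hh
    have h1 := hmax (z₁ + h) w₁ hh.1 hh.2 hw₁0 hwT.le
    rw [hfz, hfz, sq_norm_add_sub] at h1
    have h2 := sq_posPart_add_le (z₁.snd - T) h.snd
    rw [show z₁.snd - T + h.snd = (z₁ + h).snd - T by rw [WithLp.add_snd]; ring] at h2
    have h3 := mul_le_mul_of_nonneg_left h2 hN0.le
    have h4 : ‖(z₁ + h).fst‖ ^ 2 = ‖z₁.fst‖ ^ 2 + 2 * ⟪z₁.fst, h.fst⟫ + ‖h.fst‖ ^ 2 := by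
      rw [← norm_add_sq_real]; rfl
    have h5 := mul_le_mul_of_nonneg_left (norm_snd_sq_le h) hN0.le
    have h6 := mul_le_mul_of_nonneg_left (norm_fst_sq_le h) hκ.le
    rw [h4, WithLp.add_snd] at h1
    rw [WithLp.add_snd] at h3
    rw [inner_add_left, real_inner_smul_left, inner_pr, real_inner_smul_left]
    simp only [RCLike.inner_apply, conj_trivial]
    linarith)
  have hsup₁ := hsup w₁ hw₁0 ((2 * a) • (z₁ - w₁) - pr 0 (N * (2 * max (w₁.snd - T) 0)))
      (a + N) (by
    filter_upwards [hnear w₁ hw₁0 hwT] with h hh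
    have h1 := hmax z₁ (w₁ + h) hz₁0 hzT.le hh.1 hh.2
    have h0 : ‖z₁ - (w₁ + h)‖ ^ 2 = ‖z₁ - w₁‖ ^ 2 - 2 * ⟪z₁ - w₁, h⟫ + ‖h‖ ^ 2 := by
      rw [← norm_sub_sq_real]
      congr 2
      abel
    rw [hfz, hfz, h0] at h1
    have h2 := sq_posPart_add_le (w₁.snd - T) h.snd
    rw [show w₁.snd - T + h.snd = (w₁ + h).snd - T by rw [WithLp.add_snd]; ring] at h2
    have h3 := mul_le_mul_of_nonneg_left h2 hN0.le
    have h5 := mul_le_mul_of_nonneg_left (norm_snd_sq_le h) hN0.le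
    rw [inner_sub_left, real_inner_smul_left, inner_pr, inner_zero_left]
    simp only [RCLike.inner_apply, conj_trivial]
    linarith)
  obtain ⟨p, hp⟩ : ∃ p : Euc n, p = (2 * a) • (z₁ - w₁).fst := ⟨_, rfl⟩
  have e1 : ((2 * a) • (z₁ - w₁) + pr ((2 * κ) • z₁.fst)
      (σ + N * (2 * max (z₁.snd - T) 0))).fst = p + (2 * κ) • z₁.fst := by rw [hp]; rfl
  have e2 : ((2 * a) • (z₁ - w₁) + pr ((2 * κ) • z₁.fst)
      (σ + N * (2 * max (z₁.snd - T) 0))).snd = 2 * a * (z₁ - w₁).snd +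
        (σ + N * (2 * max (z₁.snd - T) 0)) := rfl
  have e3 : ((2 * a) • (z₁ - w₁) - pr (0 : Euc n) (N * (2 * max (w₁.snd - T) 0))).fst = p := by
    rw [hp, ← sub_zero ((2 * a) • (z₁ - w₁).fst)]; rfl
  have e4 : ((2 * a) • (z₁ - w₁) - pr (0 : Euc n) (N * (2 * max (w₁.snd - T) 0))).snd =
      2 * a * (z₁ - w₁).snd - N * (2 * max (w₁.snd - T) 0) := rfl
  rw [e1, e2] at hsub₁
  rw [e3, e4] at hsup₁
  have hpR : ‖p‖ ≤ 2 * a * (τ / 2) + B + 1 := by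
    rw [hp, norm_smul, Real.norm_eq_abs, abs_of_pos (by linarith)]
    have := mul_le_mul_of_nonneg_left ((norm_fst_le' (z₁ - w₁)).trans hzw)
      (by linarith : 0 ≤ 2 * a)
    linarith
  have haτ0 := mul_pos ha0 hτ0
  have hVR : |V w₁| ≤ 2 * a * (τ / 2) + B + 1 := (hB w₁ hw₁0 hwT.le).2.trans (by linarith)
  have hke : ‖p + (2 * κ) • z₁.fst - p‖ < e := by
    rw [add_sub_cancel_left, norm_smul, Real.norm_eq_abs, abs_of_pos (by linarith)]
    refine lt_of_pow_lt_pow_left₀ 2 he0.le (lt_of_le_of_lt ?_ hκe)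
    have := mul_le_mul_of_nonneg_left hκ₁ (by linarith : 0 ≤ 4 * κ)
    linarith
  have hfin := hCHb p _ (V w₁) (U z₁) e hpR hVR hVU hke he1
  have n1 := mul_nonneg hN0.le (le_max_right (z₁.snd - T) 0)
  have n2 := mul_nonneg hN0.le (le_max_right (w₁.snd - T) 0)
  linarith

end Comparison

section Effective

open scoped RealInnerProductSpace

variable {n m : ℕ}

/-- Semicontinuous subsolutions of the effective equation which stay below the initial datum. -/
structure EffSub (Hb : Euc n → ℝ → ℝ) (g : Euc n → ℝ) (U : SpT n → ℝ) : Prop where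
  usc : ∀ z, 0 < z.snd → ∀ c, U z < c → ∀ᶠ z' in 𝓝 z, U z' ≤ c
  bdd : ∀ T, ∃ B, ∀ z, 0 < z.snd → z.snd ≤ T → |U z| ≤ B
  sub : Jet1Sub Hb U
  ini : ∀ T η, 0 < T → 0 < η → ∃ K, 0 < K ∧ ∀ z, 0 < z.snd → z.snd ≤ T →
    U z ≤ g z.fst + η + K * z.snd

/-- Semicontinuous supersolutions of the effective equation which stay above the initial datum. -/
structure EffSup (Hb : Euc n → ℝ → ℝ) (g : Euc n → ℝ) (V : SpT n → ℝ) : Prop where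
  lsc : ∀ z, 0 < z.snd → ∀ c, c < V z → ∀ᶠ z' in 𝓝 z, c ≤ V z'
  bdd : ∀ T, ∃ B, ∀ z, 0 < z.snd → z.snd ≤ T → |V z| ≤ B
  sup : Jet1Sup Hb V
  ini : ∀ T η, 0 < T → 0 < η → ∃ K, 0 < K ∧ ∀ z, 0 < z.snd → z.snd ≤ T →
    g z.fst - η - K * z.snd ≤ V z

/-- `H̄` is nondecreasing in `r` and locally Lipschitz in `p`. -/
def EffHam (Hb : Euc n → ℝ → ℝ) : Prop :=
  ∀ R, 0 < R → ∃ C, 0 < C ∧ ∀ p p' r r' η, ‖p‖ ≤ R → |r| ≤ R → r ≤ r' →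
    ‖p' - p‖ < η → η ≤ 1 → Hb p r ≤ Hb p' r' + C * η

/-- A modulus of continuity in quadratic form. -/
def QuadMod (g : Euc n → ℝ) : Prop :=
  ∀ η, 0 < η → ∃ Q, 0 < Q ∧ ∀ x y, g x ≤ g y + η + Q * ‖x - y‖ ^ 2

theorem EffSub.le {Hb : Euc n → ℝ → ℝ} (hHb : EffHam Hb) {g : Euc n → ℝ} (hg : QuadMod g)
    {U V : SpT n → ℝ} (hU : EffSub Hb g U) (hV : EffSup Hb g V) {z : SpT n} (hz : 0 < z.snd) :
    U z ≤ V z := by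
  have := jet1_comparison hHb hU.usc hV.lsc (fun T => by
      obtain ⟨B, hB⟩ := hU.bdd T
      obtain ⟨B', hB'⟩ := hV.bdd T
      exact ⟨max B B', fun z h0 h1 =>
        ⟨(hB z h0 h1).trans (le_max_left _ _), (hB' z h0 h1).trans (le_max_right _ _)⟩⟩)
    hU.sub hV.sup le_rfl hg (fun η hη => by
      obtain ⟨K, hK, h⟩ := hU.ini 1 η one_pos hη
      obtain ⟨K', hK', h'⟩ := hV.ini 1 η one_pos hη
      refine ⟨K + K', by linarith, fun z h0 h1 => ⟨?_, ?_⟩⟩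
      · linarith [h z h0 h1, mul_pos hK' h0]
      · linarith [h' z h0 h1, mul_pos hK h0]) hz
  linarith

theorem Jet1Sub.congr {Hb : Euc n → ℝ → ℝ} {U V : SpT n → ℝ} (h : Jet1Sub Hb U)
    (hUV : ∀ z, 0 < z.snd → V z = U z) : Jet1Sub Hb V := by
  intro z hz q C hX
  rw [hUV z hz]
  refine h z hz q C ?_
  have h0 : Tendsto (fun d : SpT n => z + d) (𝓝 0) (𝓝 z) :=
    (continuous_const.add continuous_id).tendsto' _ _ (add_zero z)
  filter_upwards [hX, h0.eventually (isOpen_upperHalf.mem_nhds hz)] with d hd hd'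
  rwa [hUV z hz, hUV _ hd'] at hd

theorem Jet1Sup.congr {Hb : Euc n → ℝ → ℝ} {U V : SpT n → ℝ} (h : Jet1Sup Hb U)
    (hUV : ∀ z, 0 < z.snd → V z = U z) : Jet1Sup Hb V := by
  intro z hz q C hX
  rw [hUV z hz]
  refine h z hz q C ?_
  have h0 : Tendsto (fun d : SpT n => z + d) (𝓝 0) (𝓝 z) :=
    (continuous_const.add continuous_id).tendsto' _ _ (add_zero z)
  filter_upwards [hX, h0.eventually (isOpen_upperHalf.mem_nhds hz)] with d hd hd'
  rwa [hUV z hz, hUV _ hd'] at hd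

theorem tendsto_add_right_nhds (a z : SpT n) : Tendsto (fun w => w + a) (𝓝 z) (𝓝 (z + a)) :=
  (continuous_id.add continuous_const).tendsto _

theorem Jet1Sub.translate {Hb : Euc n → ℝ → ℝ} {U : SpT n → ℝ} (h : Jet1Sub Hb U) {a : SpT n}
    (ha : 0 ≤ a.snd) : Jet1Sub Hb fun z => U (z + a) := by
  intro z hz q C hX
  refine h (z + a) (by rw [WithLp.add_snd]; linarith) q C ?_
  filter_upwards [hX] with d hd
  rwa [add_right_comm] at hd

theorem Jet1Sup.translate {Hb : Euc n → ℝ → ℝ} {U : SpT n → ℝ} (h : Jet1Sup Hb U) {a : SpT n}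
    (ha : 0 ≤ a.snd) : Jet1Sup Hb fun z => U (z + a) := by
  intro z hz q C hX
  refine h (z + a) (by rw [WithLp.add_snd]; linarith) q C ?_
  filter_upwards [hX] with d hd
  rwa [add_right_comm] at hd

/-- Comparison between a subsolution and a supersolution, each translated in space-time. -/
theorem EffSub.le_translate {Hb : Euc n → ℝ → ℝ} (hHb : EffHam Hb) {g g' : Euc n → ℝ}
    {U V : SpT n → ℝ} (hU : EffSub Hb g U) (hV : EffSup Hb g V) (hg' : QuadMod g') {a b : SpT n}
    (ha : 0 ≤ a.snd) (hb : 0 ≤ b.snd) {d : ℝ} (hd : 0 ≤ d)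
    (hini : ∀ η, 0 < η → ∃ K, 0 < K ∧ ∀ z : SpT n, 0 < z.snd → z.snd ≤ 1 →
      U (z + a) ≤ g' z.fst + d + η + K * z.snd ∧ g' z.fst - η - K * z.snd ≤ V (z + b))
    {z : SpT n} (hz : 0 < z.snd) : U (z + a) ≤ V (z + b) + d := by
  have hpos : ∀ {a z : SpT n}, 0 ≤ a.snd → 0 < z.snd → 0 < (z + a).snd := fun ha hz => by
    rw [WithLp.add_snd]; linarith
  refine jet1_comparison (U := fun z => U (z + a)) (V := fun z => V (z + b)) hHb
    (fun z hz c hc => (tendsto_add_right_nhds a z).eventually (hU.usc _ (hpos ha hz) c hc))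
    (fun z hz c hc => (tendsto_add_right_nhds b z).eventually (hV.lsc _ (hpos hb hz) c hc))
    (fun T => ?_) (hU.sub.translate ha) (hV.sup.translate hb) hd hg' hini hz
  obtain ⟨B, hB⟩ := hU.bdd (T + a.snd)
  obtain ⟨B', hB'⟩ := hV.bdd (T + b.snd)
  refine ⟨max B B', fun z h0 h1 => ⟨?_, ?_⟩⟩
  · exact (hB _ (hpos ha h0) (by rw [WithLp.add_snd]; linarith)).trans (le_max_left _ _)
  · exact (hB' _ (hpos hb h0) (by rw [WithLp.add_snd]; linarith)).trans (le_max_right _ _)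

end Effective

section EffectiveSolution

variable {n : ℕ}

theorem EffSup.congr {Hb : Euc n → ℝ → ℝ} {g : Euc n → ℝ} {U V : SpT n → ℝ}
    (h : EffSup Hb g U) (hUV : ∀ z, 0 < z.snd → V z = U z) : EffSup Hb g V where
  lsc z hz c hc := by
    filter_upwards [h.lsc z hz c (by rwa [← hUV z hz]), isOpen_upperHalf.mem_nhds hz] with w hw hw0
    rwa [hUV w hw0]
  bdd T := by
    obtain ⟨B, hB⟩ := h.bdd T
    exact ⟨B, fun z h0 h1 => by rw [hUV z h0]; exact hB z h0 h1⟩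
  sup := h.sup.congr hUV
  ini T η hT hη := by
    obtain ⟨K, hK, h⟩ := h.ini T η hT hη
    exact ⟨K, hK, fun z h0 h1 => by rw [hUV z h0]; exact h z h0 h1⟩

theorem QuadMod.sub_const {g : Euc n → ℝ} (hg : QuadMod g) (c : ℝ) : QuadMod fun x => g x - c := by
  intro η hη
  obtain ⟨Q, hQ, h⟩ := hg η hη
  exact ⟨Q, hQ, fun x y => by linarith [h x y]⟩

theorem QuadMod.exists_delta {g : Euc n → ℝ} (hg : QuadMod g) {η : ℝ} (hη : 0 < η) :
    ∃ δ, 0 < δ ∧ ∀ x y, ‖x - y‖ ≤ δ → g x ≤ g y + η := by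
  obtain ⟨Q, hQ, h⟩ := hg (η / 2) (by linarith)
  refine ⟨√(η / (2 * Q)), Real.sqrt_pos.2 (by positivity), fun x y hxy => ?_⟩
  have h1 : ‖x - y‖ ^ 2 ≤ η / (2 * Q) := by
    rw [← Real.sq_sqrt (show 0 ≤ η / (2 * Q) by positivity)]
    exact pow_le_pow_left₀ (norm_nonneg _) hxy 2
  have h2 : Q * ‖x - y‖ ^ 2 ≤ η / 2 := by
    refine (mul_le_mul_of_nonneg_left h1 hQ.le).trans_eq ?_
    field_simp
  linarith [h x y]

theorem effSoln_le_add_space {Hb : Euc n → ℝ → ℝ} (hHb : EffHam Hb) {g : Euc n → ℝ}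
    (hg : QuadMod g) {U : SpT n → ℝ} (hU : EffSub Hb g U) (hV : EffSup Hb g U) {h : Euc n} {d : ℝ}
    (hd : 0 ≤ d) (hgd : ∀ x, g (x + h) ≤ g x + d) {z : SpT n} (hz : 0 < z.snd) :
    U (z + pr h 0) ≤ U z + d := by
  have := hU.le_translate hHb hV hg (a := pr h 0) (b := 0) le_rfl le_rfl hd (fun η hη => by
    obtain ⟨K, hK, hK'⟩ := hU.ini 1 η one_pos hη
    obtain ⟨L, hL, hL'⟩ := hV.ini 1 η one_pos hη
    refine ⟨K + L, by linarith, fun z h0 h1 => ⟨?_, ?_⟩⟩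
    · have e1 : (z + pr h 0).snd = z.snd := by rw [WithLp.add_snd, pr_snd, add_zero]
      have e2 : (z + pr h 0).fst = z.fst + h := by rw [WithLp.add_fst, pr_fst]
      have := hK' (z + pr h 0) (by rwa [e1]) (by rwa [e1])
      rw [e1, e2] at this
      linarith [hgd z.fst, mul_pos hL h0]
    · rw [add_zero]
      linarith [hL' z h0 h1, mul_pos hK h0]) hz
  rwa [add_zero] at this

theorem effSoln_time_modulus {Hb : Euc n → ℝ → ℝ} (hHb : EffHam Hb) {g : Euc n → ℝ}
    (hg : QuadMod g) {U : SpT n → ℝ} (hU : EffSub Hb g U) (hV : EffSup Hb g U) {η : ℝ}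
    (hη : 0 < η) : ∃ K, 0 < K ∧
      (∀ τ z, 0 ≤ τ → τ ≤ 1 → 0 < z.snd → |U (z + pr 0 τ) - U z| ≤ η + K * τ) ∧
      ∀ z, 0 < z.snd → z.snd ≤ 1 → |U z - g z.fst| ≤ η + K * z.snd := by
  obtain ⟨K, hK, hK'⟩ := hU.ini 2 η two_pos hη
  obtain ⟨L, hL, hL'⟩ := hV.ini 2 η two_pos hη
  refine ⟨K + L, by linarith, fun τ z hτ0 hτ1 hz => ?_, fun z h0 h1 => ?_⟩
  · have e1 : ∀ z : SpT n, (z + pr 0 τ).snd = z.snd + τ := fun z => by rw [WithLp.add_snd, pr_snd]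
    have e2 : ∀ z : SpT n, (z + pr 0 τ).fst = z.fst := fun z => by
      rw [WithLp.add_fst, pr_fst, add_zero]
    have hKτ : 0 ≤ K * τ := by positivity
    have hLτ : 0 ≤ L * τ := by positivity
    have h1 := hU.le_translate hHb hV hg (a := pr 0 τ) (b := 0) (d := η + K * τ) hτ0 le_rfl
      (by positivity) (fun η' hη' => by
        obtain ⟨L', hL', hV'⟩ := hV.ini 1 η' one_pos hη'
        refine ⟨K + L', by linarith, fun z h0 h1 => ⟨?_, ?_⟩⟩
        · have := hK' (z + pr 0 τ) (by rw [e1]; linarith) (by rw [e1]; linarith)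
          rw [e1, e2] at this
          linarith [mul_pos hL' h0]
        · rw [add_zero]
          linarith [hV' z h0 h1, mul_pos hK h0]) hz
    have h2 := hU.le_translate hHb hV (hg.sub_const (η + L * τ)) (a := 0) (b := pr 0 τ)
      (d := η + L * τ) le_rfl hτ0 (by positivity) (fun η' hη' => by
        obtain ⟨K', hK', hU'⟩ := hU.ini 1 η' one_pos hη'
        refine ⟨K' + L, by linarith, fun z h0 h1 => ⟨?_, ?_⟩⟩
        · rw [add_zero]
          linarith [hU' z h0 h1, mul_pos hL h0]
        · have := hL' (z + pr 0 τ) (by rw [e1]; linarith) (by rw [e1]; linarith)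
          rw [e1, e2] at this
          linarith [mul_pos hK' h0]) hz
    rw [add_zero] at h1 h2
    rw [_root_.abs_le]
    constructor <;> linarith
  · have h2 := hK' z h0 (by linarith)
    have h3 := hL' z h0 (by linarith)
    have h4 := mul_pos hK h0
    have h5 := mul_pos hL h0
    rw [_root_.abs_le]
    constructor <;> linarith

open Classical in
/-- Extension of a function on `{t > 0}` by its initial datum. -/
def withInitial (g : Euc n → ℝ) (U : SpT n → ℝ) (w : Euc n × ℝ) : ℝ :=
  if 0 < w.2 then U (pr w.1 w.2) else g w.1

theorem withInitial_of_pos (g : Euc n → ℝ) (U : SpT n → ℝ) {w : Euc n × ℝ} (hw : 0 < w.2) :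
    withInitial g U w = U (pr w.1 w.2) := if_pos hw

theorem withInitial_zero (g : Euc n → ℝ) (U : SpT n → ℝ) (x : Euc n) :
    withInitial g U (x, 0) = g x := if_neg (lt_irrefl _)

theorem withInitial_modulus {Hb : Euc n → ℝ → ℝ} (hHb : EffHam Hb) {g : Euc n → ℝ}
    (hg : QuadMod g) {U : SpT n → ℝ} (hU : EffSub Hb g U) (hV : EffSup Hb g U) {η : ℝ}
    (hη : 0 < η) : ∃ δ, 0 < δ ∧ ∀ x x' t t', 0 ≤ t → 0 ≤ t' → ‖x - x'‖ ≤ δ → |t - t'| ≤ δ →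
      withInitial g U (x, t) ≤ withInitial g U (x', t') + η := by
  obtain ⟨δ, hδ, hgδ⟩ := hg.exists_delta (show 0 < η / 2 by linarith)
  obtain ⟨K, hK, hK1, hK2⟩ := effSoln_time_modulus hHb hg hU hV (show 0 < η / 4 by linarith)
  have hspace : ∀ x x' t, 0 ≤ t → ‖x - x'‖ ≤ δ →
      withInitial g U (x, t) ≤ withInitial g U (x', t) + η / 2 := by
    intro x x' t ht hx
    rcases ht.eq_or_lt with rfl | ht
    · simpa only [withInitial_zero] using hgδ x x' hx
    · rw [withInitial_of_pos _ _ ht, withInitial_of_pos _ _ ht]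
      have := effSoln_le_add_space hHb hg hU hV (h := x - x') (d := η / 2) (by linarith)
        (fun y => hgδ _ _ (by rwa [add_sub_cancel_left])) (z := pr x' t) ht
      rwa [← pr_add, add_sub_cancel, add_zero] at this
  have htime : ∀ x t τ, 0 ≤ t → 0 ≤ τ → τ ≤ 1 →
      |withInitial g U (x, t + τ) - withInitial g U (x, t)| ≤ η / 4 + K * τ := by
    intro x t τ ht hτ hτ1
    rcases ht.eq_or_lt with rfl | ht
    · rw [zero_add, withInitial_zero]
      rcases hτ.eq_or_lt with rfl | hτ
      · rw [withInitial_zero, sub_self, abs_zero]; linarith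
      · rw [withInitial_of_pos _ _ hτ]
        exact hK2 (pr x τ) hτ hτ1
    · rw [withInitial_of_pos _ _ (add_pos_of_pos_of_nonneg ht hτ),
        withInitial_of_pos _ _ (w := (x, t)) ht]
      have := hK1 τ (pr x t) hτ hτ1 ht
      rwa [← pr_add, add_zero] at this
  refine ⟨min δ (min 1 (η / (4 * K))), by positivity, fun x x' t t' ht ht' hx htt => ?_⟩
  have h1 := hspace x x' t ht (hx.trans (min_le_left _ _))
  have h2 : |t - t'| ≤ 1 := htt.trans ((min_le_right _ _).trans (min_le_left _ _))
  have h3 : K * |t - t'| ≤ η / 4 := by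
    refine (mul_le_mul_of_nonneg_left
      (htt.trans ((min_le_right _ _).trans (min_le_right _ _))) hK.le).trans_eq ?_
    field_simp
  have h4 : withInitial g U (x', t) ≤ withInitial g U (x', t') + η / 2 := by
    rcases le_total t t' with h | h
    · rw [abs_sub_comm, abs_of_nonneg (sub_nonneg.2 h)] at h2 h3
      have := htime x' t (t' - t) ht (sub_nonneg.2 h) h2
      rw [add_sub_cancel, _root_.abs_le] at this
      linarith
    · rw [abs_of_nonneg (sub_nonneg.2 h)] at h2 h3
      have := htime x' t' (t - t') ht' (sub_nonneg.2 h) h2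
      rw [add_sub_cancel, _root_.abs_le] at this
      linarith
  linarith

theorem isEffSoln_withInitial {Hb : Euc n → ℝ → ℝ} (hHb : EffHam Hb) {g : Euc n → ℝ}
    (hg : QuadMod g) {B : ℝ} (hB : ∀ x, |g x| ≤ B) {U : SpT n → ℝ} (hU : EffSub Hb g U)
    (hV : EffSup Hb g U) : IsEffSoln Hb g (withInitial g U) := by
  have hcongr : ∀ z : SpT n, 0 < z.snd → onSpT (withInitial g U) z = U z := fun z hz =>
    withInitial_of_pos g U (w := (z.fst, z.snd)) hz
  refine ⟨fun T _ => ⟨?_, ?_⟩, isParSubOn1_of_jet1Sub (hU.sub.congr hcongr),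
    isParSupOn1_of_jet1Sup (hV.sup.congr hcongr), withInitial_zero g U⟩
  · obtain ⟨B', hB'⟩ := hU.bdd T
    refine ⟨max B B', fun x t ht => ?_⟩
    rcases ht.1.eq_or_lt with rfl | h0
    · rw [withInitial_zero]
      exact (hB x).trans (le_max_left _ _)
    · rw [withInitial_of_pos _ _ h0]
      exact (hB' (pr x t) h0 ht.2.le).trans (le_max_right _ _)
  · rw [Metric.uniformContinuousOn_iff]
    intro η hη
    obtain ⟨δ, hδ, h⟩ := withInitial_modulus hHb hg hU hV (show 0 < η / 2 by linarith)
    refine ⟨δ, hδ, fun w hw w' hw' hd => ?_⟩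
    rw [Prod.dist_eq, max_lt_iff, dist_eq_norm, Real.dist_eq] at hd
    have h1 := h w.1 w'.1 w.2 w'.2 hw.2.1 hw'.2.1 hd.1.le hd.2.le
    have h2 := h w'.1 w.1 w'.2 w.2 hw'.2.1 hw.2.1 (by rw [norm_sub_rev]; exact hd.1.le)
      (by rw [abs_sub_comm]; exact hd.2.le)
    rw [Real.dist_eq, _root_.abs_lt]
    constructor <;> linarith

theorem continuousAt_onSpT {u : Euc n × ℝ → ℝ} {z : SpT n}
    (h : ContinuousAt u (z.fst, z.snd)) : ContinuousAt (onSpT u) z :=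
  ContinuousAt.comp (f := fun z : SpT n => (z.fst, z.snd)) h
    (continuous_fst'.prodMk continuous_snd').continuousAt

theorem IsEffSoln.continuousAt {Hb : Euc n → ℝ → ℝ} {g : Euc n → ℝ} {u : Euc n × ℝ → ℝ}
    (h : IsEffSoln Hb g u) {w : Euc n × ℝ} (hw : 0 < w.2) : ContinuousAt u w := by
  refine ((h.1 (w.2 + 1) (by linarith)).2.continuousOn).continuousAt ?_
  refine mem_of_superset ((isOpen_univ.prod (isOpen_Ioo (a := (0 : ℝ)) (b := w.2 + 1))).mem_nhds
    ⟨Set.mem_univ _, hw, by linarith⟩) (Set.prod_mono le_rfl Set.Ioo_subset_Ico_self)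

theorem IsEffSoln.abs_sub_le {Hb : Euc n → ℝ → ℝ} {g : Euc n → ℝ} {u : Euc n × ℝ → ℝ}
    (h : IsEffSoln Hb g u) {T η : ℝ} (hT : 0 < T) (hη : 0 < η) : ∃ K, 0 < K ∧ ∀ x t, 0 < t →
      t ≤ T → |u (x, t) - g x| ≤ η + K * t := by
  obtain ⟨⟨B, hB⟩, huc⟩ := h.1 (T + 1) (by linarith)
  obtain ⟨δ, hδ, hδ'⟩ := Metric.uniformContinuousOn_iff.1 huc η hη
  have hB0 : 0 ≤ B := (abs_nonneg _).trans (hB 0 0 ⟨le_rfl, by linarith⟩)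
  refine ⟨(2 * B + 1) / δ, by positivity, fun x t h0 h1 => ?_⟩
  rw [← h.2.2.2 x]
  rcases lt_or_ge t δ with ht | ht
  · have := hδ' (x, t) ⟨Set.mem_univ _, h0.le, by linarith⟩ (x, 0)
      ⟨Set.mem_univ _, le_rfl, by linarith⟩ (by
        rw [Prod.dist_eq, dist_self, Real.dist_eq, sub_zero, abs_of_pos h0]
        exact max_lt hδ ht)
    rw [Real.dist_eq] at this
    have h3 : 0 ≤ (2 * B + 1) / δ * t := by positivity
    linarith
  · have h2 : 2 * B + 1 ≤ (2 * B + 1) / δ * t := by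
      rw [div_mul_eq_mul_div, le_div_iff₀ hδ]
      exact mul_le_mul_of_nonneg_left ht (by linarith)
    have h3 := abs_sub (u (x, t)) (u (x, 0))
    linarith [hB x t ⟨h0.le, by linarith⟩, hB x 0 ⟨le_rfl, by linarith⟩]

theorem IsEffSoln.effSub {Hb : Euc n → ℝ → ℝ} {g : Euc n → ℝ} {u : Euc n × ℝ → ℝ}
    (h : IsEffSoln Hb g u) : EffSub Hb g (onSpT u) where
  usc z hz c hc := by
    filter_upwards [(continuousAt_onSpT (h.continuousAt hz)).eventually (gt_mem_nhds hc)] with w hw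
    exact le_of_lt hw
  bdd T := by
    obtain ⟨B, hB⟩ := (h.1 (|T| + 1) (by positivity)).1
    exact ⟨B, fun z h0 h1 => hB _ _ ⟨h0.le, by linarith [le_abs_self T]⟩⟩
  sub := jet1Sub_of_isParSubOn1 h.2.1
  ini T η hT hη := by
    obtain ⟨K, hK, h'⟩ := h.abs_sub_le hT hη
    exact ⟨K, hK, fun z h0 h1 => by
      have := (_root_.abs_le.1 (h' z.fst z.snd h0 h1)).2
      rw [onSpT]; linarith⟩

theorem IsEffSoln.effSup {Hb : Euc n → ℝ → ℝ} {g : Euc n → ℝ} {u : Euc n × ℝ → ℝ}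
    (h : IsEffSoln Hb g u) : EffSup Hb g (onSpT u) where
  lsc z hz c hc := by
    filter_upwards [(continuousAt_onSpT (h.continuousAt hz)).eventually (lt_mem_nhds hc)] with w hw
    exact le_of_lt hw
  bdd := h.effSub.bdd
  sup := jet1Sup_of_isParSupOn1 h.2.2.1
  ini T η hT hη := by
    obtain ⟨K, hK, h'⟩ := h.abs_sub_le hT hη
    exact ⟨K, hK, fun z h0 h1 => by
      have := (_root_.abs_le.1 (h' z.fst z.snd h0 h1)).1
      rw [onSpT]; linarith⟩

theorem IsEffSoln.unique {Hb : Euc n → ℝ → ℝ} (hHb : EffHam Hb) {g : Euc n → ℝ} (hg : QuadMod g)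
    {u u' : Euc n × ℝ → ℝ} (h : IsEffSoln Hb g u) (h' : IsEffSoln Hb g u') {x : Euc n} {t : ℝ}
    (ht : 0 ≤ t) : u' (x, t) = u (x, t) := by
  rcases ht.eq_or_lt with rfl | ht
  · rw [h.2.2.2, h'.2.2.2]
  · exact le_antisymm (h'.effSub.le hHb hg h.effSup (z := pr x t) ht)
      (h.effSub.le hHb hg h'.effSup (z := pr x t) ht)

end EffectiveSolution

section Collapse

variable {n m : ℕ}

theorem iInf_le_apply (u₀ : Fin (m + 1) → Euc n → ℝ) (k : Fin (m + 1)) (x : Euc n) :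
    ⨅ k, u₀ k x ≤ u₀ k x := ciInf_le (Set.finite_range _).bddBelow k

theorem exists_eq_iInf (u₀ : Fin (m + 1) → Euc n → ℝ) (x : Euc n) :
    ∃ k, u₀ k x = ⨅ k, u₀ k x := exists_eq_ciInf_of_finite

theorem abs_iInf_le {u₀ : Fin (m + 1) → Euc n → ℝ} {B : ℝ} (hB : ∀ k x, |u₀ k x| ≤ B) (x : Euc n) :
    |⨅ k, u₀ k x| ≤ B := by
  obtain ⟨k, hk⟩ := exists_eq_iInf u₀ x
  rw [← hk]
  exact hB k x

theorem quadMod_iInf {u₀ : Fin (m + 1) → Euc n → ℝ} (huc : ∀ k, UniformContinuous (u₀ k))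
    {B : ℝ} (hB : ∀ k x, |u₀ k x| ≤ B) : QuadMod fun x => ⨅ k, u₀ k x := by
  intro η hη
  obtain ⟨Q, hQ, h⟩ := exists_quadratic_modulus huc hB hη
  refine ⟨Q, hQ, fun x y => ?_⟩
  obtain ⟨k, hk⟩ := exists_eq_iInf u₀ y
  have := iInf_le_apply u₀ k x
  simp only [← hk]
  linarith [h k x y]

theorem eventually_pos_le_one : ∀ᶠ ε in 𝓝[>] (0 : ℝ), 0 < ε ∧ ε ≤ 1 := by
  filter_upwards [Ioo_mem_nhdsGT (show (0 : ℝ) < 1 by norm_num)] with ε hε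
  exact ⟨hε.1, hε.2.le⟩

/-- Near a point of `{t > 0}`, for small `ε`. -/
theorem eventually_eps_nhds {z : SpT n} (hz : 0 < z.snd) {T : ℝ} (hT : z.snd < T) :
    ∀ᶠ q : ℝ × SpT n in 𝓝[>] (0 : ℝ) ×ˢ 𝓝 z,
      (0 < q.1 ∧ q.1 ≤ 1) ∧ z.snd / 2 < q.2.snd ∧ q.2.snd < T := by
  have h : ∀ᶠ z' : SpT n in 𝓝 z, z.snd / 2 < z'.snd ∧ z'.snd < T :=
    ((continuous_snd'.tendsto z).eventually (lt_mem_nhds (by linarith))).and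
      ((continuous_snd'.tendsto z).eventually (gt_mem_nhds hT))
  exact eventually_pos_le_one.prod_mk h

variable {S : Setting n (m + 1)} {ω : S.Ω} {u₀ : Fin (m + 1) → Euc n → ℝ}
  {u : ℝ → Fin (m + 1) → Euc n × ℝ → ℝ}

theorem eventually_eps_bound (hu : ∀ ε, 0 < ε → IsEpsSoln S ε ω u₀ (u ε)) {B : ℝ}
    (hB : ∀ k x, |u₀ k x| ≤ B) : ∃ K, 0 < K ∧ ∀ z : SpT n, 0 < z.snd →
      ∀ᶠ q in 𝓝[>] (0 : ℝ) ×ˢ 𝓝 z, ∀ k, |onSpT (u q.1 k) q.2| ≤ B + K * (z.snd + 1) := by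
  obtain ⟨K, hK, h⟩ := exists_eps_bound S hB
  refine ⟨K, hK, fun z hz => ?_⟩
  filter_upwards [eventually_eps_nhds hz (lt_add_one _)] with q hq k
  have := h ω q.1 (u q.1) hq.1.1 hq.1.2 (hu _ hq.1.1) k q.2.fst q.2.snd (by linarith [hq.2.1])
  rw [onSpT]
  have := mul_le_mul_of_nonneg_left hq.2.2.le hK.le
  linarith

theorem effSub_of_isUpperLim {Hb : Euc n → ℝ → ℝ}
    {w : Euc n → ℝ → ℝ → Fin (m + 1) → Euc n → ℝ} (hw : MacroConv S ω Hb w)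
    (huc : ∀ k, UniformContinuous (u₀ k)) {B : ℝ} (hB : ∀ k x, |u₀ k x| ≤ B)
    (hu : ∀ ε, 0 < ε → IsEpsSoln S ε ω u₀ (u ε)) {U : SpT n → ℝ}
    (hU : IsUpperLim (fun ε k => onSpT (u ε k)) U) : EffSub Hb (fun x => ⨅ k, u₀ k x) U where
  usc z hz c hc := hU.eventually_le hz hc
  bdd T := by
    obtain ⟨K, hK, h⟩ := eventually_eps_bound hu hB
    refine ⟨B + K * (T + 1), fun z h0 h1 => ?_⟩
    have h2 := mul_le_mul_of_nonneg_left h1 hK.le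
    have h3 := hU.le h0 (c := B + K * (z.snd + 1)) (by
      filter_upwards [h z h0] with q hq k using (_root_.abs_le.1 (hq k)).2)
    have h4 := hU.ge h0 (c := -(B + K * (z.snd + 1))) (by
      filter_upwards [h z h0] with q hq using ⟨0, (_root_.abs_le.1 (hq 0)).1⟩)
    rw [_root_.abs_le]
    constructor <;> linarith
  sub := jet1Sub_of_isUpperLim hw hu hU
  ini T η hT hη := by
    obtain ⟨K, C, hK, hC, h⟩ := exists_eps_upper S huc hB (T := T + 1) (by linarith)
      (show 0 < η / 2 by linarith)
    refine ⟨K, hK, fun z h0 h1 => ?_⟩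
    obtain ⟨j, hj⟩ := exists_eq_iInf u₀ z.fst
    simp only [← hj]
    refine le_of_forall_pos_le_add fun θ hθ => ?_
    refine hU.le h0 ?_
    have e1 : Tendsto (fun ε : ℝ => 2 * B * Real.exp (-(C / ε * (z.snd / 2)))) (𝓝[>] 0) (𝓝 0) := by
      have : Tendsto (fun ε : ℝ => C * (z.snd / 2) * ε⁻¹) (𝓝[>] 0) atTop :=
        tendsto_inv_nhdsGT_zero.const_mul_atTop (by positivity)
      have := ((Real.tendsto_exp_neg_atTop_nhds_zero).comp this).const_mul (2 * B)
      rw [mul_zero] at this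
      refine this.congr fun ε => ?_
      simp only [Function.comp_apply]
      congr 3
      ring
    have e2 : Tendsto (fun z : SpT n => u₀ j z.fst + K * z.snd) (𝓝 z)
        (𝓝 (u₀ j z.fst + K * z.snd)) :=
      (((huc j).continuous.comp continuous_fst').add
        (continuous_const.mul continuous_snd')).tendsto z
    filter_upwards [eventually_eps_nhds h0 (show z.snd < T + 1 by linarith),
      (e1.eventually (gt_mem_nhds (show (0 : ℝ) < η / 2 by linarith))).prod_mk
        (e2.eventually (gt_mem_nhds (lt_add_of_pos_right _ hθ)))] with q hq hq' k
    have h5 := h ω q.1 (u q.1) hq.1.1 hq.1.2 (hu _ hq.1.1) k j q.2.fst q.2.snd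
      (by linarith [hq.2.1]) hq.2.2.le
    have hB0 : 0 ≤ B := (abs_nonneg _).trans (hB 0 0)
    have h6 : 2 * B * Real.exp (-(C / q.1 * q.2.snd)) ≤
        2 * B * Real.exp (-(C / q.1 * (z.snd / 2))) := by
      refine mul_le_mul_of_nonneg_left (Real.exp_le_exp.2 ?_) (by linarith)
      exact neg_le_neg (mul_le_mul_of_nonneg_left hq.2.1.le (div_pos hC hq.1.1).le)
    rw [onSpT]
    linarith [hq'.1, hq'.2]

theorem effSup_of_isUpperLim_neg {Hb : Euc n → ℝ → ℝ}
    {w : Euc n → ℝ → ℝ → Fin (m + 1) → Euc n → ℝ} (hw : MacroConv S ω Hb w)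
    (huc : ∀ k, UniformContinuous (u₀ k)) {B : ℝ} (hB : ∀ k x, |u₀ k x| ≤ B)
    (hu : ∀ ε, 0 < ε → IsEpsSoln S ε ω u₀ (u ε)) {V : SpT n → ℝ}
    (hV : IsUpperLim (fun ε k z => -onSpT (u ε k) z) fun z => -V z) :
    EffSup Hb (fun x => ⨅ k, u₀ k x) V where
  lsc z hz c hc := by
    filter_upwards [hV.eventually_le hz (c := -c) (neg_lt_neg hc)] with w hw
    exact neg_le_neg_iff.1 hw
  bdd T := by
    obtain ⟨K, hK, h⟩ := eventually_eps_bound hu hB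
    refine ⟨B + K * (T + 1), fun z h0 h1 => ?_⟩
    have h2 := mul_le_mul_of_nonneg_left h1 hK.le
    have h3 := hV.le h0 (c := B + K * (z.snd + 1)) (by
      filter_upwards [h z h0] with q hq k
      linarith [(_root_.abs_le.1 (hq k)).1])
    have h4 := hV.ge h0 (c := -(B + K * (z.snd + 1))) (by
      filter_upwards [h z h0] with q hq
      exact ⟨0, neg_le_neg (_root_.abs_le.1 (hq 0)).2⟩)
    rw [_root_.abs_le]
    constructor <;> linarith
  sup := jet1Sup_of_isUpperLim_neg hw hu hV
  ini T η hT hη := by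
    obtain ⟨K, hK, h⟩ := exists_eps_lower S huc hB (T := T + 1) (by linarith)
      (show 0 < η / 2 by linarith)
    obtain ⟨δ, hδ, hgδ⟩ := (quadMod_iInf huc hB).exists_delta (show 0 < η / 2 by linarith)
    refine ⟨K, hK, fun z h0 h1 => ?_⟩
    refine neg_le_neg_iff.1 (le_of_forall_pos_le_add fun θ hθ => ?_)
    refine hV.le h0 ?_
    have e1 : ∀ᶠ z' in 𝓝 z, ‖z.fst - z'.fst‖ ≤ δ := by
      have : Tendsto (fun z' : SpT n => ‖z.fst - z'.fst‖) (𝓝 z) (𝓝 0) :=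
        (continuous_const.sub continuous_fst').norm.tendsto' _ _ (by simp)
      filter_upwards [this.eventually (gt_mem_nhds hδ)] with z' hz' using hz'.le
    have e2 : Tendsto (fun z : SpT n => K * z.snd) (𝓝 z) (𝓝 (K * z.snd)) :=
      (continuous_const.mul continuous_snd').tendsto z
    filter_upwards [eventually_eps_nhds h0 (show z.snd < T + 1 by linarith),
      (e1.and (e2.eventually (gt_mem_nhds (lt_add_of_pos_right _ hθ)))).prod_inr _] with q hq hq' k
    have h5 := h ω q.1 (u q.1) hq.1.1 hq.1.2 (hu _ hq.1.1) k q.2.fst q.2.snd _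
      (by linarith [hq.2.1]) hq.2.2.le (fun j => iInf_le_apply u₀ j q.2.fst)
    have h6 := hgδ _ _ hq'.1
    rw [onSpT]
    linarith [hq'.2]

/-- The relaxed limits of the ε-solutions are a subsolution and a supersolution. -/
theorem exists_relaxed_limits {Hb : Euc n → ℝ → ℝ}
    {w : Euc n → ℝ → ℝ → Fin (m + 1) → Euc n → ℝ} (hw : MacroConv S ω Hb w)
    (huc : ∀ k, UniformContinuous (u₀ k)) {B : ℝ} (hB : ∀ k x, |u₀ k x| ≤ B)
    (hu : ∀ ε, 0 < ε → IsEpsSoln S ε ω u₀ (u ε)) : ∃ U V : SpT n → ℝ,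
      IsUpperLim (fun ε k => onSpT (u ε k)) U ∧
      IsUpperLim (fun ε k z => -onSpT (u ε k) z) (fun z => -V z) ∧
      EffSub Hb (fun x => ⨅ k, u₀ k x) U ∧ EffSup Hb (fun x => ⨅ k, u₀ k x) V := by
  obtain ⟨K, hK, h⟩ := eventually_eps_bound hu hB
  obtain ⟨U, hU⟩ := exists_isUpperLim (W := fun ε k => onSpT (u ε k)) fun z hz => ⟨_, h z hz⟩
  obtain ⟨V, hV⟩ := exists_isUpperLim (W := fun ε k z => -onSpT (u ε k) z) fun z hz =>
    ⟨_, (h z hz).mono fun q hq k => by rw [abs_neg]; exact hq k⟩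
  have hV' : IsUpperLim (fun ε k z => -onSpT (u ε k) z) (fun z => -(-V z)) := by
    simpa only [neg_neg] using hV
  exact ⟨U, fun z => -V z, hU, hV', effSub_of_isUpperLim hw huc hB hu hU,
    effSup_of_isUpperLim_neg hw huc hB hu hV'⟩

theorem IsUpperLim.congr {W : ℝ → Fin (m + 1) → SpT n → ℝ} {U V : SpT n → ℝ}
    (hU : IsUpperLim W U) (h : ∀ z, 0 < z.snd → V z = U z) : IsUpperLim W V := by
  intro z hz
  rw [h z hz]
  exact hU z hz

theorem tendstoLocallyUniformlyOn_of_isUpperLim {W : SpT n → ℝ} {f : Euc n × ℝ → ℝ}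
    (hf : ∀ w : Euc n × ℝ, 0 < w.2 → f w = W (pr w.1 w.2) ∧ ContinuousAt f w)
    (hU : IsUpperLim (fun ε k => onSpT (u ε k)) W)
    (hV : IsUpperLim (fun ε k z => -onSpT (u ε k) z) fun z => -W z) (k : Fin (m + 1)) :
    TendstoLocallyUniformlyOn (fun ε => u ε k) f (𝓝[>] (0 : ℝ))
      (Set.univ ×ˢ Set.Ioi (0 : ℝ)) := by
  rw [tendstoLocallyUniformlyOn_iff_forall_tendsto]
  intro w hw
  have hw0 : 0 < w.2 := hw.2
  obtain ⟨hfw, hcont⟩ := hf w hw0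
  have hpr : Tendsto (fun q : ℝ × (Euc n × ℝ) => (q.1, (pr q.2.1 q.2.2 : SpT n)))
      (𝓝[>] (0 : ℝ) ×ˢ 𝓝 w) (𝓝[>] (0 : ℝ) ×ˢ 𝓝 (pr w.1 w.2)) :=
    tendsto_id.prodMap (continuous_pr.tendsto w)
  rw [tendsto_uniformity_iff_dist_tendsto_zero]
  refine Tendsto.mono_left ?_ (Filter.prod_mono le_rfl (nhdsWithin_le_nhds (a := w)))
  rw [Metric.tendsto_nhds]
  intro η hη
  filter_upwards [hpr.eventually ((hU (pr w.1 w.2) hw0).1 (f w + η / 2) (by linarith)),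
    hpr.eventually ((hV (pr w.1 w.2) hw0).1 (-(f w) + η / 2) (by linarith)),
    (Metric.tendsto_nhds.1 hcont (η / 2) (by linarith)).prod_inr _] with q h1 h2 h3
  have h1' : u q.1 k q.2 < f w + η / 2 := h1 k
  have h2' : -u q.1 k q.2 < -(f w) + η / 2 := h2 k
  rw [Real.dist_eq, _root_.abs_lt] at h3
  rw [dist_zero_right, Real.norm_eq_abs, abs_dist, Real.dist_eq, _root_.abs_lt]
  constructor <;> linarith [h3.1, h3.2]

end Collapse

/-- Main theorem: homogenization and collapse.  On the full-probability set `Ω₃`, every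
component of the solution of the ε-system converges, locally uniformly on `ℝⁿ × (0, ∞)`,
to the unique solution of the effective scalar equation with initial datum
`u̲₀ = min_k u_{k,0}`. -/
theorem stmt19 {n m : ℕ} (S : Setting n (m + 1))
    (v : Euc n → ℝ → ℝ → S.Ω → Fin (m + 1) → Euc n → ℝ)
    (hv : ∀ (p : Euc n) (r δ : ℝ), 0 < δ → ∀ ω, IsMacroSoln S p r δ ω (v p r δ ω))
    (Hbar : Euc n → ℝ → ℝ)
    (hHbar : ∀ (p : Euc n) (r : ℝ), ∀ᵐ ω ∂S.P,
      Hbar p r = Filter.limsup (fun δ : ℝ => -(δ * v p r δ ω 0 0)) (𝓝[>] (0 : ℝ)))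
    (Ω₃ : Set S.Ω) (hΩ₃meas : MeasurableSet Ω₃) (hΩ₃prob : S.P Ω₃ = 1)
    (hΩ₃ : ∀ R : ℝ, 0 < R → ∀ (p : Euc n) (r : ℝ), ∀ ω ∈ Ω₃,
      Tendsto (fun δ : ℝ => ⨆ y ∈ Metric.ball (0 : Euc n) (R / δ),
        |δ * v p r δ ω 0 y + Hbar p r|) (𝓝[>] (0 : ℝ)) (𝓝 0))
    (u₀ : Fin (m + 1) → Euc n → ℝ)
    (hu₀uc : ∀ k, UniformContinuous (u₀ k)) (hu₀b : ∃ B : ℝ, ∀ k x, |u₀ k x| ≤ B)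
    (u : ℝ → S.Ω → Fin (m + 1) → Euc n × ℝ → ℝ)
    (hu : ∀ ε : ℝ, 0 < ε → ∀ ω : S.Ω, IsEpsSoln S ε ω u₀ (u ε ω)) :
    ∃ ubar : Euc n × ℝ → ℝ,
      IsEffSoln Hbar (fun x => ⨅ k, u₀ k x) ubar ∧
      (∀ u' : Euc n × ℝ → ℝ, IsEffSoln Hbar (fun x => ⨅ k, u₀ k x) u' →
        ∀ x t, 0 ≤ t → u' (x, t) = ubar (x, t)) ∧
      ∀ ω ∈ Ω₃, ∀ k : Fin (m + 1),
        TendstoLocallyUniformlyOn (fun ε => u ε ω k) ubar (𝓝[>] (0 : ℝ))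
          (Set.univ ×ˢ Set.Ioi (0 : ℝ)) := by
  obtain ⟨B, hB⟩ := hu₀b
  have hw : ∀ ω ∈ Ω₃, MacroConv S ω Hbar fun p r δ => v p r δ ω := fun ω hω =>
    MacroConv.of_tendsto (fun p r δ hδ => hv p r δ hδ ω) fun R hR p r => hΩ₃ R hR p r ω hω
  obtain ⟨ω₀, hω₀⟩ : Ω₃.Nonempty := by
    refine MeasureTheory.nonempty_of_measure_ne_zero (μ := S.P) ?_
    rw [hΩ₃prob]
    exact one_ne_zero
  have hHb : EffHam Hbar := fun R hR => (hw ω₀ hω₀).le_add hR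
  have hg := quadMod_iInf hu₀uc hB
  have hlim := fun ω hω =>
    exists_relaxed_limits (hw ω hω) hu₀uc hB (u := fun ε => u ε ω) fun ε hε => hu ε hε ω
  obtain ⟨U, V, hU, hV, hsub, hsup⟩ := hlim ω₀ hω₀
  have hVU : ∀ z, 0 < z.snd → U z = V z := fun z hz =>
    le_antisymm (hsub.le hHb hg hsup hz) (hU.neg_le hV hz)
  have hsup' := hsup.congr hVU
  have hsol := isEffSoln_withInitial hHb hg (abs_iInf_le hB) hsub hsup'
  refine ⟨_, hsol, fun u' hu' x t ht => hsol.unique hHb hg hu' ht, fun ω hω k => ?_⟩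
  obtain ⟨U', V', hU', hV', hsub', hsup''⟩ := hlim ω hω
  have h1 : ∀ z, 0 < z.snd → V' z = U' z := fun z hz =>
    le_antisymm (hU'.neg_le hV' hz) (hsub'.le hHb hg hsup'' hz)
  have h2 : ∀ z, 0 < z.snd → U z = U' z := fun z hz =>
    le_antisymm ((hsub.le hHb hg hsup'' hz).trans_eq (h1 z hz)) (hsub'.le hHb hg hsup' hz)
  refine tendstoLocallyUniformlyOn_of_isUpperLim (W := U') (fun y hy => ⟨?_, hsol.continuousAt hy⟩)
    hU' (hV'.congr fun z hz => ?_) k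
  · rw [withInitial_of_pos _ _ hy, h2 (pr y.1 y.2) hy]
  · rw [h1 z hz]
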